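/- Let 1 < p ≤ q < ∞, let ν be a radial weight in the Bekollé–Bonami class B_q, let ω ∈ D be a radial weight, and let f: 𝔻 → ℂ be continuous with sup_{z∈𝔻} Ω_r f(z)·γ(z) < ∞ for some r > 0. Then the Hankel operator H^ν_f is bounded from A^p_ω to L^q_ν: there is C > 0 such that ∥H^ν_f(g)∥_{L^q_ν} ≤ C ∥g∥_{A^p_ω} for all g ∈ H^∞. -/

import Mathlib

open MeasureTheory Set
open scoped ENNReal ComplexConjugate

noncomputable section

/-- The open unit disc in `ℂ`. -/
def UD : Set ℂ := Metric.ball (0 : ℂ) 1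

/-- Normalized area measure `dA = dx dy / π` on `ℂ`. -/
def dA : Measure ℂ := (ENNReal.ofReal Real.pi)⁻¹ • (MeasureTheory.volume : Measure ℂ)

/-- `ω̂(r) = ∫_r^1 ω(s) ds` for a (radial) weight `ω : ℂ → ℝ`. -/
def what (ω : ℂ → ℝ) (r : ℝ) : ℝ := ∫ s in r..(1 : ℝ), ω (s : ℂ)

/-- A radial weight: nonnegative, radial, integrable over the unit disc. -/
def RadialWeight (ω : ℂ → ℝ) : Prop :=
  (∀ z, 0 ≤ ω z) ∧ (∀ z : ℂ, ω z = ω ((‖z‖ : ℝ) : ℂ)) ∧ IntegrableOn ω UD dA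

/-- `ω̂ > 0` on `[0,1)`. -/
def WhatPos (ω : ℂ → ℝ) : Prop := ∀ r : ℝ, 0 ≤ r → r < 1 → 0 < what ω r

/-- The class `D̂`. -/
def Dhat (ω : ℂ → ℝ) : Prop :=
  ∃ C > (1 : ℝ), ∀ r : ℝ, 0 ≤ r → r < 1 → what ω r ≤ C * what ω ((1 + r) / 2)

/-- The class `Ď`. -/
def Dcheck (ω : ℂ → ℝ) : Prop :=
  ∃ K > (1 : ℝ), ∃ C > (1 : ℝ), ∀ r : ℝ, 0 ≤ r → r < 1 →
    C * what ω (1 - (1 - r) / K) ≤ what ω r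

/-- The class `D = D̂ ∩ Ď`. -/
def Dclass (ω : ℂ → ℝ) : Prop := Dhat ω ∧ Dcheck ω

/-- A `Ď`-exponent `α > 0` for `ω`: `ω̂(t) ≤ C ((1-t)/(1-r))^α ω̂(r)` for `0 ≤ r ≤ t < 1`. -/
def DcheckExp (ω : ℂ → ℝ) (α : ℝ) : Prop :=
  ∃ C > (0 : ℝ), ∀ r t : ℝ, 0 ≤ r → r ≤ t → t < 1 →
    what ω t ≤ C * ((1 - t) / (1 - r)) ^ α * what ω r

/-- A `D̂`-exponent `β > 0` for `ω`: `ω̂(r) ≤ C ((1-r)/(1-t))^β ω̂(t)` for `0 ≤ r ≤ t < 1`. -/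
def DhatExp (ω : ℂ → ℝ) (β : ℝ) : Prop :=
  ∃ C > (0 : ℝ), ∀ r t : ℝ, 0 ≤ r → r ≤ t → t < 1 →
    what ω r ≤ C * ((1 - r) / (1 - t)) ^ β * what ω t

/-- Weighted `L^p` "norm" over the unit disc. -/
def wnorm (p : ℝ) (ω : ℂ → ℝ) (f : ℂ → ℂ) : ℝ :=
  (∫ z in UD, ‖f z‖ ^ p * ω z ∂dA) ^ (1 / p)

/-- Membership in the weighted Lebesgue space `L^p_ω`. -/
def MemLw (p : ℝ) (ω : ℂ → ℝ) (f : ℂ → ℂ) : Prop :=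
  AEStronglyMeasurable f (dA.restrict UD) ∧
  IntegrableOn (fun z => ‖f z‖ ^ p * ω z) UD dA

/-- Membership in the weighted Bergman space `A^p_ω`. -/
def MemAp (p : ℝ) (ω : ℂ → ℝ) (f : ℂ → ℂ) : Prop :=
  DifferentiableOn ℂ f UD ∧ IntegrableOn (fun z => ‖f z‖ ^ p * ω z) UD dA

/-- `H^∞`: bounded analytic functions on the unit disc. -/
def Hinfty (f : ℂ → ℂ) : Prop :=
  DifferentiableOn ℂ f UD ∧ ∃ M : ℝ, ∀ z ∈ UD, ‖f z‖ ≤ M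

/-- Moments `ν_x = ∫_0^1 t^x ν(t) dt`. -/
def mom (ν : ℂ → ℝ) (x : ℝ) : ℝ := ∫ t in (0 : ℝ)..1, t ^ x * ν (t : ℂ)

/-- The Bergman reproducing kernel of `A²_ν`. -/
def Bker (ν : ℂ → ℝ) (z ζ : ℂ) : ℂ :=
  ∑' n : ℕ, (ζ * conj z) ^ n / (((2 * mom ν (2 * (n : ℝ) + 1) : ℝ)) : ℂ)

/-- The Bergman projection `P_ν`. -/
def Pw (ν : ℂ → ℝ) (f : ℂ → ℂ) (z : ℂ) : ℂ :=
  ∫ ζ in UD, f ζ * conj (Bker ν z ζ) * ((ν ζ : ℝ) : ℂ) ∂dA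

/-- The Hankel operator `H_f^ν(g) = f g − P_ν(f g)`. -/
def Hankel (ν : ℂ → ℝ) (f g : ℂ → ℂ) (z : ℂ) : ℂ :=
  f z * g z - Pw ν (fun ζ => f ζ * g ζ) z

/-- The standard weighted Bergman projection `P_η`. -/
def Pstd (η : ℝ) (f : ℂ → ℂ) (z : ℂ) : ℂ :=
  (((η + 1 : ℝ)) : ℂ) *
    ∫ ζ in UD, f ζ * (((1 - ‖ζ‖ ^ 2) ^ η : ℝ) : ℂ) *
      (1 - z * conj ζ) ^ (((-(2 + η) : ℝ)) : ℂ) ∂dA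

/-- The Bekollé–Bonami class `B_q` (for radial weights). -/
def Bq (q : ℝ) (ν : ℂ → ℝ) : Prop :=
  ∃ η > (-1 : ℝ), ∃ C > (0 : ℝ), ∀ f : ℂ → ℂ, MemLw q ν f →
    wnorm q ν (Pstd η f) ≤ C * wnorm q ν f

/-- Pseudo-hyperbolic distance. -/
def pd (z ζ : ℂ) : ℝ := ‖(z - ζ) / (1 - conj z * ζ)‖

/-- Hyperbolic distance `β(z,ζ)`. -/
def hyp (z ζ : ℂ) : ℝ := (1 / 2) * Real.log ((1 + pd z ζ) / (1 - pd z ζ))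

/-- The hyperbolic disc `Δ(z,r)`. -/
def hDisc (z : ℂ) (r : ℝ) : Set ℂ := {ζ ∈ UD | hyp z ζ < r}

/-- `ν(Δ(z,r))`. -/
def nuD (ν : ℂ → ℝ) (z : ℂ) (r : ℝ) : ℝ := ∫ ζ in hDisc z r, ν ζ ∂dA

/-- The function `γ(z)`. -/
def gam (ω ν : ℂ → ℝ) (p q : ℝ) (z : ℂ) : ℝ :=
  (what ν ‖z‖) ^ (1 / q) * (1 - ‖z‖) ^ (1 / q) /
    ((what ω ‖z‖) ^ (1 / p) * (1 - ‖z‖) ^ (1 / p))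

/-- The average `f̂_{r,ν}(z)`. -/
def havg (ν : ℂ → ℝ) (r : ℝ) (f : ℂ → ℂ) (z : ℂ) : ℂ :=
  (∫ ζ in hDisc z r, ν ζ • f ζ ∂dA) / ((nuD ν z r : ℝ) : ℂ)

/-- The mean oscillation `MO_{ν,q,r}(f)(z)`. -/
def MO (ν : ℂ → ℝ) (q r : ℝ) (f : ℂ → ℂ) (z : ℂ) : ℝ :=
  ((∫ ζ in hDisc z r, ‖f ζ - havg ν r f z‖ ^ q * ν ζ ∂dA) / nuD ν z r) ^ (1 / q)

/-- Finiteness of the `BMO(Δ)_{ω,ν,p,q,r}` norm. -/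
def BMOfin (ω ν : ℂ → ℝ) (p q r : ℝ) (f : ℂ → ℂ) : Prop :=
  ∃ M : ℝ, ∀ z ∈ UD, MO ν q r f z * gam ω ν p q z ≤ M

/-- Boundedness of the Hankel operator `H_f^ν : A^p_ω → L^q_ν` tested on `H^∞`. -/
def HankelBdd (p q : ℝ) (ω ν : ℂ → ℝ) (f : ℂ → ℂ) : Prop :=
  ∃ C > (0 : ℝ), ∀ g : ℂ → ℂ, Hinfty g → wnorm q ν (Hankel ν f g) ≤ C * wnorm p ω g

/-- `ω̂` extended by the convention `ω̂(t) = ω̂(0)` for `t < 0`. -/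
def whatE (ω : ℂ → ℝ) (t : ℝ) : ℝ := what ω (max t 0)

/-- The function `Γ_τ(z,ζ)`. -/
def Gam (ω ν : ℂ → ℝ) (p q τ : ℝ) (z ζ : ℂ) : ℝ :=
  ((‖1 - conj z * ζ‖ ^ 2 / max (1 - ‖z‖ ^ 2) (1 - ‖ζ‖ ^ 2)) ^ (1 / p - (τ + 1) / q) *
      whatE ω (1 - 2 * ‖1 - conj z * ζ‖ ^ 2 / max (1 - ‖z‖ ^ 2) (1 - ‖ζ‖ ^ 2)) ^ (1 / p)) /
    (min (what ν ‖z‖ / (1 - ‖z‖) ^ τ) (what ν ‖ζ‖ / (1 - ‖ζ‖) ^ τ)) ^ (1 / q)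

/-- The generalized Berezin transform `B_{ν,c,σ}(φ)(z)` of a real-valued `φ`. -/
def Ber (ν : ℂ → ℝ) (c σ : ℝ) (φ : ℂ → ℝ) (z : ℂ) : ℝ :=
  (1 - ‖z‖ ^ 2) ^ (c + 1) / what ν ‖z‖ *
    ∫ ζ in UD, φ ζ * (1 - ‖ζ‖ ^ 2) ^ σ * ‖1 - z * conj ζ‖ ^ (-(2 + c + σ)) * ν ζ ∂dA

/-- The operator `T_{b,c}`. -/
def Tbc (b c : ℝ) (f : ℂ → ℂ) (z : ℂ) : ℂ :=
  ∫ ζ in UD, f ζ * (((1 - ‖ζ‖ ^ 2) ^ b : ℝ) : ℂ) * (1 - z * conj ζ) ^ (((-c : ℝ)) : ℂ) ∂dA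

/-- The operator `S_{b,c}`. -/
def Sbc (b c : ℝ) (f : ℂ → ℂ) (z : ℂ) : ℂ :=
  ∫ ζ in UD, f ζ * ((((1 - ‖ζ‖ ^ 2) ^ b * ‖1 - z * conj ζ‖ ^ (-c)) : ℝ) : ℂ) ∂dA

/-- The standard kernel `B^η_z(ζ) = (1 − conj(z) ζ)^{−(2+η)}`. -/
def Bstd (η : ℝ) (z ζ : ℂ) : ℂ := (1 - conj z * ζ) ^ (((-(2 + η) : ℝ)) : ℂ)

/-- The normalized kernel `b^η_{z,ω}`. -/
def bnrm (p : ℝ) (ω : ℂ → ℝ) (η : ℝ) (z ζ : ℂ) : ℂ :=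
  Bstd η z ζ / ((wnorm p ω (Bstd η z) : ℝ) : ℂ)

/-- The function `g^η_{z,ω} = P_ν(conj(f) b^η_{z,ω}) / b^η_{z,ω}`. -/
def gfn (ν : ℂ → ℝ) (p : ℝ) (ω : ℂ → ℝ) (η : ℝ) (f : ℂ → ℂ) (z ζ : ℂ) : ℂ :=
  Pw ν (fun u => conj (f u) * bnrm p ω η z u) ζ / bnrm p ω η z ζ

end

/-- The measure `ν dA` on the unit disc. -/
noncomputable def diskMeasure (ν : ℂ → ℝ) : Measure ℂ :=
  (dA.restrict UD).withDensity (fun z => ENNReal.ofReal (ν z))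

/-- The measure `ν(s) ds` on `(0,1)`. -/
noncomputable def radialMeasure (ν : ℂ → ℝ) : Measure ℝ :=
  (volume.restrict (Ioo (0 : ℝ) 1)).withDensity (fun s => ENNReal.ofReal (ν (s : ℂ)))

lemma measurableSet_UD : MeasurableSet UD := Metric.isOpen_ball.measurableSet

lemma isOpen_UD : IsOpen UD := Metric.isOpen_ball

lemma mem_UD {z : ℂ} : z ∈ UD ↔ ‖z‖ < 1 := by simp [UD]

instance : SFinite dA := by unfold dA; infer_instance

lemma norm_circleMap_zero' {s : ℝ} (hs : 0 ≤ s) (θ : ℝ) : ‖circleMap 0 s θ‖ = s := by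
  rw [norm_circleMap_zero, abs_of_nonneg hs]

lemma measurable_circleMap_prod : Measurable (fun p : ℝ × ℝ => circleMap 0 p.1 p.2) := by
  unfold circleMap
  fun_prop

lemma intervalIntegrable_of_whatPos {ν : ℂ → ℝ} (h : WhatPos ν) :
    IntervalIntegrable (fun s : ℝ => ν (s : ℂ)) volume 0 1 := by
  by_contra hc
  have h0 := h 0 le_rfl one_pos
  rw [what, intervalIntegral.integral_undef hc] at h0
  exact lt_irrefl _ h0

lemma integrableOn_of_whatPos {ν : ℂ → ℝ} (h : WhatPos ν) :
    IntegrableOn (fun s : ℝ => ν (s : ℂ)) (Ioo 0 1) := by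
  have := (intervalIntegrable_iff_integrableOn_Ioo_of_le zero_le_one).1
    (intervalIntegrable_of_whatPos h)
  exact this

lemma lintegral_polar_ioo (F : ℂ → ℝ≥0∞) :
    ∫⁻ z in UD, F z = ∫⁻ p in (Ioo (0:ℝ) 1 ×ˢ Ioo (-Real.pi) Real.pi),
      ENNReal.ofReal p.1 * F (circleMap 0 p.1 p.2) := by
  rw [← lintegral_indicator measurableSet_UD, ← Complex.lintegral_comp_polarCoord_symm]
  rw [← lintegral_indicator (by exact polarCoord.open_target.measurableSet),
    ← lintegral_indicator (measurableSet_Ioo.prod measurableSet_Ioo)]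
  congr 1
  ext p
  have hp : Complex.polarCoord.symm p = circleMap 0 p.1 p.2 := by
    simp [circleMap, Complex.exp_mul_I]
  by_cases h1 : p.1 ∈ Ioi (0:ℝ) <;> by_cases h2 : p.2 ∈ Ioo (-Real.pi) Real.pi
  · have ht : p ∈ polarCoord.target := by
      simpa [polarCoord_target] using ⟨h1, h2⟩
    rw [indicator_of_mem ht, hp]
    have hn : ‖circleMap 0 p.1 p.2‖ = p.1 := norm_circleMap_zero' (le_of_lt h1) _
    by_cases h3 : p.1 < 1
    · rw [indicator_of_mem (by rw [mem_UD, hn]; exact h3),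
        indicator_of_mem (by exact ⟨⟨h1, h3⟩, h2⟩), smul_eq_mul]
    · rw [indicator_of_notMem (by rw [mem_UD, hn]; exact h3),
        indicator_of_notMem (by intro h; exact h3 h.1.2), smul_zero]
  all_goals
    rw [indicator_of_notMem, indicator_of_notMem]
    · intro h
      first
        | exact h1 h.1.1
        | exact h2 h.2
    · simp only [polarCoord_target]
      intro h
      first
        | exact h1 h.1
        | exact h2 h.2

lemma aemeasurable_radial {ν : ℂ → ℝ} (hp : WhatPos ν) :
    AEMeasurable (fun s : ℝ => ENNReal.ofReal (ν (s : ℂ))) (volume.restrict (Ioo (0:ℝ) 1)) :=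
  (integrableOn_of_whatPos hp).aemeasurable.ennreal_ofReal

lemma lintegral_diskMeasure {ν : ℂ → ℝ} (hν : RadialWeight ν) (hp : WhatPos ν)
    {F : ℂ → ℝ≥0∞} (hF : Measurable F) :
    ∫⁻ z, F z ∂(diskMeasure ν) = (ENNReal.ofReal Real.pi)⁻¹ *
      ∫⁻ θ in Ioo (-Real.pi) Real.pi, ∫⁻ s, ENNReal.ofReal s * F (circleMap 0 s θ)
        ∂(radialMeasure ν) := by
  unfold diskMeasure
  rw [lintegral_withDensity_eq_lintegral_mul₀ hν.2.2.aemeasurable.ennreal_ofReal hF.aemeasurable]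
  have h1 : dA.restrict UD = (ENNReal.ofReal Real.pi)⁻¹ • (volume.restrict UD) := by
    unfold dA
    rw [Measure.restrict_smul]
  rw [h1, lintegral_smul_measure, lintegral_polar_ioo, smul_eq_mul]
  congr 1
  rw [Measure.volume_eq_prod, ← Measure.prod_restrict]
  have h2 : ∫⁻ p, ENNReal.ofReal p.1 *
        ((fun z => ENNReal.ofReal (ν z)) * F) (circleMap 0 p.1 p.2)
        ∂((volume.restrict (Ioo (0:ℝ) 1)).prod (volume.restrict (Ioo (-Real.pi) Real.pi)))
      = ∫⁻ p, ENNReal.ofReal (ν ((p.1 : ℝ) : ℂ)) *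
          (ENNReal.ofReal p.1 * F (circleMap 0 p.1 p.2))
        ∂((volume.restrict (Ioo (0:ℝ) 1)).prod (volume.restrict (Ioo (-Real.pi) Real.pi))) := by
    rw [Measure.prod_restrict]
    refine setLIntegral_congr_fun (measurableSet_Ioo.prod measurableSet_Ioo) ?_
    intro p hp'
    have hn : ‖circleMap 0 p.1 p.2‖ = p.1 := norm_circleMap_zero' (le_of_lt hp'.1.1) _
    simp only [Pi.mul_apply]
    rw [hν.2.1 (circleMap 0 p.1 p.2), hn]
    ring
  have hm : Measurable (fun p : ℝ × ℝ => ENNReal.ofReal p.1 * F (circleMap 0 p.1 p.2)) :=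
    measurable_fst.ennreal_ofReal.mul (hF.comp measurable_circleMap_prod)
  rw [h2, lintegral_prod_symm]
  · refine lintegral_congr fun θ => ?_
    unfold radialMeasure
    rw [lintegral_withDensity_eq_lintegral_mul₀ (aemeasurable_radial hp)]
    · rfl
    · exact (hm.comp (measurable_id.prodMk measurable_const)).aemeasurable
  · exact (aemeasurable_radial hp).comp_fst.mul hm.aemeasurable

lemma radialWeight_one : RadialWeight (fun _ => 1) := by
  refine ⟨fun _ => zero_le_one, fun _ => rfl, ?_⟩
  have : dA UD < ⊤ := by
    unfold dA UD
    rw [Measure.smul_apply, smul_eq_mul]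
    refine ENNReal.mul_lt_top ?_ measure_ball_lt_top
    simp [Real.pi_pos]
  exact integrableOn_const this.ne

lemma whatPos_one : WhatPos (fun _ => 1) := by
  intro r _ h
  simp [what, h]

instance (ν : ℂ → ℝ) : SFinite (diskMeasure ν) := by
  unfold diskMeasure; infer_instance

instance (ν : ℂ → ℝ) : SFinite (radialMeasure ν) := by
  unfold radialMeasure; infer_instance

lemma diskMeasure_one : diskMeasure (fun _ => 1) = dA.restrict UD := by
  simp [diskMeasure]

lemma radialMeasure_one : radialMeasure (fun _ => 1) = volume.restrict (Ioo (0:ℝ) 1) := by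
  simp [radialMeasure]

lemma lintegral_disk {F : ℂ → ℝ≥0∞} (hF : Measurable F) :
    ∫⁻ z in UD, F z ∂dA = (ENNReal.ofReal Real.pi)⁻¹ *
      ∫⁻ θ in Ioo (-Real.pi) Real.pi, ∫⁻ s in Ioo (0:ℝ) 1,
        ENNReal.ofReal s * F (circleMap 0 s θ) := by
  have := lintegral_diskMeasure radialWeight_one whatPos_one hF
  rwa [diskMeasure_one, radialMeasure_one] at this

/-- Two-sided power control (on `(0,1]`) for a nondecreasing function `N`. -/
structure RegularTail (N : ℝ → ℝ) (α B C : ℝ) : Prop where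
  alpha_pos : 0 < α
  beta_pos : 0 < B
  one_le : 1 ≤ C
  pos : ∀ t, 0 < t → t ≤ 1 → 0 < N t
  mono : ∀ s t, 0 < s → s ≤ t → t ≤ 1 → N s ≤ N t
  upper : ∀ s t, 0 < s → s ≤ t → t ≤ 1 → N t ≤ C * (t / s) ^ B * N s
  lower : ∀ s t, 0 < s → s ≤ t → t ≤ 1 → N s ≤ C * (s / t) ^ α * N t

/-- The tail `ω̂(1 - t)` as a function of the distance to the boundary. -/
noncomputable def tail (ω : ℂ → ℝ) (t : ℝ) : ℝ := what ω (1 - t)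

lemma RegularTail.weaken {N : ℝ → ℝ} {α B C α' B' C' : ℝ} (h : RegularTail N α B C)
    (h0 : 0 < α') (h1 : α' ≤ α) (h2 : B ≤ B') (h3 : C ≤ C') : RegularTail N α' B' C' where
  alpha_pos := h0
  beta_pos := h.beta_pos.trans_le h2
  one_le := h.one_le.trans h3
  pos := h.pos
  mono := h.mono
  upper s t hs hst ht := by
    refine (h.upper s t hs hst ht).trans ?_
    have := (h.pos s hs (hst.trans ht)).le
    have h4 : 1 ≤ t / s := (one_le_div hs).2 hst
    have h5 := Real.rpow_le_rpow_of_exponent_le h4 h2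
    have h6 := h.one_le
    have h10 : 0 ≤ C' := by linarith
    have h7 : 0 ≤ (t / s) ^ B := by positivity
    gcongr
  lower s t hs hst ht := by
    refine (h.lower s t hs hst ht).trans ?_
    have := (h.pos t (hs.trans_le hst) ht).le
    have h4 : s / t ≤ 1 := (div_le_one (hs.trans_le hst)).2 hst
    have h8 : 0 < s / t := div_pos hs (hs.trans_le hst)
    have h5 := Real.rpow_le_rpow_of_exponent_ge h8 h4 h1
    have h6 := h.one_le
    have h10 : 0 ≤ C' := by linarith
    have h7 : 0 ≤ (s / t) ^ α := by positivity
    gcongr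

lemma intervalIntegrable_sub {ν : ℂ → ℝ} (h : WhatPos ν) {a b : ℝ} (ha : 0 ≤ a) (ha' : a ≤ 1)
    (hb : 0 ≤ b) (hb' : b ≤ 1) :
    IntervalIntegrable (fun s : ℝ => ν (s : ℂ)) volume a b := by
  refine (intervalIntegrable_of_whatPos h).mono_set ?_
  rw [uIcc_of_le zero_le_one]
  exact uIcc_subset_Icc ⟨ha, ha'⟩ ⟨hb, hb'⟩

lemma what_sub_what {ν : ℂ → ℝ} (h : WhatPos ν) {a b : ℝ} (ha : 0 ≤ a) (ha' : a ≤ 1)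
    (hb : 0 ≤ b) (hb' : b ≤ 1) : what ν a - what ν b = ∫ s in a..b, ν (s : ℂ) := by
  unfold what
  rw [sub_eq_iff_eq_add]
  exact (intervalIntegral.integral_add_adjacent_intervals
    (intervalIntegrable_sub h ha ha' hb hb')
    (intervalIntegrable_sub h hb hb' zero_le_one le_rfl)).symm

lemma what_anti {ν : ℂ → ℝ} (hν : RadialWeight ν) (h : WhatPos ν) {a b : ℝ} (ha : 0 ≤ a)
    (hab : a ≤ b) (hb : b ≤ 1) : what ν b ≤ what ν a := by
  have h1 := what_sub_what h ha (hab.trans hb) (ha.trans hab) hb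
  have h2 : 0 ≤ ∫ s in a..b, ν (s : ℂ) :=
    intervalIntegral.integral_nonneg hab fun _ _ => hν.1 _
  linarith

lemma rpow_logb_pow {K A : ℝ} (hK : 1 < K) (hA : 0 < A) (n : ℕ) :
    ((K ^ n : ℝ)) ^ (Real.logb K A) = A ^ n := by
  rw [← Real.rpow_natCast, ← Real.rpow_mul (by linarith), mul_comm, Real.rpow_mul (by linarith),
    Real.rpow_logb (by linarith) hK.ne' hA, Real.rpow_natCast]

lemma exists_regularTail {ω : ℂ → ℝ} (hω : RadialWeight ω) (hp : WhatPos ω) (hD : Dclass ω) :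
    ∃ α B C, RegularTail (tail ω) α B C := by
  obtain ⟨⟨A, hA, hup⟩, ⟨K, hK, A', hA', hlo⟩⟩ := hD
  have hpos : ∀ t, 0 < t → t ≤ 1 → 0 < tail ω t := fun t h0 h1 =>
    hp _ (by linarith) (by linarith)
  have hmono : ∀ s t, 0 < s → s ≤ t → t ≤ 1 → tail ω s ≤ tail ω t := fun s t hs hst ht =>
    what_anti hω hp (by linarith) (by linarith) (by linarith)
  have hup1 : ∀ t, 0 < t → t ≤ 1 → tail ω t ≤ A * tail ω (t / 2) := by
    intro t h0 h1
    have := hup (1 - t) (by linarith) (by linarith)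
    rwa [show (1 + (1 - t)) / 2 = 1 - t / 2 by ring] at this
  have hupn : ∀ n : ℕ, ∀ t, 0 < t → t ≤ 1 → tail ω t ≤ A ^ n * tail ω (t / 2 ^ n) := by
    intro n
    induction n with
    | zero => intro t _ _; simp
    | succ n ih =>
      intro t h0 h1
      have h2 : t / 2 ^ n ≤ 1 := (div_le_self h0.le (one_le_pow₀ one_le_two)).trans h1
      calc tail ω t ≤ A ^ n * tail ω (t / 2 ^ n) := ih t h0 h1
        _ ≤ A ^ n * (A * tail ω (t / 2 ^ n / 2)) := by
          gcongr
          exact hup1 _ (by positivity) h2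
        _ = A ^ (n + 1) * tail ω (t / 2 ^ (n + 1)) := by
          rw [div_div, ← pow_succ]; ring
  have hlo1 : ∀ t, 0 < t → t ≤ 1 → A' * tail ω (t / K) ≤ tail ω t := by
    intro t h0 h1
    have := hlo (1 - t) (by linarith) (by linarith)
    simpa [tail] using this
  have hlon : ∀ n : ℕ, ∀ t, 0 < t → t ≤ 1 → A' ^ n * tail ω (t / K ^ n) ≤ tail ω t := by
    intro n
    induction n with
    | zero => intro t _ _; simp
    | succ n ih =>
      intro t h0 h1
      have h2 : t / K ^ n ≤ 1 := (div_le_self h0.le (one_le_pow₀ hK.le)).trans h1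
      have h3 : 0 < t / K ^ n := by have : 0 < K := by linarith
                                    positivity
      calc A' ^ (n + 1) * tail ω (t / K ^ (n + 1))
          = A' ^ n * (A' * tail ω (t / K ^ n / K)) := by rw [div_div, ← pow_succ]; ring
        _ ≤ A' ^ n * tail ω (t / K ^ n) := by
          gcongr
          exact hlo1 _ h3 h2
        _ ≤ _ := ih t h0 h1
  refine ⟨Real.logb K A', Real.logb 2 A, max A A', Real.logb_pos hK hA', Real.logb_pos one_lt_two hA,
    hA.le.trans (le_max_left _ _), hpos, hmono, ?_, ?_⟩
  · intro s t hs hst ht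
    have hx : 1 ≤ t / s := (one_le_div hs).2 hst
    have ht0 : 0 < t := hs.trans_le hst
    obtain ⟨n, hn1, hn2⟩ := exists_nat_pow_near hx one_lt_two
    have h1 : t / 2 ^ (n + 1) ≤ s := by
      rw [div_lt_iff₀ hs] at hn2
      rw [div_le_iff₀ (by positivity)]
      nlinarith
    have h2 : A ^ n ≤ (t / s) ^ (Real.logb 2 A) := by
      rw [← rpow_logb_pow one_lt_two (by linarith) n]
      exact Real.rpow_le_rpow (by positivity) hn1 (Real.logb_pos one_lt_two hA).le
    have hs' := hpos s hs (hst.trans ht)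
    calc tail ω t ≤ A ^ (n + 1) * tail ω (t / 2 ^ (n + 1)) := hupn _ t ht0 ht
      _ ≤ A ^ (n + 1) * tail ω s := by
        gcongr
        exact hmono _ _ (by positivity) h1 (hst.trans ht)
      _ = A * A ^ n * tail ω s := by ring
      _ ≤ max A A' * (t / s) ^ (Real.logb 2 A) * tail ω s := by
        gcongr
        exact le_max_left _ _
  · intro s t hs hst ht
    have hx : 1 ≤ t / s := (one_le_div hs).2 hst
    have ht0 : 0 < t := hs.trans_le hst
    obtain ⟨n, hn1, hn2⟩ := exists_nat_pow_near hx hK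
    have hK0 : 0 < K := by linarith
    have hA0 : 0 < A' := by linarith
    have h1 : s ≤ t / K ^ n := by
      rw [le_div_iff₀ hs] at hn1
      rw [le_div_iff₀ (by positivity)]
      nlinarith
    have h2 : (t / s) ^ (Real.logb K A') ≤ A' ^ (n + 1) := by
      rw [← rpow_logb_pow hK (by linarith) (n + 1)]
      exact Real.rpow_le_rpow (by positivity) hn2.le (Real.logb_pos hK hA').le
    have h3 : (s / t) ^ (Real.logb K A') = ((t / s) ^ (Real.logb K A'))⁻¹ := by
      rw [← Real.inv_rpow (by positivity), inv_div]
    have hlt : t / K ^ n ≤ 1 := (div_le_self ht0.le (one_le_pow₀ hK.le)).trans ht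
    have h4 : tail ω s ≤ tail ω (t / K ^ n) := hmono _ _ hs h1 hlt
    have h5 := hlon n t ht0 ht
    have htp := hpos t ht0 ht
    have h6 : 0 < (t / s) ^ (Real.logb K A') := by positivity
    rw [h3]
    have h7 : A' ^ n * tail ω s ≤ tail ω t := le_trans (by gcongr) h5
    have h8 : (t / s) ^ (Real.logb K A') * tail ω s ≤ A' * tail ω t := by
      have hsp := (hpos s hs (hst.trans ht)).le
      calc _ ≤ A' ^ (n + 1) * tail ω s := by gcongr
        _ = A' * (A' ^ n * tail ω s) := by ring
        _ ≤ _ := by gcongr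
    have h9 : A' * tail ω t ≤ max A A' * tail ω t := by gcongr; exact le_max_right _ _
    calc tail ω s = ((t / s) ^ (Real.logb K A'))⁻¹ * ((t / s) ^ (Real.logb K A') * tail ω s) := by
          field_simp
      _ ≤ ((t / s) ^ (Real.logb K A'))⁻¹ * (max A A' * tail ω t) := by
          exact mul_le_mul_of_nonneg_left (h8.trans h9) (by positivity)
      _ = _ := by ring

lemma radialMeasure_Ioo {ν : ℂ → ℝ} (hν : RadialWeight ν) (h : WhatPos ν) {a b : ℝ} (ha : 0 ≤ a)
    (hab : a ≤ b) (hb : b ≤ 1) :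
    radialMeasure ν (Ioo a b) = ENNReal.ofReal (what ν a - what ν b) := by
  rw [what_sub_what h ha (hab.trans hb) (ha.trans hab) hb, radialMeasure,
    withDensity_apply _ measurableSet_Ioo, Measure.restrict_restrict measurableSet_Ioo,
    inter_eq_left.2 (Ioo_subset_Ioo ha hb), intervalIntegral.integral_of_le hab,
    integral_Ioc_eq_integral_Ioo,
    ofReal_integral_eq_lintegral_ofReal _ (Filter.Eventually.of_forall fun s => hν.1 _)]
  exact (integrableOn_of_whatPos h).mono_set (Ioo_subset_Ioo ha hb)

/-- The polar rectangle of points with modulus in `I` and argument in `J`. -/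
def sector (I J : Set ℝ) : Set ℂ := {z | ‖z‖ ∈ I ∧ z.arg ∈ J}

lemma measurableSet_sector {I J : Set ℝ} (hI : MeasurableSet I) (hJ : MeasurableSet J) :
    MeasurableSet (sector I J) :=
  (measurable_norm hI).inter (Complex.measurable_arg hJ)

lemma arg_circleMap_zero {s θ : ℝ} (hs : 0 < s) (hθ : θ ∈ Ioo (-Real.pi) Real.pi) :
    (circleMap 0 s θ).arg = θ := by
  rw [circleMap, zero_add, Complex.exp_mul_I]
  exact Complex.arg_mul_cos_add_sin_mul_I hs (Ioo_subset_Ioc_self hθ)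

lemma ae_radialMeasure {ν : ℂ → ℝ} : ∀ᵐ s ∂(radialMeasure ν), s ∈ Ioo (0:ℝ) 1 :=
  (withDensity_absolutelyContinuous _ _).ae_le (ae_restrict_mem measurableSet_Ioo)

lemma diskMeasure_sector {ν : ℂ → ℝ} (hν : RadialWeight ν) (h : WhatPos ν) {I J : Set ℝ}
    (hI : MeasurableSet I) (hJ : MeasurableSet J) (hJ' : J ⊆ Ioo (-Real.pi) Real.pi) :
    diskMeasure ν (sector I J) = (ENNReal.ofReal Real.pi)⁻¹ * (volume J *
      ∫⁻ s in I, ENNReal.ofReal s ∂(radialMeasure ν)) := by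
  rw [← lintegral_indicator_one (measurableSet_sector hI hJ),
    lintegral_diskMeasure hν h (measurable_one.indicator (measurableSet_sector hI hJ))]
  congr 1
  set L := ∫⁻ s in I, ENNReal.ofReal s ∂(radialMeasure ν) with hL
  have : ∀ θ ∈ Ioo (-Real.pi) Real.pi, ∫⁻ s, ENNReal.ofReal s * (sector I J).indicator 1
      (circleMap 0 s θ) ∂(radialMeasure ν) = J.indicator (fun _ => L) θ := by
    intro θ hθ
    have h1 : ∫⁻ s, ENNReal.ofReal s * (sector I J).indicator 1
        (circleMap 0 s θ) ∂(radialMeasure ν) =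
        ∫⁻ s, J.indicator 1 θ * I.indicator ENNReal.ofReal s ∂(radialMeasure ν) := by
      refine lintegral_congr_ae ?_
      filter_upwards [ae_radialMeasure] with s hs
      have hmem : circleMap 0 s θ ∈ sector I J ↔ s ∈ I ∧ θ ∈ J := by
        simp [sector, norm_circleMap_zero' hs.1.le, arg_circleMap_zero hs.1 hθ]
      by_cases h1 : s ∈ I <;> by_cases h2 : θ ∈ J <;> simp [indicator, hmem, h1, h2]
    rw [h1, lintegral_const_mul _ (ENNReal.measurable_ofReal.indicator hI),
      lintegral_indicator hI]
    by_cases h2 : θ ∈ J <;> simp [h2, hL]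
  rw [setLIntegral_congr_fun measurableSet_Ioo this, lintegral_indicator_const hJ,
    Measure.restrict_apply hJ, inter_eq_left.2 hJ', mul_comm]

lemma diskMeasure_sector_Ioo_le {ν : ℂ → ℝ} (hν : RadialWeight ν) (h : WhatPos ν) {a b c d : ℝ}
    (ha : 0 ≤ a) (hab : a ≤ b) (hb : b ≤ 1) (hc : -Real.pi ≤ c) (hd : d ≤ Real.pi) :
    diskMeasure ν (sector (Ioo a b) (Ioo c d)) ≤ (ENNReal.ofReal Real.pi)⁻¹ *
      (ENNReal.ofReal (d - c) * ENNReal.ofReal (what ν a - what ν b)) := by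
  rw [diskMeasure_sector hν h measurableSet_Ioo measurableSet_Ioo (Ioo_subset_Ioo hc hd),
    Real.volume_Ioo, ← radialMeasure_Ioo hν h ha hab hb]
  gcongr
  rw [← setLIntegral_one]
  refine setLIntegral_mono' measurableSet_Ioo fun s hs => ?_
  rw [ENNReal.ofReal_le_one]
  exact hs.2.le.trans hb

lemma le_diskMeasure_sector_Ioo {ν : ℂ → ℝ} (hν : RadialWeight ν) (h : WhatPos ν) {a b c d : ℝ}
    (ha : 0 ≤ a) (hab : a ≤ b) (hb : b ≤ 1) (hc : -Real.pi ≤ c) (hd : d ≤ Real.pi) :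
    (ENNReal.ofReal Real.pi)⁻¹ * (ENNReal.ofReal (d - c) *
      (ENNReal.ofReal a * ENNReal.ofReal (what ν a - what ν b))) ≤
      diskMeasure ν (sector (Ioo a b) (Ioo c d)) := by
  rw [diskMeasure_sector hν h measurableSet_Ioo measurableSet_Ioo (Ioo_subset_Ioo hc hd),
    Real.volume_Ioo, ← radialMeasure_Ioo hν h ha hab hb, ← setLIntegral_const]
  gcongr 2
  refine setLIntegral_mono' measurableSet_Ioo fun s hs => ?_
  exact ENNReal.ofReal_le_ofReal hs.1.le

lemma setIntegral_mul_weight {ν : ℂ → ℝ} (hν : RadialWeight ν) {h : ℂ → ℝ} (h0 : ∀ z, 0 ≤ h z)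
    (hm : Measurable h) :
    ∫ z in UD, h z * ν z ∂dA = (∫⁻ z, ENNReal.ofReal (h z) ∂(diskMeasure ν)).toReal := by
  rw [integral_eq_lintegral_of_nonneg_ae
    (Filter.Eventually.of_forall fun z => mul_nonneg (h0 z) (hν.1 z))
    (hm.aestronglyMeasurable.mul hν.2.2.aestronglyMeasurable), diskMeasure,
    lintegral_withDensity_eq_lintegral_mul₀ hν.2.2.aemeasurable.ennreal_ofReal
    hm.ennreal_ofReal.aemeasurable]
  congr 1
  refine lintegral_congr fun z => ?_
  rw [ENNReal.ofReal_mul (h0 z), Pi.mul_apply, mul_comm]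

instance isFiniteMeasure_dA : IsFiniteMeasure (dA.restrict UD) := by
  refine ⟨?_⟩
  rw [Measure.restrict_apply_univ, dA, UD, Measure.smul_apply, smul_eq_mul]
  refine ENNReal.mul_lt_top ?_ measure_ball_lt_top
  simp [Real.pi_pos]

lemma diskMeasure_finite {ν : ℂ → ℝ} (hν : RadialWeight ν) : IsFiniteMeasure (diskMeasure ν) := by
  refine ⟨?_⟩
  rw [diskMeasure, withDensity_apply _ MeasurableSet.univ, Measure.restrict_univ]
  exact hν.2.2.lintegral_lt_top

lemma ofReal_mul_cpow {c : ℝ} (hc : 0 < c) {u : ℂ} (hu : u ≠ 0) (e : ℂ) :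
    ((c : ℂ) * u) ^ e = (c : ℂ) ^ e * u ^ e := by
  have h : (c : ℂ) ≠ 0 := by exact_mod_cast hc.ne'
  rw [Complex.cpow_def_of_ne_zero (mul_ne_zero h hu), Complex.cpow_def_of_ne_zero h,
    Complex.cpow_def_of_ne_zero hu, Complex.log_ofReal_mul hc hu, Complex.ofReal_log hc.le,
    ← Complex.exp_add, add_mul]

lemma exists_cpow_near_neg_I (e : ℝ) : ∃ ε : ℝ, 0 < ε ∧ ε < 1 ∧
    ∀ u : ℂ, ‖u + Complex.I‖ ≤ ε → ‖u ^ (e : ℂ) - (-Complex.I) ^ (e : ℂ)‖ ≤ 1 / 2 := by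
  have hc : ContinuousAt (fun u : ℂ => u ^ (e : ℂ)) (-Complex.I) := by
    refine ContinuousAt.cpow continuousAt_id continuousAt_const ?_
    simp [Complex.mem_slitPlane_iff]
  obtain ⟨δ, hδ, h⟩ := Metric.continuousAt_iff.1 hc (1 / 2) (by norm_num)
  refine ⟨min (δ / 2) (1 / 2), by positivity, by
    exact lt_of_le_of_lt (min_le_right _ _) (by norm_num), fun u hu => ?_⟩
  have h1 : dist u (-Complex.I) < δ := by
    rw [dist_eq_norm, sub_neg_eq_add]
    have := hu.trans (min_le_left _ _)
    linarith
  have := h h1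
  rw [dist_eq_norm] at this
  exact this.le

lemma norm_one_sub_mul_exp_add {A δ ρ ψ : ℝ} (hA : 1 ≤ A) (hδ : 0 < δ)
    (hδ' : δ * (A + 2) ^ 2 ≤ 1) (hρ : ρ ≤ 1) (hρ' : 1 - 3 * δ / 2 ≤ ρ)
    (hψ : (A - 1) * δ ≤ ψ) (hψ' : ψ ≤ (A + 2) * δ) :
    ‖(1 - (ρ : ℂ) * Complex.exp (ψ * Complex.I)) + (A * δ : ℝ) * Complex.I‖ ≤ 8 * δ := by
  have h0 : 0 ≤ ψ := le_trans (by nlinarith) hψ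
  have h1 : ψ ≤ 1 := by nlinarith
  have key : (1 - (ρ : ℂ) * Complex.exp (ψ * Complex.I)) + (A * δ : ℝ) * Complex.I =
      -(Complex.exp (ψ * Complex.I) - 1 - ψ * Complex.I) +
      ((1 - ρ : ℝ) : ℂ) * Complex.exp (ψ * Complex.I) - ((ψ - A * δ : ℝ) : ℂ) * Complex.I := by
    push_cast; ring
  have h2 := Complex.norm_exp_sub_one_sub_id_le (x := ψ * Complex.I) (by
    simp [abs_of_nonneg h0, h1])
  have h2' : ‖(ψ * Complex.I : ℂ)‖ = ψ := by simp [abs_of_nonneg h0]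
  rw [h2'] at h2
  have h3 : ‖((1 - ρ : ℝ) : ℂ) * Complex.exp (ψ * Complex.I)‖ = 1 - ρ := by
    rw [norm_mul, Complex.norm_exp_ofReal_mul_I, Complex.norm_real, Real.norm_of_nonneg
      (by linarith), mul_one]
  have h4 : ‖((ψ - A * δ : ℝ) : ℂ) * Complex.I‖ ≤ 2 * δ := by
    rw [norm_mul, Complex.norm_I, Complex.norm_real, mul_one, Real.norm_eq_abs, abs_le]
    constructor <;> nlinarith
  have h5 : ψ ^ 2 ≤ δ := by
    have : ψ ^ 2 ≤ ((A + 2) * δ) ^ 2 := by gcongr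
    nlinarith
  rw [key]
  calc _ ≤ _ := norm_sub_le _ _
    _ ≤ (_ + _) + _ := by gcongr; exact norm_add_le _ _
    _ ≤ (ψ ^ 2 + (1 - ρ)) + 2 * δ := by
      rw [norm_neg]; gcongr; exact h3.le
    _ ≤ _ := by linarith

lemma eq_norm_mul_exp (z : ℂ) : z = ‖z‖ * Complex.exp (z.arg * Complex.I) :=
  (Complex.norm_mul_exp_arg_mul_I z).symm

lemma mul_conj_polar (z ζ : ℂ) : z * conj ζ =
    ((‖z‖ * ‖ζ‖ : ℝ) : ℂ) * Complex.exp ((z.arg - ζ.arg : ℝ) * Complex.I) := by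
  have h : conj ζ = ‖ζ‖ * Complex.exp (-(ζ.arg * Complex.I)) := by
    conv_lhs => rw [eq_norm_mul_exp ζ]
    rw [map_mul, Complex.conj_ofReal, ← Complex.exp_conj, map_mul, Complex.conj_ofReal,
      Complex.conj_I, mul_neg]
  conv_lhs => rw [eq_norm_mul_exp z, h]
  push_cast
  rw [sub_mul, sub_eq_add_neg, Complex.exp_add]
  ring

/-- On suitable polar rectangles the standard kernel is close to a constant. -/
lemma norm_one_sub_cpow_sub_le {e ε A δ : ℝ} (hε : 0 < ε) (hε1 : ε < 1)
    (he : ∀ u : ℂ, ‖u + Complex.I‖ ≤ ε → ‖u ^ (e : ℂ) - (-Complex.I) ^ (e : ℂ)‖ ≤ 1 / 2)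
    (hA : A = 8 / ε) (hδ : 0 < δ) (hδ' : δ * (A + 2) ^ 2 ≤ 1) {z ζ : ℂ}
    (hz : z ∈ sector (Ioo (1 - δ) 1) (Ioo (A * δ) ((A + 1) * δ)))
    (hζ : ζ ∈ sector (Ioo (1 - δ / 2) (1 - δ / 4)) (Ioo (-δ) δ)) :
    ‖(1 - z * conj ζ) ^ (e : ℂ) - (((A * δ) ^ e : ℝ) : ℂ) * (-Complex.I) ^ (e : ℂ)‖
      ≤ (A * δ) ^ e / 2 := by
  have hA1 : 1 ≤ A := by rw [hA, le_div_iff₀ hε]; linarith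
  obtain ⟨⟨hz1, hz2⟩, hz3, hz4⟩ := hz
  obtain ⟨⟨hζ1, hζ2⟩, hζ3, hζ4⟩ := hζ
  have hAδ : 0 < A * δ := by positivity
  have hδ1 : δ ≤ 1 := by nlinarith
  have h1 := norm_one_sub_mul_exp_add (A := A) (δ := δ) (ρ := ‖z‖ * ‖ζ‖) (ψ := z.arg - ζ.arg)
    hA1 hδ hδ' (by nlinarith [norm_nonneg z]) (by nlinarith) (by linarith) (by linarith)
  rw [← mul_conj_polar] at h1
  set u : ℂ := (1 - z * conj ζ) / ((A * δ : ℝ) : ℂ) with hu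
  have hne : ((A * δ : ℝ) : ℂ) ≠ 0 := by exact_mod_cast hAδ.ne'
  have h2 : 1 - z * conj ζ = ((A * δ : ℝ) : ℂ) * u := by rw [hu]; field_simp
  have h3 : ‖u + Complex.I‖ ≤ ε := by
    rw [h2, ← mul_add, norm_mul, Complex.norm_real, Real.norm_of_nonneg hAδ.le] at h1
    have : A * δ * ‖u + Complex.I‖ ≤ A * δ * ε := by
      refine h1.trans_eq ?_
      rw [hA]; field_simp
    exact le_of_mul_le_mul_left this hAδ
  have hu0 : u ≠ 0 := by
    rintro h
    rw [h] at h3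
    simp at h3
    linarith
  rw [h2, ofReal_mul_cpow hAδ hu0, ← Complex.ofReal_cpow hAδ.le, ← mul_sub, norm_mul,
    Complex.norm_real, Real.norm_of_nonneg (by positivity)]
  have := he u h3
  have h5 : 0 ≤ (A * δ) ^ e := by positivity
  nlinarith

lemma norm_setIntegral_ge_of_near {S : Set ℂ} (hS : MeasurableSet S) (hSU : S ⊆ UD) {w : ℂ → ℝ}
    {k : ℂ → ℂ} {c : ℂ} {L m M : ℝ} (hc : ‖c‖ = L) (hw : Measurable w)
    (hk : Measurable k) (hm : 0 ≤ m) (hwm : ∀ z ∈ S, m ≤ w z) (hwM : ∀ z ∈ S, w z ≤ M)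
    (hkc : ∀ z ∈ S, ‖k z - c‖ ≤ L / 2) :
    L / 2 * (m * (dA S).toReal) ≤ ‖∫ z in S, (w z : ℂ) * k z ∂dA‖ := by
  have hfin : IsFiniteMeasure (dA.restrict S) :=
    isFiniteMeasure_of_le _ (Measure.restrict_mono hSU le_rfl)
  have hL : 0 ≤ L := hc ▸ norm_nonneg c
  have hi1 : IntegrableOn w S dA := by
    refine Integrable.of_bound (C := M) hw.aestronglyMeasurable ?_
    filter_upwards [ae_restrict_mem hS] with z hz
    rw [Real.norm_of_nonneg (hm.trans (hwm z hz))]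
    exact hwM z hz
  have hi2 : IntegrableOn (fun z => (w z : ℂ) * (k z - c)) S dA := by
    refine Integrable.of_bound (C := M * (L / 2))
      (by fun_prop) ?_
    filter_upwards [ae_restrict_mem hS] with z hz
    rw [norm_mul, Complex.norm_real, Real.norm_of_nonneg (hm.trans (hwm z hz))]
    have h1 := hwM z hz
    have h2 := hkc z hz
    have h3 := hm.trans (hwm z hz)
    have h4 := h3.trans h1
    gcongr
  have hi3 : IntegrableOn (fun z => (w z : ℂ) * c) S dA := hi1.ofReal.mul_const c
  have h1 : ∫ z in S, (w z : ℂ) * k z ∂dA =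
      (∫ z in S, (w z : ℂ) * c ∂dA) + ∫ z in S, (w z : ℂ) * (k z - c) ∂dA := by
    rw [← integral_add hi3 hi2]
    congr 1; ext z; ring
  have h2 : ‖∫ z in S, (w z : ℂ) * c ∂dA‖ = (∫ z in S, w z ∂dA) * L := by
    rw [integral_mul_const, integral_complex_ofReal, norm_mul, hc, Complex.norm_real,
      Real.norm_of_nonneg]
    exact setIntegral_nonneg hS fun z hz => hm.trans (hwm z hz)
  have h3 : ‖∫ z in S, (w z : ℂ) * (k z - c) ∂dA‖ ≤ (∫ z in S, w z ∂dA) * (L / 2) := by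
    rw [← integral_mul_const]
    refine norm_integral_le_of_norm_le (hi1.mul_const _) ?_
    filter_upwards [ae_restrict_mem hS] with z hz
    rw [norm_mul, Complex.norm_real, Real.norm_of_nonneg (hm.trans (hwm z hz))]
    have h3 := hm.trans (hwm z hz)
    have h2 := hkc z hz
    gcongr
  have h4 : m * (dA S).toReal ≤ ∫ z in S, w z ∂dA := by
    have : ∫ z in S, m ∂dA = m * (dA S).toReal := by simp [Measure.real, mul_comm]
    rw [← this]
    refine setIntegral_mono_on (integrable_const _) hi1 hS hwm
  have h5 := norm_sub_le_norm_add (∫ z in S, (w z : ℂ) * c ∂dA)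
    (∫ z in S, (w z : ℂ) * (k z - c) ∂dA)
  rw [h1]
  nlinarith

/-- The test function used against `Pstd`. -/
noncomputable def sectorFun (S : Set ℂ) : ℂ → ℂ := S.indicator 1

lemma Pstd_sectorFun {S : Set ℂ} (hS : MeasurableSet S) (hSU : S ⊆ UD) (η : ℝ) (z : ℂ) :
    Pstd η (sectorFun S) z = ((η + 1 : ℝ) : ℂ) * ∫ ζ in S, (((1 - ‖ζ‖ ^ 2) ^ η : ℝ) : ℂ) *
      (1 - z * conj ζ) ^ (((-(2 + η) : ℝ)) : ℂ) ∂dA := by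
  rw [Pstd]
  congr 1
  have : ∀ ζ, sectorFun S ζ * (((1 - ‖ζ‖ ^ 2) ^ η : ℝ) : ℂ) *
      (1 - z * conj ζ) ^ (((-(2 + η) : ℝ)) : ℂ) = S.indicator (fun ζ =>
      (((1 - ‖ζ‖ ^ 2) ^ η : ℝ) : ℂ) * (1 - z * conj ζ) ^ (((-(2 + η) : ℝ)) : ℂ)) ζ := by
    intro ζ
    by_cases h : ζ ∈ S <;> simp [sectorFun, h]
  simp_rw [this]
  rw [integral_indicator hS, Measure.restrict_restrict hS, inter_eq_left.2 hSU]

lemma measurable_Pstd_sectorFun {S : Set ℂ} (hS : MeasurableSet S) (hSU : S ⊆ UD) (η : ℝ) :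
    Measurable (Pstd η (sectorFun S)) := by
  rw [show Pstd η (sectorFun S) = _ from funext (Pstd_sectorFun hS hSU η)]
  refine Measurable.const_mul ?_ _
  refine StronglyMeasurable.measurable (StronglyMeasurable.integral_prod_right
    (f := fun z ζ => (((1 - ‖ζ‖ ^ 2) ^ η : ℝ) : ℂ) *
      (1 - z * conj ζ) ^ (((-(2 + η) : ℝ)) : ℂ)) ?_)
  refine Measurable.stronglyMeasurable ?_
  unfold Function.uncurry
  have : Measurable (conj : ℂ → ℂ) := Complex.continuous_conj.measurable
  fun_prop

lemma norm_Pstd_sectorFun_le {S : Set ℂ} (hS : MeasurableSet S) (hSU : S ⊆ UD) {η κ M : ℝ}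
    (hη : -1 < η) (hκ : 0 < κ) (hκS : ∀ ζ ∈ S, ‖ζ‖ ≤ 1 - κ)
    (hM : ∀ ζ ∈ S, (1 - ‖ζ‖ ^ 2) ^ η ≤ M) {z : ℂ} (hz : z ∈ UD) :
    ‖Pstd η (sectorFun S) z‖ ≤ (η + 1) * (M * κ ^ (-(2 + η)) * (dA S).toReal) := by
  have hfin : dA S < ⊤ := (measure_mono hSU).trans_lt (by
    have := measure_lt_top (dA.restrict UD) univ
    rwa [Measure.restrict_apply_univ] at this)
  rw [Pstd_sectorFun hS hSU, norm_mul, Complex.norm_real, Real.norm_of_nonneg (by linarith)]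
  have : 0 ≤ η + 1 := by linarith
  gcongr
  refine norm_setIntegral_le_of_norm_le_const hfin fun ζ hζ => ?_
  have h1 : 0 ≤ 1 - ‖ζ‖ ^ 2 := by
    have := mem_UD.1 (hSU hζ)
    nlinarith [norm_nonneg ζ]
  have h2 : 0 ≤ (1 - ‖ζ‖ ^ 2) ^ η := by positivity
  rw [norm_mul, Complex.norm_real, Real.norm_of_nonneg h2, Complex.norm_cpow_real]
  have h3 : κ ≤ ‖1 - z * conj ζ‖ := by
    have h4 := norm_sub_norm_le 1 (z * conj ζ)
    rw [norm_one, norm_mul, RCLike.norm_conj] at h4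
    have h5 := mem_UD.1 hz
    have h6 := hκS ζ hζ
    nlinarith [norm_nonneg ζ]
  have h7 := hM ζ hζ
  have h8 := h2.trans h7
  gcongr ?_ * ?_
  exact Real.rpow_le_rpow_of_nonpos hκ h3 (by linarith)

lemma sector_subset_UD {a b : ℝ} (hb : b ≤ 1) (J : Set ℝ) : sector (Ioo a b) J ⊆ UD :=
  fun _ hz => mem_UD.2 (hz.1.2.trans_le hb)

lemma measurable_sectorFun {S : Set ℂ} (hS : MeasurableSet S) : Measurable (sectorFun S) :=
  measurable_one.indicator hS

lemma memLw_sectorFun {q : ℝ} (hq : 0 < q) {ν : ℂ → ℝ} (hν : RadialWeight ν) {S : Set ℂ}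
    (hS : MeasurableSet S) : MemLw q ν (sectorFun S) := by
  refine ⟨(measurable_sectorFun hS).aestronglyMeasurable, ?_⟩
  have : (fun z => ‖sectorFun S z‖ ^ q * ν z) = S.indicator ν := by
    ext z
    by_cases h : z ∈ S <;> simp [sectorFun, h, Real.zero_rpow hq.ne']
  rw [this]
  exact hν.2.2.indicator hS

lemma diskMeasure_mono_of_bound {q : ℝ} (hq : 0 < q) {ν : ℂ → ℝ} (hν : RadialWeight ν) {C η : ℝ}
    (hC : 0 ≤ C)
    (hB : ∀ f : ℂ → ℂ, MemLw q ν f → wnorm q ν (Pstd η f) ≤ C * wnorm q ν f)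
    {S T : Set ℂ} (hS : MeasurableSet S) (hSU : S ⊆ UD) (hT : MeasurableSet T)
    {c M : ℝ} (hc : 0 ≤ c) (hM : ∀ z ∈ UD, ‖Pstd η (sectorFun S) z‖ ≤ M)
    (hcT : ∀ z ∈ T, c ≤ ‖Pstd η (sectorFun S) z‖) :
    c ^ q * (diskMeasure ν T).toReal ≤ C ^ q * (diskMeasure ν S).toReal := by
  have hfin := diskMeasure_finite hν
  have h1 := hB _ (memLw_sectorFun hq hν hS)
  have e1 : ∫ z in UD, ‖sectorFun S z‖ ^ q * ν z ∂dA = (diskMeasure ν S).toReal := by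
    rw [setIntegral_mul_weight hν (fun z => by positivity)
      ((measurable_sectorFun hS).norm.pow_const q), ← lintegral_indicator_one hS]
    congr 2; ext z
    by_cases h : z ∈ S <;> simp [sectorFun, h, Real.zero_rpow hq.ne']
  have hm := (measurable_Pstd_sectorFun hS hSU η).norm.pow_const q
  unfold wnorm at h1
  rw [e1, setIntegral_mul_weight hν (fun z => by positivity) hm] at h1
  set X := ∫⁻ z, ENNReal.ofReal (‖Pstd η (sectorFun S) z‖ ^ q) ∂(diskMeasure ν) with hX
  have hXfin : X ≠ ⊤ := by
    have : X ≤ ∫⁻ z, ENNReal.ofReal (M ^ q) ∂(diskMeasure ν) := by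
      refine lintegral_mono_ae ?_
      have : ∀ᵐ z ∂(diskMeasure ν), z ∈ UD :=
        (withDensity_absolutelyContinuous _ _).ae_le (ae_restrict_mem measurableSet_UD)
      filter_upwards [this] with z hz
      have := hM z hz
      gcongr
    refine (this.trans_lt ?_).ne
    rw [lintegral_const]
    exact ENNReal.mul_lt_top ENNReal.ofReal_lt_top (measure_lt_top _ _)
  have h2 : X.toReal ≤ C ^ q * (diskMeasure ν S).toReal := by
    have h3 := Real.rpow_le_rpow (by positivity) h1 hq.le
    rw [Real.mul_rpow hC (by positivity), ← Real.rpow_mul (by positivity),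
      ← Real.rpow_mul (by positivity), one_div_mul_cancel hq.ne', Real.rpow_one,
      Real.rpow_one] at h3
    exact h3
  refine le_trans ?_ h2
  rw [← ENNReal.toReal_ofReal (show 0 ≤ c ^ q by positivity), ← ENNReal.toReal_mul]
  refine ENNReal.toReal_mono hXfin ?_
  rw [← setLIntegral_const]
  refine le_trans (setLIntegral_mono' hT fun z hz => ?_) (setLIntegral_le_lintegral T _)
  have := hcT z hz
  exact ENNReal.ofReal_le_ofReal (by gcongr)

lemma what_one (ν : ℂ → ℝ) : what ν 1 = 0 := by simp [what]

lemma Bq_core {q : ℝ} (hq : 1 < q) {ν : ℂ → ℝ} (hν : RadialWeight ν) (hp : WhatPos ν)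
    (hB : Bq q ν) : ∃ δ₀ > (0:ℝ), ∃ C > (0:ℝ), δ₀ ≤ 1 / 2 ∧ ∀ δ, 0 < δ → δ ≤ δ₀ →
      what ν (1 - δ) ≤ C * (what ν (1 - δ / 2) - what ν (1 - δ / 4)) := by
  obtain ⟨η, hη, C, hC, hB⟩ := hB
  obtain ⟨ε, hε, hε1, he⟩ := exists_cpow_near_neg_I (-(2 + η))
  obtain ⟨A, hA⟩ : ∃ A, A = 8 / ε := ⟨_, rfl⟩
  have hA1 : 1 ≤ A := by rw [hA, le_div_iff₀ hε]; linarith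
  set e := -(2 + η) with hedef
  set m : ℝ := min ((1 / 4) ^ η) 1 with hm
  have hm0 : 0 < m := lt_min (by positivity) one_pos
  have hpi := Real.pi_pos
  set c : ℝ := (η + 1) * (A ^ e / 2 * (m * (Real.pi⁻¹ * (1 / 4)))) with hc
  have hη1 : 0 < η + 1 := by linarith
  have hc0 : 0 < c := by positivity
  have hq0 : 0 < q := by linarith
  refine ⟨min (1 / 2) (1 / (A + 2) ^ 2), by positivity, 4 * (C ^ q / c ^ q), by positivity,
    min_le_left _ _, fun δ hδ hδ' => ?_⟩
  have hδ1 : δ ≤ 1 / 2 := hδ'.trans (min_le_left _ _)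
  have hδ2 : δ * (A + 2) ^ 2 ≤ 1 := by
    rw [← le_div_iff₀ (by positivity)]
    exact hδ'.trans (min_le_right _ _)
  set S := sector (Ioo (1 - δ / 2) (1 - δ / 4)) (Ioo (-δ) δ) with hS
  set T := sector (Ioo (1 - δ) 1) (Ioo (A * δ) ((A + 1) * δ)) with hT
  have hSm : MeasurableSet S := measurableSet_sector measurableSet_Ioo measurableSet_Ioo
  have hTm : MeasurableSet T := measurableSet_sector measurableSet_Ioo measurableSet_Ioo
  have hSU : S ⊆ UD := sector_subset_UD (by linarith) _
  have hw : ∀ ζ ∈ S, δ / 4 ≤ 1 - ‖ζ‖ ^ 2 ∧ 1 - ‖ζ‖ ^ 2 ≤ δ := by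
    rintro ζ ⟨⟨h1, h2⟩, -⟩
    constructor <;> nlinarith
  have hwm : ∀ ζ ∈ S, m * δ ^ η ≤ (1 - ‖ζ‖ ^ 2) ^ η := by
    intro ζ hζ
    obtain ⟨h1, h2⟩ := hw ζ hζ
    rcases le_total 0 η with h | h
    · calc m * δ ^ η ≤ (1 / 4) ^ η * δ ^ η := by gcongr; exact min_le_left _ _
        _ = (δ / 4) ^ η := by rw [← Real.mul_rpow (by norm_num) hδ.le]; ring_nf
        _ ≤ _ := by gcongr
    · calc m * δ ^ η ≤ 1 * δ ^ η := by gcongr; exact min_le_right _ _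
        _ = δ ^ η := one_mul _
        _ ≤ _ := Real.rpow_le_rpow_of_nonpos (by linarith) h2 h
  have hwM : ∀ ζ ∈ S, (1 - ‖ζ‖ ^ 2) ^ η ≤ δ ^ η + (δ / 4) ^ η := by
    intro ζ hζ
    obtain ⟨h1, h2⟩ := hw ζ hζ
    have p1 : 0 < δ ^ η := by positivity
    have p2 : 0 < (δ / 4) ^ η := by positivity
    rcases le_total 0 η with h | h
    · have : (1 - ‖ζ‖ ^ 2) ^ η ≤ δ ^ η := Real.rpow_le_rpow (by linarith) h2 h
      linarith
    · have : (1 - ‖ζ‖ ^ 2) ^ η ≤ (δ / 4) ^ η :=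
        Real.rpow_le_rpow_of_nonpos (by positivity) h1 h
      linarith
  have hpi3 := Real.pi_gt_three
  have hSA : Real.pi⁻¹ * (δ ^ 2 / 4) ≤ (dA S).toReal := by
    have h1 := le_diskMeasure_sector_Ioo radialWeight_one whatPos_one (a := 1 - δ / 2)
      (b := 1 - δ / 4) (c := -δ) (d := δ) (by linarith) (by linarith) (by linarith)
      (by linarith) (by linarith)
    rw [diskMeasure_one, ← hS, Measure.restrict_apply hSm, inter_eq_left.2 hSU] at h1
    have hfin : dA S ≠ ⊤ := ((measure_mono hSU).trans_lt (by
      have := measure_lt_top (dA.restrict UD) univ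
      rwa [Measure.restrict_apply_univ] at this)).ne
    have h2 := ENNReal.toReal_mono hfin h1
    have e1 : what (fun _ => 1) (1 - δ / 2) - what (fun _ => 1) (1 - δ / 4) = δ / 4 := by
      simp [what]; ring
    rw [e1, ENNReal.toReal_mul, ENNReal.toReal_mul, ENNReal.toReal_mul, ENNReal.toReal_inv,
      ENNReal.toReal_ofReal hpi.le, ENNReal.toReal_ofReal (by linarith),
      ENNReal.toReal_ofReal (by linarith), ENNReal.toReal_ofReal (by linarith)] at h2
    refine le_trans ?_ h2
    gcongr
    nlinarith
  have hlow : ∀ z ∈ T, c ≤ ‖Pstd η (sectorFun S) z‖ := by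
    intro z hz
    rw [Pstd_sectorFun hSm hSU, norm_mul, Complex.norm_real, Real.norm_of_nonneg hη1.le]
    have hcn : Measurable (conj : ℂ → ℂ) := Complex.continuous_conj.measurable
    have hAδ : 0 < A * δ := by positivity
    have hI : ‖(-Complex.I) ^ (e : ℂ)‖ = 1 := by rw [Complex.norm_cpow_real]; simp
    have h1 := norm_setIntegral_ge_of_near (S := S) hSm hSU
      (w := fun ζ => (1 - ‖ζ‖ ^ 2) ^ η) (k := fun ζ => (1 - z * conj ζ) ^ (e : ℂ))
      (c := (((A * δ) ^ e : ℝ) : ℂ) * (-Complex.I) ^ (e : ℂ)) (L := (A * δ) ^ e)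
      (m := m * δ ^ η) (by
        rw [norm_mul, hI, mul_one, Complex.norm_real, Real.norm_of_nonneg (by positivity)])
      (by fun_prop) (by fun_prop) (by positivity) hwm hwM
      (fun ζ hζ => norm_one_sub_cpow_sub_le hε hε1 he hA hδ hδ2 hz hζ)
    rw [hc]
    gcongr
    refine le_trans ?_ h1
    have e2 : δ ^ e * δ ^ η * δ ^ (2:ℝ) = 1 := by
      rw [← Real.rpow_add hδ, ← Real.rpow_add hδ, hedef]; ring_nf; exact Real.rpow_zero _
    calc A ^ e / 2 * (m * (Real.pi⁻¹ * (1 / 4)))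
        = (A ^ e * δ ^ e) / 2 * (m * δ ^ η * (Real.pi⁻¹ * (δ ^ 2 / 4))) := by
          rw [← Real.rpow_natCast δ 2]; push_cast
          linear_combination (-(A ^ e / 2 * (m * (Real.pi⁻¹ * (1 / 4))))) * e2
      _ = (A * δ) ^ e / 2 * (m * δ ^ η * (Real.pi⁻¹ * (δ ^ 2 / 4))) := by
          rw [Real.mul_rpow (by linarith) hδ.le]
      _ ≤ _ := by gcongr
  have hmain := diskMeasure_mono_of_bound hq0 hν hC.le hB hSm hSU hTm hc0.le
    (fun z hz => norm_Pstd_sectorFun_le hSm hSU hη (κ := δ / 4) (by positivity)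
      (fun ζ hζ => hζ.1.2.le) hwM hz) hlow
  have hfin := diskMeasure_finite hν
  have hAδ1 : (A + 1) * δ ≤ 1 := by nlinarith
  have hAδ0 : 0 < A * δ := by positivity
  have hT1 := ENNReal.toReal_mono (measure_ne_top _ _) (le_diskMeasure_sector_Ioo hν hp
    (a := 1 - δ) (b := 1) (c := A * δ) (d := (A + 1) * δ) (by linarith) (by linarith) le_rfl
    (by linarith) (by linarith))
  have hd1 : what ν (1 - δ / 4) ≤ what ν (1 - δ / 2) :=
    what_anti hν hp (by linarith) (by linarith) (by linarith)
  have hd2 := hp (1 - δ) (by linarith) (by linarith)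
  have hS1 := ENNReal.toReal_mono (by finiteness) (diskMeasure_sector_Ioo_le hν hp
    (a := 1 - δ / 2) (b := 1 - δ / 4) (c := -δ) (d := δ) (by linarith) (by linarith) (by linarith)
    (by linarith) (by linarith))
  rw [← hT, what_one, sub_zero, ENNReal.toReal_mul, ENNReal.toReal_mul, ENNReal.toReal_mul,
    ENNReal.toReal_inv, ENNReal.toReal_ofReal hpi.le, ENNReal.toReal_ofReal (by linarith),
    ENNReal.toReal_ofReal (by linarith), ENNReal.toReal_ofReal (by linarith)] at hT1
  rw [← hS, ENNReal.toReal_mul, ENNReal.toReal_mul,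
    ENNReal.toReal_inv, ENNReal.toReal_ofReal hpi.le, ENNReal.toReal_ofReal (by linarith),
    ENNReal.toReal_ofReal (by linarith)] at hS1
  set D := what ν (1 - δ / 2) - what ν (1 - δ / 4)
  have hcq : 0 < c ^ q := by positivity
  have h5 : c ^ q * (Real.pi⁻¹ * (δ * (1 / 2 * what ν (1 - δ)))) ≤
      C ^ q * (Real.pi⁻¹ * (2 * δ * D)) := by
    calc _ ≤ c ^ q * (diskMeasure ν T).toReal := by
          gcongr
          refine le_trans ?_ hT1
          have : (A + 1) * δ - A * δ = δ := by ring
          rw [this]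
          gcongr
          linarith
      _ ≤ C ^ q * (diskMeasure ν S).toReal := hmain
      _ ≤ _ := by
          gcongr
          refine hS1.trans_eq ?_
          ring
  have h6 : Real.pi⁻¹ * δ * (c ^ q * what ν (1 - δ)) ≤ Real.pi⁻¹ * δ * (4 * C ^ q * D) := by
    nlinarith
  have h7 := le_of_mul_le_mul_left h6 (by positivity)
  rw [show 4 * (C ^ q / c ^ q) * D = 4 * C ^ q * D / c ^ q by ring, le_div_iff₀ hcq]
  linarith

lemma Dclass_of_Bq {q : ℝ} (hq : 1 < q) {ν : ℂ → ℝ} (hν : RadialWeight ν) (hp : WhatPos ν)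
    (hB : Bq q ν) : Dclass ν := by
  obtain ⟨δ₀, hδ₀, C, hC, hδ1, h⟩ := Bq_core hq hν hp hB
  constructor
  · set E := what ν 0 / what ν (1 - δ₀ / 2) with hE
    have hb := hp (1 - δ₀ / 2) (by linarith) (by linarith)
    have ha := hp 0 le_rfl one_pos
    have hE0 : 0 < E := by positivity
    refine ⟨1 + C + E, by linarith, fun r h0 h1 => ?_⟩
    have hpos := hp ((1 + r) / 2) (by linarith) (by linarith)
    rcases le_total (1 - r) δ₀ with h2 | h2
    · have h3 := h (1 - r) (by linarith) h2
      have h4 := hp (1 - (1 - r) / 4) (by linarith) (by linarith)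
      have e1 : 1 - (1 - r) = r := by ring
      have e2 : 1 - (1 - r) / 2 = (1 + r) / 2 := by ring
      rw [e1, e2] at h3
      nlinarith
    · have h3 := what_anti hν hp le_rfl h0 h1.le
      have h4 := what_anti hν hp (a := (1 + r) / 2) (b := 1 - δ₀ / 2) (by linarith) (by linarith)
        (by linarith)
      have h5 : what ν 0 ≤ E * what ν ((1 + r) / 2) := by
        calc what ν 0 = E * what ν (1 - δ₀ / 2) := by rw [hE, div_mul_cancel₀ _ hb.ne']
          _ ≤ _ := by gcongr
      nlinarith
  · refine ⟨4 / δ₀, by rw [gt_iff_lt, lt_div_iff₀ hδ₀]; linarith, 1 + 1 / C,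
      by have : 0 < 1 / C := by positivity
         linarith, fun r h0 h1 => ?_⟩
    set δ := (1 - r) * δ₀ with hδ
    have hδp : 0 < δ := mul_pos (by linarith) hδ₀
    have hδle : δ ≤ δ₀ := by nlinarith
    have hδle' : δ ≤ 1 - r := by nlinarith
    have h3 := h δ hδp hδle
    have e1 : 1 - (1 - r) / (4 / δ₀) = 1 - δ / 4 := by rw [hδ]; field_simp
    rw [e1]
    have h4 := what_anti hν hp (a := 1 - δ) (b := 1 - δ / 2) (by linarith) (by linarith)
      (by linarith)
    have h5 := what_anti hν hp (a := r) (b := 1 - δ) (by linarith) (by linarith)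
      (by linarith)
    have h6 := what_anti hν hp (a := 1 - δ) (b := 1 - δ / 4) (by linarith) (by linarith)
      (by linarith)
    have h7 : what ν (1 - δ) / C ≤ what ν (1 - δ) - what ν (1 - δ / 4) := by
      rw [div_le_iff₀ hC]; nlinarith
    have h8 : what ν (1 - δ / 4) / C ≤ what ν (1 - δ) / C := by gcongr
    have : (1 + 1 / C) * what ν (1 - δ / 4) = what ν (1 - δ / 4) + what ν (1 - δ / 4) / C := by
      ring
    linarith

lemma isFiniteMeasure_radialMeasure {ν : ℂ → ℝ} (h : WhatPos ν) :
    IsFiniteMeasure (radialMeasure ν) := by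
  refine ⟨?_⟩
  rw [radialMeasure, withDensity_apply _ MeasurableSet.univ, Measure.restrict_univ]
  exact (integrableOn_of_whatPos h).lintegral_lt_top

/-- A globally monotone version of the tail. -/
noncomputable def tl (ν : ℂ → ℝ) (t : ℝ) : ℝ := (radialMeasure ν (Ioi (1 - t))).toReal

lemma tl_mono {ν : ℂ → ℝ} (h : WhatPos ν) : Monotone (tl ν) := by
  intro s t hst
  have := isFiniteMeasure_radialMeasure h
  exact ENNReal.toReal_mono (measure_ne_top _ _)
    (measure_mono (Ioi_subset_Ioi (by linarith)))

lemma radialMeasure_Ioi {ν : ℂ → ℝ} (hν : RadialWeight ν) (h : WhatPos ν) {a : ℝ} (ha : 0 ≤ a)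
    (hb : a ≤ 1) : radialMeasure ν (Ioi a) = ENNReal.ofReal (what ν a) := by
  have h1 := radialMeasure_Ioo hν h ha hb le_rfl
  rw [what_one, sub_zero] at h1
  rw [← h1]
  refine measure_congr ?_
  filter_upwards [ae_radialMeasure] with s hs
  exact propext ⟨fun h => ⟨h, hs.2⟩, fun h => h.1⟩

lemma ofReal_tl {ν : ℂ → ℝ} (h : WhatPos ν) (t : ℝ) :
    ENNReal.ofReal (tl ν t) = radialMeasure ν (Ioi (1 - t)) := by
  have := isFiniteMeasure_radialMeasure h
  exact ENNReal.ofReal_toReal (measure_ne_top _ _)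

lemma what_nonneg {ν : ℂ → ℝ} (hν : RadialWeight ν) {a : ℝ} (hb : a ≤ 1) : 0 ≤ what ν a :=
  intervalIntegral.integral_nonneg hb fun _ _ => hν.1 _

lemma tl_eq_tail {ν : ℂ → ℝ} (hν : RadialWeight ν) (h : WhatPos ν) {t : ℝ} (h0 : 0 ≤ t)
    (h1 : t ≤ 1) : tl ν t = tail ν t := by
  rw [tl, radialMeasure_Ioi hν h (by linarith) (by linarith), ENNReal.toReal_ofReal
    (what_nonneg hν (by linarith)), tail]

lemma tl_nonneg (ν : ℂ → ℝ) (t : ℝ) : 0 ≤ tl ν t := ENNReal.toReal_nonneg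

lemma tl_of_one_le {ν : ℂ → ℝ} {t : ℝ} (ht : 1 ≤ t) : tl ν t = tl ν 1 := by
  unfold tl
  congr 1
  refine measure_congr ?_
  filter_upwards [ae_radialMeasure] with s hs
  exact propext ⟨fun _ => show 1 - 1 < s by linarith [hs.1], fun _ =>
    show 1 - t < s by linarith [hs.1]⟩

lemma regularTail_tl {ν : ℂ → ℝ} (hν : RadialWeight ν) (h : WhatPos ν) {α B C : ℝ}
    (hN : RegularTail (tail ν) α B C) : RegularTail (tl ν) α B C where
  alpha_pos := hN.alpha_pos
  beta_pos := hN.beta_pos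
  one_le := hN.one_le
  pos t h0 h1 := by rw [tl_eq_tail hν h h0.le h1]; exact hN.pos t h0 h1
  mono s t _ hst _ := tl_mono h hst
  upper s t h0 hst h1 := by
    rw [tl_eq_tail hν h h0.le (hst.trans h1), tl_eq_tail hν h (h0.le.trans hst) h1]
    exact hN.upper s t h0 hst h1
  lower s t h0 hst h1 := by
    rw [tl_eq_tail hν h h0.le (hst.trans h1), tl_eq_tail hν h (h0.le.trans hst) h1]
    exact hN.lower s t h0 hst h1

lemma tl_two_mul_le {ν : ℂ → ℝ} {α B C : ℝ}
    (hN : RegularTail (tl ν) α B C) {t : ℝ} (h0 : 0 < t) (h1 : t ≤ 1) :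
    tl ν (2 * t) ≤ C * 2 ^ B * tl ν t := by
  have hC := hN.one_le
  have hB := hN.beta_pos
  have hp := (hN.pos t h0 h1).le
  rcases le_total (2 * t) 1 with h2 | h2
  · have := hN.upper t (2 * t) h0 (by linarith) h2
    rwa [mul_div_cancel_right₀ _ h0.ne'] at this
  · rw [tl_of_one_le h2]
    refine (hN.upper t 1 h0 h1 le_rfl).trans ?_
    have : 1 / t ≤ 2 := by rw [div_le_iff₀ h0]; linarith
    gcongr

/-- Radial integrals of doubling functions against a regular radial weight are controlled by the
smooth density `N(1-s)/(1-s)`. -/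
lemma lintegral_radialMeasure_le {ν : ℂ → ℝ} (hp : WhatPos ν)
    {α B C : ℝ} (hN : RegularTail (tl ν) α B C) {φ : ℝ → ℝ≥0∞} (hφ : Measurable φ) {c : ℝ≥0∞}
    (h : ∀ s s', 0 < s → s ≤ s' → s' < 1 → 1 - s ≤ 2 * (1 - s') → φ s ≤ c * φ s') :
    ∫⁻ s, φ s ∂(radialMeasure ν) ≤ ENNReal.ofReal (2 * (C * 2 ^ B)) * c *
      ∫⁻ s in Ioo (0:ℝ) 1, φ s * ENNReal.ofReal (tl ν (1 - s) / (1 - s)) := by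
  have hC := hN.one_le
  set E : Set (ℝ × ℝ) := {p | p.2 < (1 + p.1) / 2} with hE
  have hEm : MeasurableSet E := measurableSet_lt (by fun_prop) (by fun_prop)
  have step : ∀ s ∈ Ioo (0:ℝ) 1, φ s ≤ ∫⁻ s' in Ioo (0:ℝ) 1,
      E.indicator (fun p => c * φ p.2 * ENNReal.ofReal (2 / (1 - p.2))) (s, s') := by
    intro s hs
    have hs1 : 0 < 1 - s := by linarith [hs.2]
    calc φ s = ∫⁻ s' in Ioo s ((1 + s) / 2), φ s * ENNReal.ofReal (2 / (1 - s)) := by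
          rw [setLIntegral_const, Real.volume_Ioo, mul_assoc, ← ENNReal.ofReal_mul (by positivity)]
          have : 2 / (1 - s) * ((1 + s) / 2 - s) = 1 := by field_simp; ring
          rw [this]; simp
      _ ≤ ∫⁻ s' in Ioo s ((1 + s) / 2),
          E.indicator (fun p => c * φ p.2 * ENNReal.ofReal (2 / (1 - p.2))) (s, s') := by
          refine setLIntegral_mono' measurableSet_Ioo fun s' hs' => ?_
          have hm : (s, s') ∈ E := hs'.2
          have h1 : s' < 1 := by have := hs'.2; linarith [hs.2]
          have h2 : 0 < 1 - s' := by linarith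
          rw [indicator_of_mem hm]
          have h3 := h s s' hs.1 hs'.1.le h1 (by linarith [hs'.2])
          have h4 := hs'.1
          gcongr
      _ ≤ _ := by
          refine lintegral_mono_set (Ioo_subset_Ioo hs.1.le ?_)
          linarith [hs.2]
  calc ∫⁻ s, φ s ∂(radialMeasure ν) ≤ ∫⁻ s, (∫⁻ s' in Ioo (0:ℝ) 1,
      E.indicator (fun p => c * φ p.2 * ENNReal.ofReal (2 / (1 - p.2))) (s, s'))
        ∂(radialMeasure ν) := by
        refine lintegral_mono_ae ?_
        filter_upwards [ae_radialMeasure] with s hs using step s hs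
    _ = ∫⁻ s' in Ioo (0:ℝ) 1, ∫⁻ s,
      E.indicator (fun p => c * φ p.2 * ENNReal.ofReal (2 / (1 - p.2))) (s, s')
        ∂(radialMeasure ν) := by
        refine lintegral_lintegral_swap (Measurable.aemeasurable ?_)
        exact Measurable.indicator (by fun_prop) hEm
    _ ≤ ∫⁻ s' in Ioo (0:ℝ) 1, ENNReal.ofReal (2 * (C * 2 ^ B)) * c *
        (φ s' * ENNReal.ofReal (tl ν (1 - s') / (1 - s'))) := by
        refine setLIntegral_mono' measurableSet_Ioo fun s' hs' => ?_
        have e : ∀ s, E.indicator (fun p => c * φ p.2 * ENNReal.ofReal (2 / (1 - p.2))) (s, s') =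
            (Ioi (1 - 2 * (1 - s'))).indicator
              (fun _ => c * φ s' * ENNReal.ofReal (2 / (1 - s'))) s := by
          intro s
          have : (s, s') ∈ E ↔ s ∈ Ioi (1 - 2 * (1 - s')) := by
            simp only [hE, Set.mem_ofPred_eq, mem_Ioi]
            constructor <;> intro h <;> linarith
          simp only [indicator, this]
        have h1 : 0 < 1 - s' := by linarith [hs'.2]
        simp_rw [e]
        rw [lintegral_indicator_const measurableSet_Ioi, ← ofReal_tl hp]
        have h2 := tl_two_mul_le hN h1 (by linarith [hs'.1])
        calc _ ≤ c * φ s' * ENNReal.ofReal (2 / (1 - s')) *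
              ENNReal.ofReal (C * 2 ^ B * tl ν (1 - s')) := by gcongr
          _ = _ := by
            have : 2 / (1 - s') * (C * 2 ^ B * tl ν (1 - s')) =
              2 * (C * 2 ^ B) * (tl ν (1 - s') / (1 - s')) := by ring
            rw [mul_assoc (c * φ s'), ← ENNReal.ofReal_mul (by positivity), this,
              ENNReal.ofReal_mul (by positivity)]
            ring
    _ = _ := by
        rw [lintegral_const_mul]
        have := (tl_mono hp).measurable
        fun_prop

lemma lintegral_diskMeasure_le {ν : ℂ → ℝ} (hν : RadialWeight ν) (hp : WhatPos ν)
    {α B C : ℝ} (hN : RegularTail (tl ν) α B C) {F : ℂ → ℝ≥0∞} (hF : Measurable F) {c : ℝ≥0∞}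
    (h : ∀ θ s s', 0 < s → s ≤ s' → s' < 1 → 1 - s ≤ 2 * (1 - s') →
      F (circleMap 0 s θ) ≤ c * F (circleMap 0 s' θ)) :
    ∫⁻ z, F z ∂(diskMeasure ν) ≤ ENNReal.ofReal (2 * (C * 2 ^ B)) * c *
      ∫⁻ z in UD, F z * ENNReal.ofReal (tl ν (1 - ‖z‖) / (1 - ‖z‖)) ∂dA := by
  have hm := (tl_mono hp).measurable
  have hcm (θ : ℝ) : Measurable (fun s : ℝ => circleMap 0 s θ) := by unfold circleMap; fun_prop
  have hcm2 := measurable_circleMap_prod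
  rw [lintegral_diskMeasure hν hp hF, lintegral_disk (by fun_prop), mul_left_comm]
  gcongr
  rw [← lintegral_const_mul]
  · refine lintegral_mono fun θ => ?_
    refine (lintegral_radialMeasure_le hp hN (c := c) ?_ ?_).trans_eq ?_
    · have := hcm θ
      fun_prop
    · intro s s' h0 hss h1 h2
      calc _ ≤ ENNReal.ofReal s' * (c * F (circleMap 0 s' θ)) := by
            gcongr
            exact h θ s s' h0 hss h1 h2
        _ = _ := by ring
    · congr 1
      refine setLIntegral_congr_fun measurableSet_Ioo fun s hs => ?_
      rw [norm_circleMap_zero' hs.1.le, mul_assoc]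
  · refine Measurable.lintegral_prod_right'
      (f := fun p : ℝ × ℝ => ENNReal.ofReal p.2 * (F (circleMap 0 p.2 p.1) *
        ENNReal.ofReal (tl ν (1 - ‖circleMap 0 p.2 p.1‖) / (1 - ‖circleMap 0 p.2 p.1‖)))) ?_
    have := hcm2.comp measurable_swap
    simp only [Function.comp_def, Prod.fst_swap, Prod.snd_swap] at this
    fun_prop

/-- `|1 - conj z * ζ|`. -/
noncomputable def hk (z ζ : ℂ) : ℝ := ‖1 - conj z * ζ‖

lemma hk_comm (z ζ : ℂ) : hk z ζ = hk ζ z := by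
  have : conj (1 - conj z * ζ) = 1 - conj ζ * z := by simp [mul_comm]
  rw [hk, hk, ← this, RCLike.norm_conj]

lemma hk_nonneg (z ζ : ℂ) : 0 ≤ hk z ζ := norm_nonneg _

@[fun_prop]
lemma measurable_hk {α : Type*} [MeasurableSpace α] {f g : α → ℂ} (hf : Measurable f)
    (hg : Measurable g) : Measurable fun x => hk (f x) (g x) :=
  (measurable_const.sub ((Complex.continuous_conj.measurable.comp hf).mul hg)).norm

lemma one_sub_mul_le_hk (z ζ : ℂ) : 1 - ‖z‖ * ‖ζ‖ ≤ hk z ζ := by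
  have h4 := norm_sub_norm_le 1 (conj z * ζ)
  rwa [norm_one, norm_mul, RCLike.norm_conj] at h4

lemma one_sub_norm_le_hk {z ζ : ℂ} (hζ : ζ ∈ UD) : 1 - ‖z‖ ≤ hk z ζ := by
  have h5 := mem_UD.1 hζ
  nlinarith [one_sub_mul_le_hk z ζ, norm_nonneg z]

lemma hk_pos {z ζ : ℂ} (hz : z ∈ UD) (hζ : ζ ∈ UD) : 0 < hk z ζ := by
  have h5 := mem_UD.1 hz
  linarith [one_sub_norm_le_hk (z := z) hζ]

lemma hk_le_two {z ζ : ℂ} (hz : z ∈ UD) (hζ : ζ ∈ UD) : hk z ζ ≤ 2 := by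
  refine (norm_sub_le _ _).trans ?_
  rw [norm_one, norm_mul, RCLike.norm_conj]
  nlinarith [mem_UD.1 hz, mem_UD.1 hζ, norm_nonneg z, norm_nonneg ζ]

lemma le_norm_one_sub_circleMap {ρ θ : ℝ} (h0 : 0 ≤ ρ) (hθ : |θ| ≤ Real.pi) :
    ((1 - ρ) + |θ|) / 5 ≤ ‖1 - circleMap 0 ρ θ‖ := by
  have hpi := Real.pi_pos
  have e : ‖1 - circleMap 0 ρ θ‖ ^ 2 = (1 - ρ) ^ 2 + 2 * ρ * (1 - Real.cos θ) := by
    rw [← Complex.normSq_eq_norm_sq, Complex.normSq_apply]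
    simp only [Complex.sub_re, Complex.sub_im, circleMap, zero_add, Complex.one_re,
      Complex.one_im, Complex.re_ofReal_mul, Complex.im_ofReal_mul, Complex.exp_ofReal_mul_I_re,
      Complex.exp_ofReal_mul_I_im]
    nlinarith [Real.sin_sq_add_cos_sq θ]
  have hc := Real.cos_le_one_sub_mul_cos_sq hθ
  set t := |θ| / Real.pi with ht
  have ht0 : 0 ≤ t := by positivity
  have ht1 : t ≤ 1 := (div_le_one hpi).2 hθ
  have htq : 2 / Real.pi ^ 2 * θ ^ 2 = 2 * t ^ 2 := by
    rw [ht, div_pow, sq_abs]; ring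
  have h2 : t ≤ ‖1 - circleMap 0 ρ θ‖ := by
    refine abs_le_of_sq_le_sq' ?_ (norm_nonneg _) |>.2
    rw [e]
    have : 1 - Real.cos θ ≥ 2 * t ^ 2 := by linarith
    have h3 : 2 * ρ * (1 - Real.cos θ) ≥ 2 * ρ * (2 * t ^ 2) := by gcongr
    have h4 : t ^ 2 ≤ 1 := by nlinarith
    nlinarith [mul_nonneg h0 (sq_nonneg t), sq_nonneg (1 - ρ), mul_nonneg h0 h0,
      mul_nonneg (mul_nonneg h0 h0) (sq_nonneg t),
      mul_nonneg (sub_nonneg.2 h4) (sq_nonneg (1 - ρ))]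
  have h3 : 1 - ρ ≤ ‖1 - circleMap 0 ρ θ‖ := by
    have := norm_sub_norm_le 1 (circleMap 0 ρ θ)
    rwa [norm_one, norm_circleMap_zero' h0] at this
  have h4 : |θ| = Real.pi * t := by rw [ht]; field_simp
  have := Real.pi_le_four
  nlinarith

lemma lintegral_comp_abs_le (g : ℝ → ℝ≥0∞) (s : Set ℝ) :
    ∫⁻ θ in s, g |θ| ≤ 2 * ∫⁻ x in Ioi 0, g x := by
  have h0 : ∫⁻ θ in s, g |θ| ≤ ∫⁻ θ in ({0}ᶜ : Set ℝ), g |θ| := by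
    rw [restrict_compl_singleton]
    exact setLIntegral_le_lintegral _ _
  have e : ({0}ᶜ : Set ℝ) = Iio 0 ∪ Ioi 0 := by
    ext x; simp
  have h1 : ∫⁻ θ in Ioi 0, g |θ| = ∫⁻ x in Ioi 0, g x :=
    setLIntegral_congr_fun measurableSet_Ioi fun x hx => by
      rw [abs_of_pos hx]
  have h2 : ∫⁻ θ in Iio 0, g |θ| = ∫⁻ x in Ioi 0, g x := by
    rw [← h1, ← (Measure.measurePreserving_neg (volume : Measure ℝ)).setLIntegral_comp_preimage_emb
      (Homeomorph.neg ℝ).measurableEmbedding (fun x => g |x|) (Ioi 0)]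
    simp
  refine h0.trans ?_
  rw [e]
  refine (lintegral_union_le _ _ _).trans ?_
  rw [h1, h2, two_mul]

lemma lintegral_Ioi_add_rpow {a y : ℝ} (ha : 0 < a) (hy : 0 < y) :
    ∫⁻ x in Ioi 0, ENNReal.ofReal ((a + x) ^ (-(y + 1))) = ENNReal.ofReal (a ^ (-y) / y) := by
  have h := (measurePreserving_add_left (volume : Measure ℝ) a).setLIntegral_comp_preimage_emb
    (Homeomorph.addLeft a).measurableEmbedding (fun x => ENNReal.ofReal (x ^ (-(y + 1)))) (Ioi a)
  have e : (fun x => a + x) ⁻¹' Ioi a = Ioi 0 := by ext x; simp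
  rw [e] at h
  rw [h, ← ofReal_integral_eq_lintegral_ofReal (integrableOn_Ioi_rpow_of_lt (by linarith) ha),
    integral_Ioi_rpow_of_lt (by linarith) ha]
  · congr 1
    rw [show -(y + 1) + 1 = -y by ring, neg_div_neg_eq]
  · filter_upwards [ae_restrict_mem measurableSet_Ioi] with x hx
    have : 0 < x := ha.trans hx
    positivity

lemma lintegral_norm_one_sub_circleMap_rpow {y : ℝ} (hy : 0 < y) {ρ : ℝ} (h0 : 0 ≤ ρ)
    (h1 : ρ < 1) :
    ∫⁻ θ in Ioo (-Real.pi) Real.pi, ENNReal.ofReal (‖1 - circleMap 0 ρ θ‖ ^ (-(y + 1))) ≤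
      ENNReal.ofReal (2 * 5 ^ (y + 1) / y * (1 - ρ) ^ (-y)) := by
  have ha : 0 < 1 - ρ := by linarith
  calc _ ≤ ∫⁻ θ in Ioo (-Real.pi) Real.pi,
        ENNReal.ofReal (5 ^ (y + 1)) * ENNReal.ofReal (((1 - ρ) + |θ|) ^ (-(y + 1))) := by
        refine setLIntegral_mono' measurableSet_Ioo fun θ hθ => ?_
        rw [← ENNReal.ofReal_mul (by positivity)]
        refine ENNReal.ofReal_le_ofReal ?_
        have h2 := le_norm_one_sub_circleMap h0 (abs_le.2 ⟨hθ.1.le, hθ.2.le⟩)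
        have h3 : 0 < (1 - ρ) + |θ| := by positivity
        refine (Real.rpow_le_rpow_of_nonpos (by positivity) h2 (by linarith)).trans_eq ?_
        rw [Real.div_rpow h3.le (by norm_num), Real.rpow_neg (by norm_num : (0:ℝ) ≤ 5)]
        field_simp
    _ ≤ ENNReal.ofReal (5 ^ (y + 1)) * (2 * ENNReal.ofReal ((1 - ρ) ^ (-y) / y)) := by
        rw [lintegral_const_mul' _ _ ENNReal.ofReal_ne_top]
        gcongr
        rw [← lintegral_Ioi_add_rpow ha hy]
        exact lintegral_comp_abs_le (fun x => ENNReal.ofReal (((1 - ρ) + x) ^ (-(y + 1)))) _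
    _ = _ := by
        rw [show (2:ℝ≥0∞) = ENNReal.ofReal 2 by simp, ← ENNReal.ofReal_mul (by norm_num),
          ← ENNReal.ofReal_mul (by positivity)]
        congr 1; ring

lemma lintegral_rpow_mul_max {x y a : ℝ} (hx : 0 < x) (hxy : x < y) (ha : 0 < a) :
    ∫⁻ s in Ioo (0:ℝ) 1, ENNReal.ofReal ((1 - s) ^ (x - 1) * (max a (1 - s)) ^ (-y)) ≤
      ENNReal.ofReal ((1 / x + 1 / (y - x)) * a ^ (x - y)) := by
  have h := (Measure.measurePreserving_sub_left (volume : Measure ℝ)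
    1).setLIntegral_comp_preimage_emb (Homeomorph.subLeft (1:ℝ)).measurableEmbedding
    (fun s => ENNReal.ofReal (s ^ (x - 1) * (max a s) ^ (-y))) (Ioo 0 1)
  have e : (fun x => 1 - x) ⁻¹' Ioo (0:ℝ) 1 = Ioo (0:ℝ) 1 := by
    ext x; simp only [mem_preimage, mem_Ioo]; constructor <;> rintro ⟨h1, h2⟩ <;>
    constructor <;> linarith
  rw [e] at h
  rw [h]
  have h1 : ∫⁻ s in Ioc (0:ℝ) a, ENNReal.ofReal (s ^ (x - 1) * (max a s) ^ (-y)) =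
      ENNReal.ofReal (1 / x * a ^ (x - y)) := by
    have : ∫⁻ s in Ioc (0:ℝ) a, ENNReal.ofReal (s ^ (x - 1) * (max a s) ^ (-y)) =
        ∫⁻ s in Ioc (0:ℝ) a, ENNReal.ofReal (a ^ (-y) * s ^ (x - 1)) := by
      refine setLIntegral_congr_fun measurableSet_Ioc fun s hs => ?_
      rw [max_eq_left hs.2, mul_comm]
    rw [this, ← ofReal_integral_eq_lintegral_ofReal, integral_const_mul,
      ← intervalIntegral.integral_of_le ha.le, integral_rpow (Or.inl (by linarith)),
      Real.zero_rpow (by linarith)]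
    · congr 1
      rw [sub_add_cancel, sub_eq_add_neg x y, Real.rpow_add ha]; ring
    · exact ((intervalIntegral.intervalIntegrable_rpow' (by linarith)).1).const_mul _
    · filter_upwards [ae_restrict_mem measurableSet_Ioc] with s hs
      have := hs.1
      have : 0 ≤ s ^ (x - 1) := by positivity
      positivity
  have h2 : ∫⁻ s in Ioi a, ENNReal.ofReal (s ^ (x - 1) * (max a s) ^ (-y)) =
      ENNReal.ofReal (1 / (y - x) * a ^ (x - y)) := by
    have : ∫⁻ s in Ioi a, ENNReal.ofReal (s ^ (x - 1) * (max a s) ^ (-y)) =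
        ∫⁻ s in Ioi a, ENNReal.ofReal (s ^ (x - 1 - y)) := by
      refine setLIntegral_congr_fun measurableSet_Ioi fun s hs => ?_
      rw [max_eq_right (le_of_lt hs), sub_eq_add_neg (x - 1) y, Real.rpow_add (ha.trans hs)]
    rw [this, ← ofReal_integral_eq_lintegral_ofReal
      (integrableOn_Ioi_rpow_of_lt (by linarith) ha), integral_Ioi_rpow_of_lt (by linarith) ha]
    · congr 1
      rw [show x - 1 - y + 1 = -(y - x) by ring, neg_div_neg_eq, neg_sub]; ring
    · filter_upwards [ae_restrict_mem measurableSet_Ioi] with s hs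
      have : 0 < s := ha.trans hs
      positivity
  have h3 : Ioo (0:ℝ) 1 ⊆ Ioc 0 a ∪ Ioi a := by
    intro s hs
    rcases le_or_gt s a with h | h
    · exact Or.inl ⟨hs.1, h⟩
    · exact Or.inr h
  refine (lintegral_mono_set h3).trans ((lintegral_union_le _ _ _).trans_eq ?_)
  have : 0 < y - x := by linarith
  rw [h1, h2, ← ENNReal.ofReal_add (by positivity) (by positivity), add_mul]

lemma lintegral_UD_rotation (u : Circle) (F : ℂ → ℝ≥0∞) :
    ∫⁻ ζ in UD, F (u * ζ) ∂dA = ∫⁻ ζ in UD, F ζ ∂dA := by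
  have hr := (rotation u).measurePreserving
  have h := hr.setLIntegral_comp_preimage_emb
    (rotation u).toHomeomorph.measurableEmbedding F UD
  have e : (rotation u) ⁻¹' UD = UD := by
    ext z
    rw [mem_preimage, mem_UD, mem_UD, (rotation u).norm_map]
  rw [e] at h
  simp only [rotation_apply] at h
  simp [dA, Measure.restrict_smul, lintegral_smul_measure, h]

/-- The Forelli–Rudin estimate. -/
lemma forelliRudin {x y : ℝ} (hx : 0 < x) (hxy : x < y) : ∃ C > (0:ℝ), ∀ z ∈ UD,
    ∫⁻ ζ in UD, ENNReal.ofReal ((1 - ‖ζ‖) ^ (x - 1) * hk z ζ ^ (-(y + 1))) ∂dA ≤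
      ENNReal.ofReal (C * (1 - ‖z‖) ^ (x - y)) := by
  have hpi := Real.pi_pos
  have hy : 0 < y := hx.trans hxy
  have hyx : 0 < y - x := by linarith
  refine ⟨Real.pi⁻¹ * (2 * 5 ^ (y + 1) / y * (1 / x + 1 / (y - x))), by positivity,
    fun z hz => ?_⟩
  have hz1 := mem_UD.1 hz
  obtain ⟨u, hu⟩ : ∃ u : Circle, z = ‖z‖ * u := ⟨Circle.exp z.arg, by
    rw [Circle.coe_exp]; exact eq_norm_mul_exp z⟩
  set ρ := ‖z‖ with hρ
  have e1 : ∀ ζ : ℂ, hk z (u * ζ) = ‖1 - ρ * ζ‖ := by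
    intro ζ
    rw [hk, hu, map_mul, Complex.conj_ofReal]
    congr 2
    have : conj (u : ℂ) * u = 1 := by
      rw [mul_comm, Complex.mul_conj, Circle.normSq_coe, Complex.ofReal_one]
    linear_combination (ρ * ζ : ℂ) * this
  rw [← lintegral_UD_rotation u]
  simp only [norm_mul, Circle.norm_coe, one_mul, e1]
  have hcm := measurable_circleMap_prod
  have hcm2 := hcm.comp measurable_swap
  simp only [Function.comp_def, Prod.fst_swap, Prod.snd_swap] at hcm2
  rw [lintegral_disk (by fun_prop), lintegral_lintegral_swap (by fun_prop), mul_assoc,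
    ENNReal.ofReal_mul (by positivity), ENNReal.ofReal_inv_of_pos hpi]
  gcongr
  calc _ ≤ ∫⁻ s in Ioo (0:ℝ) 1, ENNReal.ofReal (2 * 5 ^ (y + 1) / y) *
        ENNReal.ofReal ((1 - s) ^ (x - 1) * (max (1 - ρ) (1 - s)) ^ (-y)) := by
        refine setLIntegral_mono' measurableSet_Ioo fun s hs => ?_
        have hs1 : 0 < 1 - s := by linarith [hs.2]
        have hρ0 : 0 ≤ ρ := norm_nonneg z
        have e2 : ∀ θ, ENNReal.ofReal s * ENNReal.ofReal ((1 - ‖circleMap 0 s θ‖) ^ (x - 1) *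
            ‖1 - ρ * circleMap 0 s θ‖ ^ (-(y + 1))) = ENNReal.ofReal (s * (1 - s) ^ (x - 1)) *
              ENNReal.ofReal (‖1 - circleMap 0 (ρ * s) θ‖ ^ (-(y + 1))) := by
          intro θ
          rw [norm_circleMap_zero' hs.1.le, ← ENNReal.ofReal_mul hs.1.le,
            ← ENNReal.ofReal_mul (by have := hs.1.le; positivity)]
          have : (ρ:ℂ) * circleMap 0 s θ = circleMap 0 (ρ * s) θ := by
            simp [circleMap, mul_assoc]
          rw [this, mul_assoc]
        simp_rw [e2]
        rw [lintegral_const_mul' _ _ ENNReal.ofReal_ne_top]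
        have hs0 := hs.1.le
        have hmax : 0 < max (1 - ρ) (1 - s) := lt_max_of_lt_right hs1
        calc _ ≤ ENNReal.ofReal (1 * (1 - s) ^ (x - 1)) *
              ENNReal.ofReal (2 * 5 ^ (y + 1) / y * (max (1 - ρ) (1 - s)) ^ (-y)) := by
              gcongr
              · exact hs.2.le
              refine (lintegral_norm_one_sub_circleMap_rpow hy (by positivity)
                (by nlinarith)).trans ?_
              refine ENNReal.ofReal_le_ofReal ?_
              gcongr 1
              refine Real.rpow_le_rpow_of_nonpos hmax (max_le ?_ ?_) (by linarith)
              · nlinarith [hs.2]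
              · nlinarith
          _ = _ := by
              rw [← ENNReal.ofReal_mul (by positivity), ← ENNReal.ofReal_mul (by positivity)]
              congr 1; ring
    _ ≤ _ := by
        rw [lintegral_const_mul' _ _ ENNReal.ofReal_ne_top, mul_assoc,
          ENNReal.ofReal_mul (by positivity)]
        gcongr
        exact lintegral_rpow_mul_max hx hxy (by linarith)

lemma one_sub_mul_tsum {b : ℕ → ℂ} {w : ℂ} (h : Summable fun n => b n * w ^ n) :
    (1 - w) * ∑' n, b n * w ^ n = b 0 + w * ∑' n, (b (n + 1) - b n) * w ^ n := by
  rcases eq_or_ne w 0 with rfl | hw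
  · rw [tsum_eq_single 0 (by intro n hn; simp [hn])]; simp
  have h1 : Summable fun n => b (n + 1) * w ^ n := by
    have := ((summable_nat_add_iff 1).2 h).mul_left w⁻¹
    refine this.congr fun n => ?_
    rw [pow_succ]; field_simp
  have e : ∀ n, (b (n + 1) - b n) * w ^ n = b (n + 1) * w ^ n - b n * w ^ n := fun n => by ring
  simp_rw [e]
  rw [h1.tsum_sub h, mul_sub, ← tsum_mul_left (f := fun n => b (n + 1) * w ^ n)]
  have := h.tsum_eq_zero_add
  have e2 : ∀ n, w * (b (n + 1) * w ^ n) = b (n + 1) * w ^ (n + 1) := fun n => by ring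
  simp_rw [e2]
  rw [sub_mul, one_mul]
  nth_rewrite 1 [this]
  ring

lemma summable_diff {b : ℕ → ℂ} {w : ℂ} (h : Summable fun n => b n * w ^ n) :
    Summable fun n => (b (n + 1) - b n) * w ^ n := by
  rcases eq_or_ne w 0 with rfl | hw
  · exact summable_of_ne_finset_zero (s := {0}) fun n hn => by
      simp only [Finset.mem_singleton] at hn; simp [hn]
  have h1 : Summable fun n => b (n + 1) * w ^ n := by
    have := ((summable_nat_add_iff 1).2 h).mul_left w⁻¹
    refine this.congr fun n => ?_
    rw [pow_succ]; field_simp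
  exact (h1.sub h).congr fun n => by ring

lemma sq_norm_one_sub_mul_tsum_le {b : ℕ → ℂ} {w : ℂ} (hw : ‖w‖ ≤ 1)
    (h : Summable fun n => b n * w ^ n) {S : ℝ}
    (hS : HasSum (fun n => ‖(b (n + 2) - 2 * b (n + 1) + b n) * w ^ n‖) S) :
    ‖1 - w‖ ^ 2 * ‖∑' n, b n * w ^ n‖ ≤ ‖1 - w‖ * ‖b 0‖ + ‖b 1 - b 0‖ + S := by
  have h1 := one_sub_mul_tsum h
  have h2 := one_sub_mul_tsum (b := fun n => b (n + 1) - b n) (summable_diff h)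
  rw [← norm_pow, ← norm_mul]
  have e : (1 - w) ^ 2 * ∑' n, b n * w ^ n = (1 - w) * b 0 + w * ((b 1 - b 0) +
      w * ∑' n, (b (n + 2) - 2 * b (n + 1) + b n) * w ^ n) := by
    rw [pow_two, mul_assoc, h1, mul_add]
    have : ∀ n, (b (n + 2) - 2 * b (n + 1) + b n) * w ^ n =
      (b (n + 1 + 1) - b (n + 1) - (b (n + 1) - b n)) * w ^ n := fun n => by ring
    simp_rw [this, ← h2]
    ring
  rw [e]
  have h3 : ‖∑' n, (b (n + 2) - 2 * b (n + 1) + b n) * w ^ n‖ ≤ S := tsum_of_norm_bounded hS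
    fun n => le_rfl
  have hw0 := norm_nonneg w
  have h4 := norm_add_le ((1 - w) * b 0) (w * ((b 1 - b 0) +
      w * ∑' n, (b (n + 2) - 2 * b (n + 1) + b n) * w ^ n))
  have h5 := norm_add_le (b 1 - b 0) (w * ∑' n, (b (n + 2) - 2 * b (n + 1) + b n) * w ^ n)
  rw [norm_mul, norm_mul w] at h4
  rw [norm_mul] at h5
  have h6 := mul_le_mul_of_nonneg_right hw
    (norm_nonneg ((b 1 - b 0) + w * ∑' n, (b (n + 2) - 2 * b (n + 1) + b n) * w ^ n))
  have h7 := mul_le_mul_of_nonneg_right hw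
    (norm_nonneg (∑' n, (b (n + 2) - 2 * b (n + 1) + b n) * w ^ n))
  linarith

lemma rpow_sub_two_le {α x : ℝ} (hα : α < 1) (h0 : 0 < α) (hx : 0 < x) :
    (x + 1) ^ (α - 2) ≤ (1 - α)⁻¹ * (x ^ (α - 1) - (x + 1) ^ (α - 1)) := by
  have h1 : 0 < 1 - α := by linarith
  have hx1 : 0 < x + 1 := by linarith
  rw [inv_mul_eq_div, le_div_iff₀ h1]
  have hb := rpow_one_add_le_one_add_mul_self (s := - (1 / (x + 1))) (p := 1 - α)
    (by rw [neg_le_neg_iff, div_le_one hx1]; linarith) h1.le (by linarith)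
  have e : 1 + -(1 / (x + 1)) = x / (x + 1) := by field_simp; ring
  rw [e, Real.div_rpow hx.le hx1.le] at hb
  have e1 : (x + 1) ^ (α - 2) = (x + 1) ^ (α - 1) / (x + 1) := by
    rw [← Real.rpow_sub_one hx1.ne']; ring_nf
  have e3 : x ^ (1 - α) = (x ^ (α - 1))⁻¹ := by rw [← Real.rpow_neg hx.le]; ring_nf
  have e4 : (x + 1) ^ (1 - α) = ((x + 1) ^ (α - 1))⁻¹ := by
    rw [← Real.rpow_neg hx1.le]; ring_nf
  rw [e3, e4, inv_div_inv] at hb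
  have p1 : 0 < (x + 1) ^ (α - 1) := by positivity
  have p2 : 0 < x ^ (α - 1) := by positivity
  rw [e1]
  set P := (x + 1) ^ (α - 1)
  set Q := x ^ (α - 1)
  rw [div_le_iff₀ p2] at hb
  have ht : P / (x + 1) * (1 - α) = P * ((1 - α) * (1 / (x + 1))) := by ring
  rw [ht]
  set t := (1 - α) * (1 / (x + 1))
  have ht0 : 0 ≤ t := by positivity
  have hb' : P ≤ (1 - t) * Q := by linarith
  nlinarith [mul_le_mul_of_nonneg_right hb' (by linarith : 0 ≤ 1 + t), 
    mul_nonneg p2.le (mul_nonneg ht0 ht0)]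

lemma hasSum_rpow_sub {α x : ℝ} (hα : α < 1) (hx : 0 < x) :
    HasSum (fun n : ℕ => (x + n) ^ (α - 1) - (x + n + 1) ^ (α - 1)) (x ^ (α - 1)) := by
  have ht : Filter.Tendsto (fun n : ℕ => (x + n) ^ (α - 1)) Filter.atTop (nhds 0) := by
    have h1 := tendsto_rpow_neg_atTop (y := 1 - α) (by linarith)
    rw [neg_sub] at h1
    exact h1.comp (Filter.tendsto_atTop_add_const_left _ x tendsto_natCast_atTop_atTop)
  refine (hasSum_iff_tendsto_nat_of_nonneg (fun n => ?_) _).2 ?_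
  · have : 0 < x + n := by positivity
    exact sub_nonneg.2 (Real.rpow_le_rpow_of_nonpos this (by linarith) (by linarith))
  · have := ht.const_sub (x ^ (α - 1))
    rw [sub_zero] at this
    refine this.congr fun n => ?_
    have := Finset.sum_range_sub' (fun n : ℕ => (x + n) ^ (α - 1)) n
    simp only [Nat.cast_add, Nat.cast_one, Nat.cast_zero, add_zero, ← add_assoc] at this
    exact this.symm

/-- Power series whose coefficients are smooth of order `α` are `O(|1-w|^{-1-α})`. -/
lemma norm_tsum_le_of_smooth {α : ℝ} (hα : α < 1) (h0 : 0 < α) {a : ℕ → ℂ} {w : ℂ} {E : ℝ}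
    (hE : 0 ≤ E) (hw : ‖w‖ < 1) (h : Summable fun n => a n * w ^ n)
    (ha : ∀ n, ‖a n‖ * ‖w‖ ^ n ≤ E * (n + 1) ^ α)
    (hd : ∀ n, ‖a (n + 1) - a n‖ * ‖w‖ ^ n ≤ E * (n + 1) ^ (α - 1))
    (hdd : ∀ n, ‖a (n + 2) - 2 * a (n + 1) + a n‖ * ‖w‖ ^ n ≤ E * (n + 1) ^ (α - 2)) :
    ‖∑' n, a n * w ^ n‖ ≤ (15 + (1 - α)⁻¹) * E * ‖1 - w‖ ^ (-(1 + α)) := by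
  have h1 : 0 < 1 - α := by linarith
  set H := ‖1 - w‖ with hH
  have hH0 : 0 < H := by
    have := norm_sub_norm_le 1 w
    rw [norm_one] at this
    linarith
  have hH2 : H ≤ 2 := by
    have := norm_sub_le 1 w
    rw [norm_one] at this
    linarith
  obtain ⟨X, hX1, hX2⟩ : ∃ X : ℕ, 1 / H ≤ X ∧ (X : ℝ) < 1 / H + 1 :=
    ⟨⌈1 / H⌉₊, Nat.le_ceil _, Nat.ceil_lt_add_one (by positivity)⟩
  have hX0 : (0:ℝ) < X := lt_of_lt_of_le (by positivity) hX1
  have hX3 : (1:ℝ) ≤ X := by exact_mod_cast (show 1 ≤ X by exact_mod_cast hX0)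
  have hH' : 1 ≤ 2 / H := by rw [le_div_iff₀ hH0]; linarith
  have hXX : (X : ℝ) ≤ 3 / H := by
    have : 3 / H = 1 / H + 2 / H := by ring
    linarith
  have hXX1 : (X : ℝ) + 1 ≤ 5 / H := by
    have : 5 / H = 3 / H + 2 / H := by ring
    linarith
  have hw0 := norm_nonneg w
  set R := H ^ (-(1 + α)) with hR
  have hR0 : 0 < R := by positivity
  have head : ‖∑ n ∈ Finset.range X, a n * w ^ n‖ ≤ 9 * E * R := by
    refine (norm_sum_le _ _).trans ?_
    have : ∀ n ∈ Finset.range X, ‖a n * w ^ n‖ ≤ E * (X : ℝ) ^ α := by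
      intro n hn
      rw [norm_mul, norm_pow]
      refine (ha n).trans ?_
      gcongr
      exact_mod_cast Finset.mem_range.1 hn
    refine (Finset.sum_le_card_nsmul _ _ _ this).trans ?_
    rw [Finset.card_range, nsmul_eq_mul]
    calc (X : ℝ) * (E * (X : ℝ) ^ α) = E * (X : ℝ) ^ (1 + α) := by
          rw [Real.rpow_add hX0, Real.rpow_one]; ring
      _ ≤ E * (3 / H) ^ (1 + α) := by gcongr
      _ = 3 ^ (1 + α) * E * R := by
          rw [Real.div_rpow (by norm_num) hH0.le, hR, Real.rpow_neg hH0.le]; ring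
      _ ≤ 9 * E * R := by
          gcongr
          calc (3:ℝ) ^ (1 + α) ≤ 3 ^ (2:ℝ) := by gcongr <;> linarith
            _ = 9 := by norm_num
  have hsum : Summable fun n => a (n + X) * w ^ n := by
    rcases eq_or_ne w 0 with rfl | hw'
    · exact summable_of_ne_finset_zero (s := {0}) fun n hn => by
        simp only [Finset.mem_singleton] at hn; simp [hn]
    · have := ((summable_nat_add_iff X).2 h).mul_left (w ^ X)⁻¹
      refine this.congr fun n => ?_
      rw [pow_add]; field_simp
  have tail0 : ∑' n, a (n + X) * w ^ (n + X) = w ^ X * ∑' n, a (n + X) * w ^ n := by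
    rw [← tsum_mul_left]
    exact tsum_congr fun n => by ring
  have hdom := (hasSum_rpow_sub (α := α) hα hX0).mul_left (E * (1 - α)⁻¹)
  have hterm : ∀ n : ℕ, ‖w‖ ^ X * ‖(a (n + 2 + X) - 2 * a (n + 1 + X) + a (n + X)) * w ^ n‖ ≤
      E * (1 - α)⁻¹ * ((X + n : ℝ) ^ (α - 1) - (X + n + 1) ^ (α - 1)) := by
    intro n
    have e1 := hdd (n + X)
    have e2 := rpow_sub_two_le hα h0 (x := X + n) (by positivity)
    rw [norm_mul, norm_pow]
    calc _ = ‖a (n + X + 2) - 2 * a (n + X + 1) + a (n + X)‖ * ‖w‖ ^ (n + X) := by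
          rw [show n + 2 + X = n + X + 2 by ring, show n + 1 + X = n + X + 1 by ring]; ring
      _ ≤ E * (X + n + 1 : ℝ) ^ (α - 2) := by
          refine e1.trans_eq ?_
          push_cast; rw [add_comm (n:ℝ) X]
      _ ≤ _ := by rw [mul_assoc]; gcongr
  have hs2 : Summable fun n => ‖(a (n + 2 + X) - 2 * a (n + 1 + X) + a (n + X)) * w ^ n‖ := by
    have hb := summable_diff (b := fun n => a (n + 1 + X) - a (n + X))
      (summable_diff (b := fun n => a (n + X)) hsum)
    refine hb.norm.congr fun n => ?_
    congr 2
    rw [show n + 1 + 1 = n + 2 by ring]; ring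
  have ht := sq_norm_one_sub_mul_tsum_le hw.le hsum hs2.hasSum
  have hS : ‖w‖ ^ X * ∑' n, ‖(a (n + 2 + X) - 2 * a (n + 1 + X) + a (n + X)) * w ^ n‖ ≤
      E * (1 - α)⁻¹ * (X : ℝ) ^ (α - 1) := by
    rw [← tsum_mul_left, ← hdom.tsum_eq]
    exact (hs2.mul_left _).tsum_le_tsum hterm hdom.summable
  have hXm : (X : ℝ) ^ (α - 1) ≤ H ^ (1 - α) := by
    calc (X : ℝ) ^ (α - 1) ≤ (1 / H) ^ (α - 1) :=
          Real.rpow_le_rpow_of_nonpos (by positivity) hX1 (by linarith)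
      _ = H ^ (1 - α) := by
          rw [one_div, Real.inv_rpow hH0.le, ← Real.rpow_neg hH0.le, neg_sub]
  have tailb : ‖w ^ X * ∑' n, a (n + X) * w ^ n‖ ≤ (6 + (1 - α)⁻¹) * E * R := by
    have hk : H ^ 2 * ‖w ^ X * ∑' n, a (n + X) * w ^ n‖ ≤
        H ^ 2 * ((6 + (1 - α)⁻¹) * E * R) := by
      have e1 : H ^ 2 * R = H ^ (1 - α) := by
        rw [hR, ← Real.rpow_natCast, ← Real.rpow_add hH0]; congr 1; push_cast; ring
      calc _ = ‖w‖ ^ X * (H ^ 2 * ‖∑' n, a (n + X) * w ^ n‖) := by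
            rw [norm_mul, norm_pow]; ring
        _ ≤ ‖w‖ ^ X * (H * ‖a (0 + X)‖ + ‖a (1 + X) - a (0 + X)‖ +
              ∑' n, ‖(a (n + 2 + X) - 2 * a (n + 1 + X) + a (n + X)) * w ^ n‖) := by gcongr
        _ = H * (‖a X‖ * ‖w‖ ^ X) + ‖a (X + 1) - a X‖ * ‖w‖ ^ X + ‖w‖ ^ X *
              ∑' n, ‖(a (n + 2 + X) - 2 * a (n + 1 + X) + a (n + X)) * w ^ n‖ := by
            rw [zero_add, add_comm 1 X]; ring
        _ ≤ H * (E * (X + 1) ^ α) + E * (X + 1) ^ (α - 1) +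
              E * (1 - α)⁻¹ * (X : ℝ) ^ (α - 1) := by
            exact add_le_add (add_le_add (mul_le_mul_of_nonneg_left (ha X) hH0.le) (hd X)) hS
        _ ≤ H * (E * (5 * H ^ (-α))) + E * (X : ℝ) ^ (α - 1) +
              E * (1 - α)⁻¹ * (X : ℝ) ^ (α - 1) := by
            gcongr H * (E * ?_) + E * ?_ + _
            · calc ((X:ℝ) + 1) ^ α ≤ (5 / H) ^ α := by gcongr
                _ = 5 ^ α * H ^ (-α) := by
                  rw [Real.div_rpow (by norm_num) hH0.le, Real.rpow_neg hH0.le]; rfl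
                _ ≤ 5 * H ^ (-α) := by
                  gcongr
                  calc (5:ℝ) ^ α ≤ 5 ^ (1:ℝ) := by gcongr; norm_num
                    _ = 5 := by norm_num
            · exact Real.rpow_le_rpow_of_nonpos hX0 (by linarith) (by linarith)
        _ ≤ H * (E * (5 * H ^ (-α))) + E * H ^ (1 - α) + E * (1 - α)⁻¹ * H ^ (1 - α) := by
            gcongr
        _ = _ := by
            rw [show H ^ 2 * ((6 + (1 - α)⁻¹) * E * R) = (6 + (1 - α)⁻¹) * E * (H ^ 2 * R) by ring,
              e1, sub_eq_add_neg 1 α, Real.rpow_add hH0, Real.rpow_one]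
            ring
    exact le_of_mul_le_mul_left hk (by positivity)
  rw [← h.sum_add_tsum_nat_add X, tail0]
  refine (norm_add_le _ _).trans ((add_le_add head tailb).trans_eq ?_)
  ring

lemma mom_eq {ν : ℂ → ℝ} (hν : RadialWeight ν) (hp : WhatPos ν) (n : ℕ) :
    mom ν (2 * (n : ℝ) + 1) = ∫ t, t ^ (2 * n + 1) ∂(radialMeasure ν) := by
  have h := (integrableOn_of_whatPos hp).aemeasurable
  rw [radialMeasure, integral_withDensity_eq_integral_toReal_smul₀ h.ennreal_ofReal
    (by filter_upwards with _ using ENNReal.ofReal_lt_top), mom,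
    intervalIntegral.integral_of_le zero_le_one, integral_Ioc_eq_integral_Ioo]
  refine integral_congr_ae ?_
  filter_upwards with t
  rw [ENNReal.toReal_ofReal (hν.1 _), smul_eq_mul, mul_comm]
  congr 1
  rw [← Real.rpow_natCast]
  push_cast; rfl

lemma integrable_radialMeasure {ν : ℂ → ℝ} (hp : WhatPos ν) {f : ℝ → ℝ} (hf : Continuous f) :
    Integrable f (radialMeasure ν) := by
  have := isFiniteMeasure_radialMeasure hp
  obtain ⟨M, hM⟩ := (isCompact_Icc (a := (0:ℝ)) (b := 1)).exists_bound_of_continuousOn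
    hf.continuousOn
  refine Integrable.of_bound hf.aestronglyMeasurable M ?_
  filter_upwards [ae_radialMeasure] with s hs using hM s ⟨hs.1.le, hs.2.le⟩

lemma pow_mul_tl_le_mom {ν : ℂ → ℝ} (hp : WhatPos ν) (k : ℕ) {r : ℝ} (hr : 0 ≤ r) :
    r ^ k * tl ν (1 - r) ≤ ∫ t, t ^ k ∂(radialMeasure ν) := by
  have := isFiniteMeasure_radialMeasure hp
  have hi := integrable_radialMeasure hp (f := fun t => t ^ k) (by fun_prop)
  calc r ^ k * tl ν (1 - r) = ∫ t in Ioi r, r ^ k ∂(radialMeasure ν) := by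
        rw [setIntegral_const, smul_eq_mul, mul_comm, tl, sub_sub_cancel]; rfl
    _ ≤ ∫ t in Ioi r, t ^ k ∂(radialMeasure ν) := by
        refine setIntegral_mono_on (integrable_const _) hi.integrableOn measurableSet_Ioi
          fun t ht => ?_
        have : r ≤ t := le_of_lt ht
        gcongr
    _ ≤ _ := by
        refine setIntegral_le_integral hi ?_
        filter_upwards [ae_radialMeasure] with s hs
        exact pow_nonneg hs.1.le _

lemma tl_pos {ν : ℂ → ℝ} (hν : RadialWeight ν) (h : WhatPos ν) {t : ℝ} (h0 : 0 < t)
    (h1 : t ≤ 1) : 0 < tl ν t := by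
  rw [tl_eq_tail hν h h0.le h1]
  exact h _ (by linarith) (by linarith)

lemma mom_pos {ν : ℂ → ℝ} (hν : RadialWeight ν) (hp : WhatPos ν) (n : ℕ) :
    0 < mom ν (2 * (n : ℝ) + 1) := by
  rw [mom_eq hν hp]
  refine lt_of_lt_of_le ?_ (pow_mul_tl_le_mom hp _ (by norm_num : (0:ℝ) ≤ 1 / 2))
  have := tl_pos hν hp (t := 1 - 1 / 2) (by norm_num) (by norm_num)
  positivity

lemma summable_Bker {ν : ℂ → ℝ} (hν : RadialWeight ν) (hp : WhatPos ν) {ρ : ℝ} (h0 : 0 ≤ ρ)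
    (h1 : ρ < 1) : Summable fun n : ℕ => ρ ^ n / (2 * mom ν (2 * (n : ℝ) + 1)) := by
  obtain ⟨r, hr0, hr1, hr⟩ : ∃ r : ℝ, 0 < r ∧ r < 1 ∧ ρ < r ^ 2 := by
    refine ⟨√((1 + ρ) / 2), Real.sqrt_pos.2 (by linarith), ?_, ?_⟩
    · rw [Real.sqrt_lt' one_pos]; linarith
    · rw [Real.sq_sqrt (by linarith)]; linarith
  have hN := tl_pos hν hp (t := 1 - r) (by linarith) (by linarith)
  have hq : ρ / r ^ 2 < 1 := (div_lt_one (by positivity)).2 hr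
  refine Summable.of_nonneg_of_le (fun n => ?_) (fun n => ?_)
    ((summable_geometric_of_lt_one (by positivity) hq).mul_left (1 / (r * tl ν (1 - r))))
  · have := mom_pos hν hp n
    positivity
  · have := pow_mul_tl_le_mom hp (2 * n + 1) hr0.le
    rw [← mom_eq hν hp] at this
    have hm := mom_pos hν hp n
    calc ρ ^ n / (2 * mom ν (2 * (n : ℝ) + 1)) ≤ ρ ^ n / (r ^ (2 * n + 1) * tl ν (1 - r)) := by
          gcongr 1
          linarith
      _ = _ := by
          rw [div_pow, pow_succ, pow_mul]
          field_simp

lemma lintegral_rpow_mul_exp {a y : ℝ} (ha : 0 < a) (hy : 0 < y) :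
    ∫⁻ u in Ioi 0, ENNReal.ofReal (u ^ (a - 1) * Real.exp (-(y * u))) =
      ENNReal.ofReal (y ^ (-a) * Real.Gamma a) := by
  have h := Real.integral_rpow_mul_exp_neg_mul_Ioi ha hy
  have hG := Real.Gamma_pos_of_pos ha
  rw [← ofReal_integral_eq_lintegral_ofReal, h, Real.rpow_neg hy.le, one_div,
    Real.inv_rpow hy.le]
  · refine not_imp_comm.1 integral_undef ?_
    rw [h]
    positivity
  · filter_upwards [ae_restrict_mem measurableSet_Ioi] with u hu
    have : (0:ℝ) < u := hu
    positivity

lemma RegularTail.le_add {N : ℝ → ℝ} {α B C : ℝ} (hN : RegularTail N α B C) {u v : ℝ}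
    (hu : 0 < u) (hu1 : u ≤ 1) (hv : 0 < v) (hv1 : v ≤ 1) :
    N u ≤ C * ((u / v) ^ α + (u / v) ^ B) * N v := by
  have hC := hN.one_le
  have hp := hN.pos v hv hv1
  have h1 : 0 ≤ (u / v) ^ α := by positivity
  have h2 : 0 ≤ (u / v) ^ B := by positivity
  rcases le_total u v with h | h
  · refine (hN.lower u v hu h hv1).trans ?_
    gcongr; linarith
  · refine (hN.upper v u hv h hu1).trans ?_
    gcongr; linarith

lemma exists_moment_bound {ν : ℂ → ℝ} (hp : WhatPos ν) {α B C : ℝ}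
    (hN : RegularTail (tl ν) α B C) (j : ℕ) : ∃ C' > (0:ℝ), ∀ n : ℕ,
    ∫ t, t ^ (2 * n + 1) * (1 - t ^ 2) ^ j ∂(radialMeasure ν) ≤
      C' * ((n:ℝ) + 1) ^ (-(j:ℝ)) * tl ν (1 / (n + 1)) := by
  have hC := hN.one_le
  have hα := hN.alpha_pos
  have hB := hN.beta_pos
  have hG1 := Real.Gamma_pos_of_pos (show 0 < j + α by positivity)
  have hG2 := Real.Gamma_pos_of_pos (show 0 < j + B by positivity)
  refine ⟨2 * (C * 2 ^ B) * 2 ^ j * (2 ^ j * C * (Real.Gamma (j + α) + Real.Gamma (j + B))),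
    by positivity, fun n => ?_⟩
  set y : ℝ := (n : ℝ) + 1 with hy
  have hy1 : 1 ≤ y := by rw [hy]; simp
  have hy0 : 0 < y := by linarith
  have hNy := hN.pos (1 / y) (by positivity) ((div_le_one hy0).2 hy1)
  have hi := integrable_radialMeasure hp (f := fun t => t ^ (2 * n + 1) * (1 - t ^ 2) ^ j)
    (by fun_prop)
  have h0 : 0 ≤ᵐ[radialMeasure ν] fun t => t ^ (2 * n + 1) * (1 - t ^ 2) ^ j := by
    filter_upwards [ae_radialMeasure] with s hs
    have h1 := hs.1
    have h2 := hs.2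
    have : 0 ≤ 1 - s ^ 2 := by nlinarith
    simp only [Pi.zero_apply]
    positivity
  rw [← ENNReal.ofReal_le_ofReal_iff (by positivity),
    ofReal_integral_eq_lintegral_ofReal hi h0]
  refine (lintegral_radialMeasure_le hp hN (c := ENNReal.ofReal (2 ^ j)) (by fun_prop) ?_).trans ?_
  · intro s s' hs hss hs' h
    rw [← ENNReal.ofReal_mul (by positivity)]
    apply ENNReal.ofReal_le_ofReal
    have e0 := hs.le.trans hss
    have e1 : 0 ≤ 1 - s ^ 2 := by nlinarith
    have e2 : 1 - s ^ 2 ≤ 2 * (1 - s' ^ 2) := by nlinarith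
    calc s ^ (2 * n + 1) * (1 - s ^ 2) ^ j ≤ s' ^ (2 * n + 1) * (2 * (1 - s' ^ 2)) ^ j := by
          gcongr
      _ = _ := by rw [mul_pow]; ring
  set K : ℝ := 2 ^ j * C * tl ν (1 / y) with hK
  have key : ∫⁻ s in Ioo (0:ℝ) 1, ENNReal.ofReal (s ^ (2 * n + 1) * (1 - s ^ 2) ^ j) *
      ENNReal.ofReal (tl ν (1 - s) / (1 - s)) ≤
      ENNReal.ofReal (K * (y ^ (-(j:ℝ)) * (Real.Gamma (j + α) + Real.Gamma (j + B)))) := by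
    set Ψ : ℝ → ℝ≥0∞ := fun u => ENNReal.ofReal (K * y ^ α) *
        ENNReal.ofReal (u ^ (j + α - 1) * Real.exp (-(y * u))) + ENNReal.ofReal (K * y ^ B) *
        ENNReal.ofReal (u ^ (j + B - 1) * Real.exp (-(y * u))) with hΨ
    have hK0 : 0 ≤ K := by positivity
    have step : ∀ s ∈ Ioo (0:ℝ) 1, ENNReal.ofReal (s ^ (2 * n + 1) * (1 - s ^ 2) ^ j) *
        ENNReal.ofReal (tl ν (1 - s) / (1 - s)) ≤ Ψ (1 - s) := by
      intro s hs
      have hs0 := hs.1.le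
      set u := 1 - s with hu
      have hu0 : 0 < u := by linarith [hs.2]
      have hu1 : u ≤ 1 := by linarith
      have e1 : 0 ≤ 1 - s ^ 2 := by nlinarith [hs.2]
      have e2 : 1 - s ^ 2 ≤ 2 * u := by nlinarith [hs.2]
      have e3 : s ^ (2 * n + 1) ≤ Real.exp (-(y * u)) := by
        calc s ^ (2 * n + 1) ≤ s ^ (n + 1) := pow_le_pow_of_le_one hs0 hs.2.le (by omega)
          _ ≤ Real.exp (-u) ^ (n + 1) := by
            gcongr
            have := Real.add_one_le_exp (-u)
            linarith
          _ = _ := by rw [← Real.exp_nat_mul]; congr 1; push_cast; ring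
      have e4 := hN.le_add hu0 hu1 (v := 1 / y) (by positivity) ((div_le_one hy0).2 hy1)
      rw [hΨ]
      beta_reduce
      rw [← ENNReal.ofReal_mul (by positivity), ← ENNReal.ofReal_mul (by positivity),
        ← ENNReal.ofReal_mul (by positivity), ← ENNReal.ofReal_add (by positivity) (by positivity)]
      apply ENNReal.ofReal_le_ofReal
      have e5 : ∀ κ : ℝ, u ^ (j + κ - 1) = u ^ j * u ^ κ / u := by
        intro κ
        rw [Real.rpow_sub_one hu0.ne', Real.rpow_add hu0, Real.rpow_natCast]
      calc s ^ (2 * n + 1) * (1 - s ^ 2) ^ j * (tl ν u / u) ≤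
            Real.exp (-(y * u)) * (2 * u) ^ j *
              (C * ((u / (1 / y)) ^ α + (u / (1 / y)) ^ B) * tl ν (1 / y) / u) := by
            have := tl_nonneg ν u
            gcongr
        _ = _ := by
            rw [e5, e5, div_div_eq_mul_div, div_one, Real.mul_rpow hu0.le hy0.le,
              Real.mul_rpow hu0.le hy0.le, mul_pow, hK]
            ring
    refine (setLIntegral_mono' measurableSet_Ioo step).trans ?_
    have hsub := (Measure.measurePreserving_sub_left (volume : Measure ℝ)
      (1:ℝ)).setLIntegral_comp_preimage_emb (Homeomorph.subLeft (1:ℝ)).measurableEmbedding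
      Ψ (Ioo 0 1)
    have e : (fun x => 1 - x) ⁻¹' Ioo (0:ℝ) 1 = Ioo (0:ℝ) 1 := by
      ext x; simp only [mem_preimage, mem_Ioo]; constructor <;> rintro ⟨h1, h2⟩ <;>
      constructor <;> linarith
    rw [e] at hsub
    rw [hsub]
    refine (lintegral_mono_set (fun x hx => (hx.1 : x ∈ Ioi (0:ℝ)))).trans ?_
    rw [hΨ, lintegral_add_left (by fun_prop), lintegral_const_mul' _ _ ENNReal.ofReal_ne_top,
      lintegral_const_mul' _ _ ENNReal.ofReal_ne_top, lintegral_rpow_mul_exp (by positivity) hy0,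
      lintegral_rpow_mul_exp (by positivity) hy0, ← ENNReal.ofReal_mul (by positivity),
      ← ENNReal.ofReal_mul (by positivity), ← ENNReal.ofReal_add (by positivity) (by positivity)]
    apply ENNReal.ofReal_le_ofReal
    rw [neg_add, neg_add, Real.rpow_add hy0, Real.rpow_add hy0, Real.rpow_neg hy0.le α,
      Real.rpow_neg hy0.le B]
    apply le_of_eq
    have := (Real.rpow_pos_of_pos hy0 α).ne'
    have := (Real.rpow_pos_of_pos hy0 B).ne'
    field_simp
  refine (mul_le_mul_right key _).trans_eq ?_
  rw [← ENNReal.ofReal_mul (by positivity), ← ENNReal.ofReal_mul (by positivity), hK]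
  congr 1; ring

lemma rpow_le_mul_exp {k x : ℝ} (hk : 0 < k) (hx : 0 ≤ x) : x ^ k ≤ k ^ k * Real.exp x := by
  have h1 : x / k ≤ Real.exp (x / k) := by linarith [Real.add_one_le_exp (x / k)]
  calc x ^ k = k ^ k * (x / k) ^ k := by
        rw [← Real.mul_rpow hk.le (by positivity)]; congr 1; field_simp
    _ ≤ k ^ k * Real.exp (x / k) ^ k := by gcongr
    _ = _ := by rw [← Real.exp_mul]; congr 2; field_simp

lemma RegularTail.pow_mul_le {N : ℝ → ℝ} {α B C : ℝ} (hN : RegularTail N α B C) (hαB : α < B) :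
    ∃ K > (0:ℝ), ∀ ρ : ℝ, 0 ≤ ρ → ρ < 1 → ∀ n : ℕ,
      ρ ^ n * N (1 - ρ) ≤ K * (((n:ℝ) + 1) * (1 - ρ)) ^ α * N (1 / ((n:ℝ) + 1)) := by
  have hC := hN.one_le
  have hk : 0 < B - α := by linarith
  set k := B - α with hkdef
  refine ⟨C * (1 + Real.exp 1 * k ^ k), by positivity, fun ρ h0 h1 n => ?_⟩
  set y : ℝ := (n:ℝ) + 1 with hy
  have hy1 : 1 ≤ y := by rw [hy]; simp
  have hy0 : 0 < y := by linarith
  have hNy := hN.pos (1 / y) (by positivity) ((div_le_one hy0).2 hy1)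
  set δ := 1 - ρ with hδ
  have hδ0 : 0 < δ := by linarith
  have e4 := hN.le_add hδ0 (by linarith) (v := 1 / y) (by positivity) ((div_le_one hy0).2 hy1)
  have ex : δ / (1 / y) = y * δ := by rw [div_div_eq_mul_div, div_one, mul_comm]
  rw [ex] at e4
  set x := y * δ with hx
  have hx0 : 0 < x := by positivity
  have hρ : ρ ^ n ≤ Real.exp 1 * Real.exp (-x) := by
    calc ρ ^ n ≤ Real.exp (-δ) ^ n := by
          gcongr
          linarith [Real.add_one_le_exp (-δ)]
      _ = Real.exp (n * -δ) := by rw [← Real.exp_nat_mul]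
      _ ≤ Real.exp (1 + -x) := by
          apply Real.exp_le_exp.2
          rw [hx, hy]; nlinarith
      _ = _ := Real.exp_add _ _
  have hρ1 : ρ ^ n ≤ 1 := pow_le_one₀ h0 h1.le
  have hxB : x ^ B = x ^ α * x ^ k := by rw [← Real.rpow_add hx0]; congr 1; ring
  have hxk := rpow_le_mul_exp hk hx0.le
  have hxα : 0 < x ^ α := by positivity
  have e5 : ρ ^ n * (x ^ α + x ^ B) ≤ (1 + Real.exp 1 * k ^ k) * x ^ α := by
    have : ρ ^ n * x ^ k ≤ Real.exp 1 * k ^ k := by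
      calc ρ ^ n * x ^ k ≤ (Real.exp 1 * Real.exp (-x)) * (k ^ k * Real.exp x) := by gcongr
        _ = _ := by rw [Real.exp_neg]; field_simp
    rw [hxB]
    nlinarith
  calc ρ ^ n * N δ ≤ ρ ^ n * (C * (x ^ α + x ^ B) * N (1 / y)) := by gcongr
    _ = C * (ρ ^ n * (x ^ α + x ^ B)) * N (1 / y) := by ring
    _ ≤ C * ((1 + Real.exp 1 * k ^ k) * x ^ α) * N (1 / y) := by gcongr
    _ = _ := by ring

lemma abs_second_diff_inv_le {m₀ m₁ m₂ D E c : ℝ} (hc : 0 < c) (h2 : c ≤ m₂) (h21 : m₂ ≤ m₁)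
    (h10 : m₁ ≤ m₀) (hD : m₀ - m₁ ≤ D) (hE0 : 0 ≤ m₀ - 2 * m₁ + m₂)
    (hE : m₀ - 2 * m₁ + m₂ ≤ E) :
    |m₂⁻¹ - 2 * m₁⁻¹ + m₀⁻¹| ≤ E / c ^ 2 + 2 * D ^ 2 / c ^ 3 := by
  have p2 : 0 < m₂ := by linarith
  have p1 : 0 < m₁ := by linarith
  have p0 : 0 < m₀ := by linarith
  have e : m₂⁻¹ - 2 * m₁⁻¹ + m₀⁻¹ = -((m₀ - 2 * m₁ + m₂) / (m₁ * m₂)) +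
      (m₀ - m₂) * (m₀ - m₁) / (m₀ * m₁ * m₂) := by
    field_simp; ring
  have hE' : 0 ≤ E := hE0.trans hE
  have hD' : 0 ≤ D := by linarith
  rw [e]
  refine (abs_add_le _ _).trans (add_le_add ?_ ?_)
  · rw [abs_neg, abs_of_nonneg (by positivity)]
    rw [pow_two]
    gcongr
    linarith
  · have q1 : 0 ≤ m₀ - m₂ := by linarith
    have q2 : 0 ≤ m₀ - m₁ := by linarith
    rw [abs_of_nonneg (by positivity)]
    calc (m₀ - m₂) * (m₀ - m₁) / (m₀ * m₁ * m₂) ≤ (2 * D) * D / (c * c * c) := by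
          gcongr <;> linarith
      _ = _ := by ring

lemma exists_coef_bound {ν : ℂ → ℝ} (hν : RadialWeight ν) (hp : WhatPos ν) {α B C : ℝ}
    (hN : RegularTail (tl ν) α B C) : ∃ K > (0:ℝ), ∀ n : ℕ, ∀ m : ℕ → ℝ,
      (∀ n : ℕ, m n = 2 * mom ν (2 * (n : ℝ) + 1)) →
      (m n)⁻¹ ≤ K / tl ν (1 / ((n:ℝ) + 1)) ∧
      |(m (n + 1))⁻¹ - (m n)⁻¹| ≤ K * ((n:ℝ) + 1) ^ (-1:ℝ) / tl ν (1 / ((n:ℝ) + 1)) ∧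
      |(m (n + 2))⁻¹ - 2 * (m (n + 1))⁻¹ + (m n)⁻¹| ≤
        K * ((n:ℝ) + 1) ^ (-2:ℝ) / tl ν (1 / ((n:ℝ) + 1)) := by
  obtain ⟨C1, hC1, h1⟩ := exists_moment_bound hp hN 1
  obtain ⟨C2, hC2, h2⟩ := exists_moment_bound hp hN 2
  have hC := hN.one_le
  have hB := hN.beta_pos
  set c : ℝ := (C * 12 ^ B)⁻¹ with hc
  have hc0 : 0 < c := by positivity
  have K1 : 0 ≤ c⁻¹ := by positivity
  have K2 : 0 ≤ 2 * C1 / c ^ 2 := by positivity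
  have K3 : 0 ≤ 2 * C2 / c ^ 2 + 2 * (2 * C1) ^ 2 / c ^ 3 := by positivity
  refine ⟨c⁻¹ + 2 * C1 / c ^ 2 + (2 * C2 / c ^ 2 + 2 * (2 * C1) ^ 2 / c ^ 3), by positivity,
    fun n m hm => ?_⟩
  specialize h1 n
  specialize h2 n
  set K := c⁻¹ + 2 * C1 / c ^ 2 + (2 * C2 / c ^ 2 + 2 * (2 * C1) ^ 2 / c ^ 3) with hK
  set y : ℝ := (n:ℝ) + 1 with hy
  have hy1 : 1 ≤ y := by rw [hy]; simp
  have hy0 : 0 < y := by linarith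
  have hM := hN.pos (1 / y) (by positivity) ((div_le_one hy0).2 hy1)
  set M := tl ν (1 / y) with hMdef
  have hi : ∀ k : ℕ, Integrable (fun t => t ^ k) (radialMeasure ν) := fun k =>
    integrable_radialMeasure hp (by fun_prop)
  have hm' : ∀ n, m n = 2 * ∫ t, t ^ (2 * n + 1) ∂(radialMeasure ν) := fun n => by
    rw [hm, mom_eq hν hp]
  have d1 : ∀ n, m n - m (n + 1) =
      2 * ∫ t, t ^ (2 * n + 1) * (1 - t ^ 2) ^ 1 ∂(radialMeasure ν) := by
    intro n
    rw [hm', hm', ← mul_sub, ← integral_sub (hi _) (hi _)]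
    congr 2; ext t; ring
  have d2 : m n - 2 * m (n + 1) + m (n + 2) =
      2 * ∫ t, t ^ (2 * n + 1) * (1 - t ^ 2) ^ 2 ∂(radialMeasure ν) := by
    have : m n - 2 * m (n + 1) + m (n + 2) = (m n - m (n + 1)) - (m (n + 1) - m (n + 1 + 1)) := by
      ring
    rw [this, d1, d1, ← mul_sub, ← integral_sub]
    · congr 2; ext t; ring
    · exact integrable_radialMeasure hp (by fun_prop)
    · exact integrable_radialMeasure hp (by fun_prop)
  have nn : ∀ n j : ℕ, 0 ≤ ∫ t, t ^ (2 * n + 1) * (1 - t ^ 2) ^ j ∂(radialMeasure ν) := by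
    intro n j
    refine integral_nonneg_of_ae ?_
    filter_upwards [ae_radialMeasure] with s hs
    have h1 := hs.1
    have h2 := hs.2
    have : 0 ≤ 1 - s ^ 2 := by nlinarith
    simp only [Pi.zero_apply]
    positivity
  have a10 : m (n + 1) ≤ m n := by linarith [d1 n, nn n 1]
  have a21 : m (n + 2) ≤ m (n + 1) := by linarith [d1 (n + 1), nn (n + 1) 1]
  have low : c * M ≤ m (n + 2) := by
    set u : ℝ := 1 / (4 * (y + 2)) with hu
    have hu0 : 0 < u := by positivity
    have hu1 : u ≤ 1 / 4 := by
      rw [hu]; gcongr; linarith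
    have huy : u ≤ 1 / y := by
      rw [hu]; gcongr; linarith
    have l1 := pow_mul_tl_le_mom hp (2 * (n + 2) + 1) (r := 1 - u) (by linarith)
    rw [sub_sub_cancel] at l1
    have l2 := one_add_mul_le_pow (a := -u) (by linarith) (2 * (n + 2) + 1)
    have l3 : (1:ℝ) / 2 ≤ 1 + ((2 * (n + 2) + 1 : ℕ) : ℝ) * -u := by
      have : ((2 * (n + 2) + 1 : ℕ) : ℝ) = 2 * y + 3 := by rw [hy]; push_cast; ring
      rw [this]
      have : (2 * y + 3) * u ≤ 1 / 2 := by
        rw [hu, mul_one_div, div_le_div_iff₀ (by positivity) (by norm_num)]; linarith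
      linarith
    have l4 : 1 / 2 ≤ (1 - u) ^ (2 * (n + 2) + 1) := l3.trans l2
    have l5 := hN.upper u (1 / y) hu0 huy ((div_le_one hy0).2 hy1)
    have l6 : 1 / y / u ≤ 12 := by
      rw [hu, div_div_div_eq, one_mul, mul_one, div_le_iff₀ hy0]; linarith
    have l7 : c * M ≤ tl ν u := by
      rw [hc, inv_mul_le_iff₀ (by positivity)]
      refine l5.trans ?_
      have := tl_nonneg ν u
      gcongr
    rw [hm']
    have := tl_nonneg ν u
    nlinarith
  have hcM : 0 < c * M := by positivity
  have p1 : m n - m (n + 1) ≤ 2 * C1 * M / y := by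
    rw [d1]
    refine (mul_le_mul_of_nonneg_left h1 zero_le_two).trans_eq ?_
    rw [Nat.cast_one, Real.rpow_neg_one]; ring
  have p2 : m n - 2 * m (n + 1) + m (n + 2) ≤ 2 * C2 * M / y ^ 2 := by
    rw [d2]
    refine (mul_le_mul_of_nonneg_left h2 zero_le_two).trans_eq ?_
    rw [Real.rpow_neg hy0.le, Nat.cast_ofNat, Real.rpow_two]; ring
  have p3 : 0 ≤ m n - 2 * m (n + 1) + m (n + 2) := by
    rw [d2]; exact mul_nonneg zero_le_two (nn _ _)
  have q0 : 0 < m (n + 2) := by linarith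
  have q1 : 0 < m (n + 1) := by linarith
  have q2 : 0 < m n := by linarith
  refine ⟨?_, ?_, ?_⟩
  · calc (m n)⁻¹ ≤ (c * M)⁻¹ := by gcongr; linarith
      _ = c⁻¹ / M := by rw [mul_inv]; rfl
      _ ≤ K / M := by gcongr; linarith
  · have e : (m (n + 1))⁻¹ - (m n)⁻¹ = (m n - m (n + 1)) / (m (n + 1) * m n) := by
      field_simp
    have : 0 ≤ m n - m (n + 1) := by linarith
    rw [e, abs_of_nonneg (by positivity)]
    calc _ ≤ (2 * C1 * M / y) / ((c * M) * (c * M)) := by gcongr <;> linarith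
      _ = (2 * C1 / c ^ 2) * y ^ (-1:ℝ) / M := by
          rw [Real.rpow_neg_one]; field_simp
      _ ≤ _ := by gcongr; linarith
  · refine (abs_second_diff_inv_le hcM low a21 a10 p1 p3 p2).trans ?_
    calc _ = (2 * C2 / c ^ 2 + 2 * (2 * C1) ^ 2 / c ^ 3) * y ^ (-2:ℝ) / M := by
          rw [Real.rpow_neg hy0.le, Real.rpow_two]; field_simp
      _ ≤ _ := by gcongr; linarith

/-- Pointwise estimate for Bergman reproducing kernels of regular radial weights. -/
lemma exists_norm_tsum_mom_le {ν : ℂ → ℝ} (hν : RadialWeight ν) (hp : WhatPos ν) {α B C : ℝ}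
    (hN : RegularTail (tl ν) α B C) (hα : α < 1) (hαB : α < B) : ∃ K > (0:ℝ), ∀ w : ℂ, ‖w‖ < 1 →
    ‖∑' n : ℕ, w ^ n / ((2 * mom ν (2 * (n : ℝ) + 1) : ℝ) : ℂ)‖ ≤
      K * ((1 - ‖w‖) ^ α / tl ν (1 - ‖w‖)) * ‖1 - w‖ ^ (-(1 + α)) := by
  obtain ⟨K, hK, hK'⟩ := exists_coef_bound hν hp hN
  obtain ⟨L, hL, hL'⟩ := hN.pow_mul_le hαB
  have h1α : 0 < 1 - α := by linarith
  refine ⟨(15 + (1 - α)⁻¹) * (K * L), by positivity, fun w hw => ?_⟩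
  set m : ℕ → ℝ := fun n => 2 * mom ν (2 * (n : ℝ) + 1) with hm
  have hw0 := norm_nonneg w
  have hδ : 0 < 1 - ‖w‖ := by linarith
  have hNδ := hN.pos _ hδ (by linarith)
  set E := K * L * ((1 - ‖w‖) ^ α / tl ν (1 - ‖w‖)) with hE
  have key : ∀ n : ℕ, ∀ t κ : ℝ, t ≤ K * ((n:ℝ) + 1) ^ κ / tl ν (1 / ((n:ℝ) + 1)) →
      t * ‖w‖ ^ n ≤ E * ((n:ℝ) + 1) ^ (α + κ) := by
    intro n t κ ht
    have hy0 : (0:ℝ) < n + 1 := by positivity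
    have hM := hN.pos (1 / ((n:ℝ) + 1)) (by positivity) ((div_le_one hy0).2 (by simp))
    have h2 := hL' ‖w‖ hw0 hw n
    rw [Real.mul_rpow hy0.le hδ.le] at h2
    calc t * ‖w‖ ^ n ≤ (K * ((n:ℝ) + 1) ^ κ / tl ν (1 / ((n:ℝ) + 1))) *
          (L * (((n:ℝ) + 1) ^ α * (1 - ‖w‖) ^ α) * tl ν (1 / ((n:ℝ) + 1)) / tl ν (1 - ‖w‖)) := by
          gcongr
          rw [le_div_iff₀ hNδ]; exact h2
      _ = _ := by
          rw [Real.rpow_add hy0, hE]; field_simp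
  have hmpos : ∀ n, 0 < m n := fun n => mul_pos two_pos (mom_pos hν hp n)
  have hsum : Summable fun n => (((m n)⁻¹ : ℝ) : ℂ) * w ^ n := by
    refine Summable.of_norm ((summable_Bker hν hp hw0 hw).congr fun n => ?_)
    rw [norm_mul, norm_pow, Complex.norm_real, Real.norm_eq_abs, abs_of_pos (inv_pos.2 (hmpos n))]
    exact div_eq_inv_mul _ _
  have := norm_tsum_le_of_smooth (a := fun n => (((m n)⁻¹ : ℝ) : ℂ)) (w := w) (E := E) hα
    hN.alpha_pos (by positivity) hw hsum ?_ ?_ ?_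
  · have e : ∀ n : ℕ, w ^ n / ((2 * mom ν (2 * (n : ℝ) + 1) : ℝ) : ℂ) =
      (((m n)⁻¹ : ℝ) : ℂ) * w ^ n := fun n => by
        rw [Complex.ofReal_inv]; exact div_eq_inv_mul _ _
    simp_rw [e]
    refine this.trans_eq ?_
    rw [hE]; ring
  · intro n
    rw [Complex.norm_real, Real.norm_eq_abs, abs_of_pos (inv_pos.2 (hmpos n))]
    simpa using key n _ 0 (by simpa using (hK' n m fun _ => rfl).1)
  · intro n
    rw [← Complex.ofReal_sub, Complex.norm_real]
    exact key n _ _ (hK' n m fun _ => rfl).2.1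
  · intro n
    have := key n _ _ (hK' n m fun _ => rfl).2.2
    rw [← Real.norm_eq_abs, ← Complex.norm_real] at this
    push_cast at this ⊢
    exact this

lemma diskMeasure_eq_map {ν : ℂ → ℝ} (hν : RadialWeight ν) (hp : WhatPos ν) :
    diskMeasure ν = (ENNReal.ofReal Real.pi)⁻¹ •
      (((radialMeasure ν).withDensity (fun s => ENNReal.ofReal s)).prod
        (volume.restrict (Ioo (-Real.pi) Real.pi))).map (fun p => circleMap 0 p.1 p.2) := by
  refine Measure.ext_of_lintegral _ fun F hF => ?_
  have hc := measurable_circleMap_prod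
  have hc2 := hc.comp measurable_swap
  simp only [Function.comp_def, Prod.fst_swap, Prod.snd_swap] at hc2
  rw [lintegral_smul_measure, lintegral_map hF hc, lintegral_prod _ (by fun_prop),
    lintegral_diskMeasure hν hp hF, lintegral_lintegral_swap (by fun_prop), smul_eq_mul]
  congr 1
  have hm : Measurable fun s => ∫⁻ θ in Ioo (-Real.pi) Real.pi, F (circleMap 0 s θ) :=
    Measurable.lintegral_prod_right' (f := fun p : ℝ × ℝ => F (circleMap 0 p.1 p.2)) (hF.comp hc)
  rw [lintegral_withDensity_eq_lintegral_mul _ (by fun_prop) hm]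
  refine lintegral_congr fun s => ?_
  rw [lintegral_const_mul' _ _ ENNReal.ofReal_ne_top]; rfl

lemma integral_diskMeasure {ν : ℂ → ℝ} (hν : RadialWeight ν) (hp : WhatPos ν) {F : ℂ → ℂ}
    (hF : Integrable F (diskMeasure ν)) :
    ∫ z, F z ∂(diskMeasure ν) = (Real.pi : ℂ)⁻¹ *
      ∫ s : ℝ, (s : ℂ) * (∫ θ in Ioo (-Real.pi) Real.pi, F (circleMap 0 s θ)) ∂(radialMeasure ν) := by
  have hpi := Real.pi_pos
  have hc := measurable_circleMap_prod
  have hne : (ENNReal.ofReal Real.pi)⁻¹ ≠ 0 := by simp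
  have htop : (ENNReal.ofReal Real.pi)⁻¹ ≠ ∞ := by simp [hpi]
  rw [diskMeasure_eq_map hν hp] at hF ⊢
  rw [integrable_smul_measure hne htop] at hF
  have hi : Integrable (fun p : ℝ × ℝ => F (circleMap 0 p.1 p.2))
      (((radialMeasure ν).withDensity (fun s => ENNReal.ofReal s)).prod
        (volume.restrict (Ioo (-Real.pi) Real.pi))) :=
    (integrable_map_measure hF.1 hc.aemeasurable).1 hF
  rw [integral_smul_measure, integral_map hc.aemeasurable hF.1, integral_prod _ hi,
    integral_withDensity_eq_integral_toReal_smul₀ (by fun_prop)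
      (by filter_upwards with _ using ENNReal.ofReal_lt_top), ENNReal.toReal_inv,
    ENNReal.toReal_ofReal hpi.le, Complex.real_smul, Complex.ofReal_inv]
  congr 1
  refine integral_congr_ae ?_
  filter_upwards [ae_radialMeasure] with s hs
  rw [ENNReal.toReal_ofReal hs.1.le, Complex.real_smul]

lemma exists_coeff_circle {v : ℂ → ℂ} (hv : DifferentiableOn ℂ v UD) : ∃ a : ℕ → ℂ,
    (∀ z ∈ UD, HasSum (fun n => z ^ n * a n) (v z)) ∧ ∀ s : ℝ, 0 < s → s < 1 → ∀ n : ℕ,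
      ∫ θ in Ioo (-Real.pi) Real.pi, v (circleMap 0 s θ) * conj (circleMap 0 s θ) ^ n =
        2 * Real.pi * a n * s ^ (2 * n) := by
  have hpi := Real.pi_pos
  have hP : ∀ s : NNReal, 0 < s → s < 1 →
      HasFPowerSeriesOnBall v (cauchyPowerSeries v 0 s) 0 s := fun s h0 h1 =>
    (hv.mono (Metric.closedBall_subset_ball (by exact_mod_cast h1))).hasFPowerSeriesOnBall h0
  set p := cauchyPowerSeries v 0 ((1 / 2 : NNReal) : ℝ) with hp
  have h12 := hP (1 / 2) (by norm_num) (by rw [← NNReal.coe_lt_coe]; norm_num)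
  have hEq : ∀ s : NNReal, 0 < s → s < 1 → cauchyPowerSeries v 0 s = p := fun s h0 h1 =>
    (hP s h0 h1).hasFPowerSeriesAt.eq_formalMultilinearSeries h12.hasFPowerSeriesAt
  refine ⟨fun n => p.coeff n, fun z hz => ?_, fun s h0 h1 n => ?_⟩
  · have hz1 := mem_UD.1 hz
    have hz0 := norm_nonneg z
    set s : NNReal := ⟨(‖z‖ + 1) / 2, by positivity⟩ with hs
    have hs0 : 0 < s := by rw [← NNReal.coe_pos]; change 0 < (‖z‖ + 1) / 2; positivity
    have hs1 : s < 1 := by rw [← NNReal.coe_lt_coe]; change (‖z‖ + 1) / 2 < 1; linarith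
    have h := hP s hs0 hs1
    rw [hEq s hs0 hs1] at h
    have h2 := h.hasSum (y := z) (by
      rw [Metric.mem_eball, edist_zero_right, enorm_eq_nnnorm]
      have : ‖z‖₊ < s := by rw [← NNReal.coe_lt_coe]; change ‖z‖ < (‖z‖ + 1) / 2; linarith
      exact_mod_cast this)
    rw [zero_add] at h2
    refine h2.congr_fun fun n => ?_
    rw [FormalMultilinearSeries.apply_eq_pow_smul_coeff, smul_eq_mul]
  · have e1 := cauchyPowerSeries_apply v 0 s n 1
    have e2 := hEq ⟨s, h0.le⟩ h0 h1
    change cauchyPowerSeries v 0 s = p at e2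
    rw [e2] at e1
    have e3 : p.coeff n = p n fun _ => 1 := rfl
    beta_reduce
    rw [e3, e1, circleIntegral]
    have hper : Function.Periodic (fun θ => v (circleMap 0 s θ) * conj (circleMap 0 s θ) ^ n)
        (2 * Real.pi) := fun θ => by
      simp only [periodic_circleMap 0 s θ]
    have e4 := hper.intervalIntegral_add_eq (-Real.pi) 0
    rw [zero_add, show -Real.pi + 2 * Real.pi = Real.pi by ring] at e4
    rw [← integral_Ioc_eq_integral_Ioo, ← intervalIntegral.integral_of_le (by linarith), e4,
      show ∀ x : ℂ, 2 * Real.pi * ((2 * Real.pi * Complex.I : ℂ)⁻¹ • x) * s ^ (2 * n) =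
        (s ^ (2 * n) * Complex.I⁻¹) * x by
          intro x
          have : (Real.pi : ℂ) ≠ 0 := by exact_mod_cast hpi.ne'
          have := Complex.I_ne_zero
          rw [smul_eq_mul]; field_simp,
      ← intervalIntegral.integral_const_mul]
    refine intervalIntegral.integral_congr fun θ _ => ?_
    have hne : circleMap 0 s θ ≠ 0 := circleMap_ne_center h0.ne'
    have hcc : conj (circleMap 0 s θ) = s ^ 2 / circleMap 0 s θ := by
      rw [eq_div_iff hne, mul_comm, Complex.mul_conj, Complex.normSq_eq_norm_sq,
        norm_circleMap_zero' h0.le]; push_cast; rfl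
    have := Complex.I_ne_zero
    simp only [deriv_circleMap, smul_eq_mul, sub_zero, hcc]
    rw [div_pow, ← pow_mul, div_pow, one_pow]
    field_simp

lemma aemeasurable_weight {ν : ℂ → ℝ} (hν : RadialWeight ν) :
    AEMeasurable (fun z => ENNReal.ofReal (ν z)) (dA.restrict UD) :=
  hν.2.2.aemeasurable.ennreal_ofReal

lemma Pw_eq {ν : ℂ → ℝ} (hν : RadialWeight ν) (h : ℂ → ℂ) (z : ℂ) :
    Pw ν h z = ∫ ζ, h ζ * conj (Bker ν z ζ) ∂(diskMeasure ν) := by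
  rw [diskMeasure, integral_withDensity_eq_integral_toReal_smul₀ (aemeasurable_weight hν)
      (by filter_upwards with _ using ENNReal.ofReal_lt_top), Pw]
  refine integral_congr_ae ?_
  filter_upwards with ζ
  rw [ENNReal.toReal_ofReal (hν.1 _), Complex.real_smul, mul_comm]

lemma ae_diskMeasure (ν : ℂ → ℝ) : ∀ᵐ z ∂(diskMeasure ν), z ∈ UD :=
  (withDensity_absolutelyContinuous _ _).ae_le (ae_restrict_mem measurableSet_UD)

lemma aestronglyMeasurable_of_continuousOn {E : Type*} [TopologicalSpace E]
    [TopologicalSpace.PseudoMetrizableSpace E] [SecondCountableTopologyEither ℂ E] (ν : ℂ → ℝ)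
    {h : ℂ → E} (hh : ContinuousOn h UD) : AEStronglyMeasurable h (diskMeasure ν) :=
  (hh.aestronglyMeasurable measurableSet_UD).mono_ac (withDensity_absolutelyContinuous _ _)

lemma conj_Bker (ν : ℂ → ℝ) (z ζ : ℂ) : conj (Bker ν z ζ) =
    ∑' n : ℕ, (conj ζ * z) ^ n / ((2 * mom ν (2 * (n : ℝ) + 1) : ℝ) : ℂ) := by
  rw [Bker, Complex.conj_tsum]
  refine tsum_congr fun n => ?_
  rw [map_div₀, map_pow, map_mul, Complex.conj_conj, Complex.conj_ofReal]

lemma hasSum_Pw {ν : ℂ → ℝ} (hν : RadialWeight ν) (hp : WhatPos ν) {h : ℂ → ℂ}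
    (hh : Integrable h (diskMeasure ν)) {z : ℂ} (hz : z ∈ UD) :
    HasSum (fun n : ℕ => z ^ n * ((∫ ζ, h ζ * conj ζ ^ n ∂(diskMeasure ν)) /
      ((2 * mom ν (2 * (n : ℝ) + 1) : ℝ) : ℂ))) (Pw ν h z) := by
  have hz1 := mem_UD.1 hz
  set m : ℕ → ℝ := fun n => 2 * mom ν (2 * (n : ℝ) + 1) with hm
  have hmpos : ∀ n, 0 < m n := fun n => mul_pos two_pos (mom_pos hν hp n)
  have hb : ∀ n : ℕ, ∀ ζ ∈ UD, ‖(conj ζ * z) ^ n / (m n : ℂ)‖ ≤ ‖z‖ ^ n / m n := by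
    intro n ζ hζ
    rw [norm_div, norm_pow, norm_mul, RCLike.norm_conj, Complex.norm_real, Real.norm_eq_abs,
      abs_of_pos (hmpos n)]
    have := mem_UD.1 hζ
    gcongr
    · exact (hmpos n).le
    · nlinarith [norm_nonneg z]
  have hFi : ∀ n : ℕ, Integrable (fun ζ => h ζ * ((conj ζ * z) ^ n / (m n : ℂ)))
      (diskMeasure ν) := by
    intro n
    refine hh.mul_bdd (c := ‖z‖ ^ n / m n) ?_ ?_
    · exact (((Complex.continuous_conj.mul continuous_const).pow n).div_const
        _).aestronglyMeasurable
    · filter_upwards [ae_diskMeasure ν] with ζ hζ using hb n ζ hζ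
  have hFs : Summable fun n => ∫ ζ, ‖h ζ * ((conj ζ * z) ^ n / (m n : ℂ))‖ ∂(diskMeasure ν) := by
    refine Summable.of_nonneg_of_le (fun n => integral_nonneg fun _ => norm_nonneg _) (fun n => ?_)
      ((summable_Bker hν hp (norm_nonneg z) hz1).mul_left (∫ ζ, ‖h ζ‖ ∂(diskMeasure ν)))
    rw [← integral_mul_const]
    refine integral_mono_ae (hFi n).norm (hh.norm.mul_const _) ?_
    filter_upwards [ae_diskMeasure ν] with ζ hζ
    rw [norm_mul]
    exact mul_le_mul_of_nonneg_left (hb n ζ hζ) (norm_nonneg _)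
  have key := hasSum_integral_of_summable_integral_norm hFi hFs
  have e1 : ∀ ζ, ∑' n, h ζ * ((conj ζ * z) ^ n / (m n : ℂ)) = h ζ * conj (Bker ν z ζ) := by
    intro ζ
    rw [tsum_mul_left, conj_Bker]
  simp_rw [e1] at key
  rw [← Pw_eq hν] at key
  refine key.congr_fun fun n => ?_
  have e2 : ∀ ζ, h ζ * ((conj ζ * z) ^ n / (m n : ℂ)) =
      h ζ * conj ζ ^ n * (z ^ n / (m n : ℂ)) := fun ζ => by rw [mul_pow]; ring
  simp_rw [e2]
  rw [integral_mul_const]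
  ring

/-- Bergman projections of integrable functions are analytic. -/
lemma differentiableOn_Pw {ν : ℂ → ℝ} (hν : RadialWeight ν) (hp : WhatPos ν) {h : ℂ → ℂ}
    (hh : Integrable h (diskMeasure ν)) : DifferentiableOn ℂ (Pw ν h) UD := by
  set m : ℕ → ℝ := fun n => 2 * mom ν (2 * (n : ℝ) + 1) with hm
  have hmpos : ∀ n, 0 < m n := fun n => mul_pos two_pos (mom_pos hν hp n)
  intro z hz
  have hz1 := mem_UD.1 hz
  obtain ⟨ρ, hρ1, hρ2⟩ := exists_between hz1
  have hρ0 : 0 ≤ ρ := (norm_nonneg z).trans hρ1.le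
  have hmem : z ∈ Metric.ball (0:ℂ) ρ := by rwa [mem_ball_zero_iff]
  have hd : DifferentiableOn ℂ (fun w => ∑' n : ℕ, w ^ n *
      ((∫ ζ, h ζ * conj ζ ^ n ∂(diskMeasure ν)) / (m n : ℂ))) (Metric.ball (0:ℂ) ρ) := by
    refine Complex.differentiableOn_tsum_of_summable_norm
      ((summable_Bker hν hp hρ0 hρ2).mul_left (∫ ζ, ‖h ζ‖ ∂(diskMeasure ν)))
      (fun n => by fun_prop) Metric.isOpen_ball fun n w hw => ?_
    rw [mem_ball_zero_iff] at hw
    rw [norm_mul, norm_div, norm_pow, Complex.norm_real, Real.norm_eq_abs, abs_of_pos (hmpos n)]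
    have : ‖∫ ζ, h ζ * conj ζ ^ n ∂(diskMeasure ν)‖ ≤ ∫ ζ, ‖h ζ‖ ∂(diskMeasure ν) := by
      refine norm_integral_le_of_norm_le hh.norm ?_
      filter_upwards [ae_diskMeasure ν] with ζ hζ
      rw [norm_mul, norm_pow, RCLike.norm_conj]
      exact mul_le_of_le_one_right (norm_nonneg _)
        (pow_le_one₀ (norm_nonneg _) (mem_UD.1 hζ).le)
    have hm0 := (hmpos n).le
    calc ‖w‖ ^ n * (‖∫ ζ, h ζ * conj ζ ^ n ∂(diskMeasure ν)‖ / m n) ≤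
          ρ ^ n * ((∫ ζ, ‖h ζ‖ ∂(diskMeasure ν)) / m n) := by gcongr
      _ = _ := by rw [hm]; ring
  have hev : (Pw ν h) =ᶠ[nhds z] fun w => ∑' n : ℕ, w ^ n *
      ((∫ ζ, h ζ * conj ζ ^ n ∂(diskMeasure ν)) / (m n : ℂ)) := by
    filter_upwards [isOpen_UD.mem_nhds hz] with w hw
    exact (hasSum_Pw hν hp hh hw).tsum_eq.symm
  exact ((hd.differentiableAt (Metric.isOpen_ball.mem_nhds hmem)).congr_of_eventuallyEq
    hev).differentiableWithinAt

/-- Bergman projections reproduce integrable analytic functions. -/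
lemma Pw_eq_self {ν : ℂ → ℝ} (hν : RadialWeight ν) (hp : WhatPos ν) {v : ℂ → ℂ}
    (hv : DifferentiableOn ℂ v UD) (hi : Integrable v (diskMeasure ν)) {z : ℂ} (hz : z ∈ UD) :
    Pw ν v z = v z := by
  obtain ⟨a, ha, hc⟩ := exists_coeff_circle hv
  refine (hasSum_Pw hν hp hi hz).unique ((ha z hz).congr_fun fun n => ?_)
  have hvint : Integrable (fun ζ => v ζ * conj ζ ^ n) (diskMeasure ν) := by
    refine hi.mul_bdd (c := 1) (Complex.continuous_conj.pow n).aestronglyMeasurable ?_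
    filter_upwards [ae_diskMeasure ν] with ζ hζ
    rw [norm_pow, RCLike.norm_conj]
    exact pow_le_one₀ (norm_nonneg _) (mem_UD.1 hζ).le
  have hpi : (Real.pi : ℂ) ≠ 0 := by exact_mod_cast Real.pi_ne_zero
  have hm := (mom_pos hν hp n).ne'
  rw [integral_diskMeasure hν hp hvint]
  have e : ∫ s : ℝ, (s : ℂ) * (∫ θ in Ioo (-Real.pi) Real.pi, v (circleMap 0 s θ) *
      conj (circleMap 0 s θ) ^ n) ∂(radialMeasure ν) =
      ∫ s : ℝ, (2 * Real.pi * a n) * ((s ^ (2 * n + 1) : ℝ) : ℂ) ∂(radialMeasure ν) := by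
    refine integral_congr_ae ?_
    filter_upwards [ae_radialMeasure] with s hs
    rw [hc s hs.1 hs.2]
    push_cast; ring
  rw [e, integral_const_mul, integral_complex_ofReal, ← mom_eq hν hp]
  have hmc : ((mom ν (2 * (n : ℝ) + 1) : ℝ) : ℂ) ≠ 0 := by exact_mod_cast hm
  push_cast
  field_simp

/-- The even standard weights `(1 - |z|²) ^ (2 n)`. -/
noncomputable def stdWeight (n : ℕ) (z : ℂ) : ℝ := (1 - ‖z‖ ^ 2) ^ (2 * n)

lemma stdWeight_nonneg (n : ℕ) (z : ℂ) : 0 ≤ stdWeight n z := by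
  rw [stdWeight, pow_mul]; positivity

lemma continuous_stdWeight (n : ℕ) : Continuous (stdWeight n) := by
  unfold stdWeight; fun_prop

lemma stdWeight_ofReal (n : ℕ) (t : ℝ) : stdWeight n (t : ℂ) = (1 - t ^ 2) ^ (2 * n) := by
  rw [stdWeight, Complex.norm_real, Real.norm_eq_abs, sq_abs]

lemma stdWeight_le_one (n : ℕ) {z : ℂ} (hz : z ∈ UD) : stdWeight n z ≤ 1 := by
  have := mem_UD.1 hz
  exact pow_le_one₀ (by nlinarith [norm_nonneg z]) (by nlinarith [norm_nonneg z])

lemma radialWeight_stdWeight (n : ℕ) : RadialWeight (stdWeight n) := by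
  refine ⟨stdWeight_nonneg n, fun z => ?_, ?_⟩
  · simp [stdWeight]
  · refine Measure.integrableOn_of_bounded (M := 1)
      (by rw [← Measure.restrict_apply_univ]; exact measure_ne_top _ _)
      (continuous_stdWeight n).aestronglyMeasurable ?_
    filter_upwards [ae_restrict_mem measurableSet_UD] with z hz
    rw [Real.norm_of_nonneg (stdWeight_nonneg n z)]
    exact stdWeight_le_one n hz

lemma whatPos_stdWeight (n : ℕ) : WhatPos (stdWeight n) := by
  intro r h0 h1
  refine intervalIntegral.intervalIntegral_pos_of_pos_on
    (((continuous_stdWeight n).comp Complex.continuous_ofReal).intervalIntegrable _ _)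
    (fun x hx => ?_) h1
  rw [stdWeight_ofReal]
  have : 0 < x := h0.trans_lt hx.1
  exact pow_pos (by nlinarith [hx.2]) _

lemma integral_pow_mul_one_sub_sq_pow (N : ℕ) : ∀ k : ℕ,
    ∫ t in (0:ℝ)..1, t ^ (2 * k + 1) * (1 - t ^ 2) ^ N =
      (k.factorial * N.factorial : ℝ) / (2 * (k + N + 1).factorial) := by
  induction N with
  | zero =>
    intro k
    simp only [pow_zero, mul_one, integral_pow, Nat.factorial_succ, Nat.factorial_zero]
    have : (k.factorial : ℝ) ≠ 0 := by exact_mod_cast k.factorial_ne_zero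
    push_cast
    simp
    field_simp
    ring
  | succ N ih =>
    intro k
    have hd : ∀ t : ℝ, HasDerivAt (fun t : ℝ => t ^ (2 * k + 2) * (1 - t ^ 2) ^ (N + 1))
        ((2 * k + 2) * (t ^ (2 * k + 1) * (1 - t ^ 2) ^ (N + 1)) -
          (2 * (N + 1)) * (t ^ (2 * (k + 1) + 1) * (1 - t ^ 2) ^ N)) t := by
      intro t
      have h := (hasDerivAt_pow (2 * k + 2) t).mul
        (((hasDerivAt_pow 2 t).const_sub 1).pow (N + 1))
      refine h.congr_deriv ?_
      simp only [Nat.add_sub_cancel, Pi.pow_apply]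
      push_cast
      ring
    have hI := intervalIntegral.integral_eq_sub_of_hasDerivAt (a := 0) (b := 1)
      (fun t _ => hd t) (Continuous.intervalIntegrable (by fun_prop) _ _)
    rw [intervalIntegral.integral_sub (Continuous.intervalIntegrable (by fun_prop) _ _)
      (Continuous.intervalIntegrable (by fun_prop) _ _), intervalIntegral.integral_const_mul,
      intervalIntegral.integral_const_mul, ih (k + 1)] at hI
    simp only [ne_eq, Nat.add_eq_zero_iff, OfNat.ofNat_ne_zero, and_false, not_false_eq_true,
      zero_pow, zero_mul, one_pow, sub_self, mul_zero, one_ne_zero] at hI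
    have h3 : ((k + (N + 1) + 1).factorial : ℝ) ≠ 0 := by exact_mod_cast Nat.factorial_ne_zero _
    rw [show k + 1 + N + 1 = k + (N + 1) + 1 by ring, Nat.factorial_succ k] at hI
    rw [Nat.factorial_succ N]
    push_cast at hI ⊢
    have h4 : (2 * (k : ℝ) + 2) ≠ 0 := by positivity
    refine mul_left_cancel₀ h4 ?_
    rw [sub_eq_zero.1 hI]
    field_simp

lemma mom_stdWeight (n k : ℕ) : mom (stdWeight n) (2 * (k : ℝ) + 1) =
    (k.factorial * (2 * n).factorial : ℝ) / (2 * (k + 2 * n + 1).factorial) := by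
  rw [← integral_pow_mul_one_sub_sq_pow, mom]
  refine intervalIntegral.integral_congr fun t _ => ?_
  simp only [stdWeight_ofReal]
  rw [← Real.rpow_natCast t (2 * k + 1)]
  push_cast; rfl

lemma Bker_stdWeight (n : ℕ) {z ζ : ℂ} (hz : z ∈ UD) (hζ : ζ ∈ UD) :
    Bker (stdWeight n) z ζ = (2 * n + 1) / (1 - ζ * conj z) ^ (2 * n + 2) := by
  have hw : ‖ζ * conj z‖ < 1 := by
    rw [norm_mul, RCLike.norm_conj]
    have := mem_UD.1 hz
    have := mem_UD.1 hζ
    nlinarith [norm_nonneg z, norm_nonneg ζ]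
  have h := tsum_choose_mul_geometric_of_norm_lt_one (2 * n + 1) hw
  rw [Bker, show ∀ x : ℂ, (2 * n + 1 : ℂ) / x = (2 * n + 1) * (1 / x) from fun x => by ring,
    ← h, ← tsum_mul_left]
  refine tsum_congr fun k => ?_
  rw [mom_stdWeight]
  have h1 : ((k + (2 * n + 1)).choose (2 * n + 1) : ℂ) * k.factorial * (2 * n + 1).factorial =
      (k + 2 * n + 1).factorial := by
    exact_mod_cast Nat.add_choose_mul_factorial_mul_factorial k (2 * n + 1)
  have h2 : (k.factorial : ℂ) ≠ 0 := by exact_mod_cast Nat.factorial_ne_zero _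
  have h3 : ((2 * n).factorial : ℂ) ≠ 0 := by exact_mod_cast Nat.factorial_ne_zero _
  have h4 : ((k + 2 * n + 1).factorial : ℂ) ≠ 0 := by exact_mod_cast Nat.factorial_ne_zero _
  rw [Nat.factorial_succ] at h1
  push_cast at h1 ⊢
  rw [show (2 * ((k.factorial : ℂ) * (2 * n).factorial / (2 * (k + 2 * n + 1).factorial))) =
    k.factorial * (2 * n).factorial / (k + 2 * n + 1).factorial by field_simp, ← h1]
  field_simp

lemma norm_Bker_stdWeight (n : ℕ) {z ζ : ℂ} (hz : z ∈ UD) (hζ : ζ ∈ UD) :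
    ‖Bker (stdWeight n) z ζ‖ = (2 * n + 1) / hk z ζ ^ (2 * n + 2) := by
  rw [Bker_stdWeight n hz hζ, norm_div, norm_pow, hk, mul_comm ζ]
  congr 1
  exact_mod_cast Complex.norm_natCast (2 * n + 1)

/-- A weighted Hölder inequality with an unnormalized kernel. -/
lemma lintegral_mul_rpow_le {X : Type*} [MeasurableSpace X] {μ : Measure X} {p : ℝ} (hp : 1 < p)
    {k φ : X → ℝ≥0∞} (hk : AEMeasurable k μ) (hφ : AEMeasurable φ μ) :
    (∫⁻ x, k x * φ x ∂μ) ^ p ≤ (∫⁻ x, k x ∂μ) ^ (p - 1) * ∫⁻ x, k x * φ x ^ p ∂μ := by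
  have hp0 : 0 < p := one_pos.trans hp
  have hc : (p / (p - 1)).HolderConjugate p := by
    have := Real.HolderConjugate.conjExponent hp
    exact this.symm
  have h1 := ENNReal.lintegral_mul_le_Lp_mul_Lq μ hc (f := fun x => k x ^ ((p - 1) / p))
    (g := fun x => k x ^ (1 / p) * φ x) (hk.pow_const _) ((hk.pow_const _).mul hφ)
  have hp1 : 0 < p - 1 := by linarith
  have e1 : ∀ x, ((fun x => k x ^ ((p - 1) / p)) * fun x => k x ^ (1 / p) * φ x) x =
      k x * φ x := by
    intro x
    simp only [Pi.mul_apply]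
    rw [← mul_assoc, ← ENNReal.rpow_add_of_nonneg _ _ (by positivity) (by positivity)]
    rw [show (p - 1) / p + 1 / p = 1 by field_simp; ring, ENNReal.rpow_one]
  have e2 : ∀ x, (k x ^ ((p - 1) / p)) ^ (p / (p - 1)) = k x := by
    intro x
    rw [← ENNReal.rpow_mul, show (p - 1) / p * (p / (p - 1)) = 1 by field_simp, ENNReal.rpow_one]
  have e3 : ∀ x, (k x ^ (1 / p) * φ x) ^ p = k x * φ x ^ p := by
    intro x
    rw [ENNReal.mul_rpow_of_nonneg _ _ hp0.le, ← ENNReal.rpow_mul, one_div_mul_cancel hp0.ne',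
      ENNReal.rpow_one]
  simp only [e1, e2, e3] at h1
  calc (∫⁻ x, k x * φ x ∂μ) ^ p
      ≤ ((∫⁻ x, k x ∂μ) ^ (1 / (p / (p - 1))) * (∫⁻ x, k x * φ x ^ p ∂μ) ^ (1 / p)) ^ p := by
        gcongr
    _ = _ := by
        rw [ENNReal.mul_rpow_of_nonneg _ _ hp0.le, ← ENNReal.rpow_mul, ← ENNReal.rpow_mul,
          one_div_mul_cancel hp0.ne', ENNReal.rpow_one]
        congr 2
        field_simp

/-- The Poisson kernel of the disc of radius `s`, normalized to have unit mass on `(-π, π)`. -/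
noncomputable def pois (s : ℝ) (z : ℂ) (θ : ℝ) : ℝ :=
  (2 * Real.pi)⁻¹ * ((s ^ 2 - ‖z‖ ^ 2) / ‖circleMap 0 s θ - z‖ ^ 2)

lemma pois_nonneg {s : ℝ} {z : ℂ} (hz : ‖z‖ ≤ s) (θ : ℝ) : 0 ≤ pois s z θ := by
  have : 0 ≤ s ^ 2 - ‖z‖ ^ 2 := by nlinarith [norm_nonneg z]
  have := Real.pi_pos
  unfold pois; positivity

lemma pois_le {s : ℝ} {z : ℂ} (hz : ‖z‖ < s) (hs : s ≤ 1) (θ : ℝ) : pois s z θ ≤ 1 / (s - ‖z‖) := by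
  have h0 := norm_nonneg z
  have hpi := Real.pi_gt_three
  have h1 : s - ‖z‖ ≤ ‖circleMap 0 s θ - z‖ := by
    have := norm_sub_norm_le (circleMap 0 s θ) z
    rwa [norm_circleMap_zero' (h0.trans hz.le)] at this
  have hd : 0 < s - ‖z‖ := by linarith
  unfold pois
  calc (2 * Real.pi)⁻¹ * ((s ^ 2 - ‖z‖ ^ 2) / ‖circleMap 0 s θ - z‖ ^ 2)
      ≤ 2⁻¹ * ((s ^ 2 - ‖z‖ ^ 2) / (s - ‖z‖) ^ 2) := by
        have : 0 ≤ s ^ 2 - ‖z‖ ^ 2 := by nlinarith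
        gcongr
        linarith
    _ = 2⁻¹ * (s + ‖z‖) / (s - ‖z‖) := by
        rw [show s ^ 2 - ‖z‖ ^ 2 = (s + ‖z‖) * (s - ‖z‖) by ring]; field_simp
    _ ≤ 1 / (s - ‖z‖) := by gcongr; linarith

lemma pois_comm {r s : ℝ} (hr : 0 ≤ r) (θ φ : ℝ) :
    pois s (circleMap 0 r θ) φ = pois s (circleMap 0 r φ) θ := by
  unfold pois
  rw [norm_circleMap_zero' hr, norm_circleMap_zero' hr]
  congr 3
  have h : circleMap 0 s φ - circleMap 0 r θ =
      Complex.exp ((φ + θ : ℝ) * Complex.I) * conj (circleMap 0 s θ - circleMap 0 r φ) := by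
    simp only [circleMap, zero_add, map_sub, map_mul, Complex.conj_ofReal, ← Complex.exp_conj,
      Complex.conj_I, mul_sub]
    have e : ∀ x y : ℝ, Complex.exp ((x + y : ℝ) * Complex.I) * Complex.exp (x * -Complex.I) =
        Complex.exp (y * Complex.I) := by
      intro x y; rw [← Complex.exp_add]; congr 1; push_cast; ring
    have e1 := e θ φ
    have e2 := e φ θ
    rw [add_comm θ φ] at e1
    rw [mul_left_comm, e1, mul_left_comm, e2]
  rw [h, norm_mul, Complex.norm_exp_ofReal_mul_I, RCLike.norm_conj, one_mul]

lemma circleMap_ne_of_norm_lt {s : ℝ} {z : ℂ} (hz : ‖z‖ < s) (θ : ℝ) : circleMap 0 s θ - z ≠ 0 := by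
  intro h
  have := congrArg norm (sub_eq_zero.1 h)
  rw [norm_circleMap_zero' ((norm_nonneg z).trans hz.le)] at this
  linarith

lemma continuous_pois {s : ℝ} {z : ℂ} (hz : ‖z‖ < s) : Continuous (pois s z) := by
  unfold pois
  have h := continuous_circleMap 0 s
  refine continuous_const.mul (continuous_const.div (by fun_prop) fun θ => ?_)
  exact pow_ne_zero 2 (norm_ne_zero_iff.2 (circleMap_ne_of_norm_lt hz θ))

lemma measurable_pois (s r : ℝ) : Measurable fun x : ℝ × ℝ => pois s (circleMap 0 r x.1) x.2 := by
  unfold pois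
  have h := (continuous_circleMap 0 r).measurable
  have h2 := (continuous_circleMap 0 s).measurable
  fun_prop

/-- The Poisson formula for analytic functions on the unit disc. -/
lemma integral_pois {g : ℂ → ℂ} (hg : DifferentiableOn ℂ g UD) {s : ℝ} {z : ℂ} (hz : ‖z‖ < s)
    (hs : s < 1) :
    ∫ θ in Ioo (-Real.pi) Real.pi, (pois s z θ : ℂ) * g (circleMap 0 s θ) = g z := by
  have hpi := Real.pi_pos
  have hcl : DiffContOnCl ℂ g (Metric.ball 0 s) :=
    (hg.mono (Metric.closedBall_subset_ball hs)).diffContOnCl_ball Subset.rfl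
  have h := hcl.circleAverage_poissonKernel_smul' (w := z) (by simpa using hz)
  rw [Real.circleAverage] at h
  have hper : Function.Periodic (fun θ => ((‖circleMap 0 s θ - 0‖ ^ 2 - ‖z - 0‖ ^ 2) /
      ‖circleMap 0 s θ - 0 - (z - 0)‖ ^ 2) • g (circleMap 0 s θ)) (2 * Real.pi) := fun θ => by
    simp only [periodic_circleMap 0 s θ]
  have e4 := hper.intervalIntegral_add_eq (-Real.pi) 0
  rw [zero_add, show -Real.pi + 2 * Real.pi = Real.pi by ring] at e4
  rw [← e4, intervalIntegral.integral_of_le (by linarith), integral_Ioc_eq_integral_Ioo,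
    ← integral_smul] at h
  rw [← h]
  refine integral_congr_ae ?_
  filter_upwards with θ
  rw [pois, sub_zero, sub_zero, norm_circleMap_zero' ((norm_nonneg z).trans hz.le)]
  simp only [Complex.real_smul]
  push_cast; ring

lemma lintegral_pois {s : ℝ} {z : ℂ} (hz : ‖z‖ < s) (hs : s < 1) :
    ∫⁻ θ in Ioo (-Real.pi) Real.pi, ENNReal.ofReal (pois s z θ) = 1 := by
  have h := integral_pois (g := fun _ => 1) (differentiableOn_const _) hz hs
  simp only [mul_one] at h
  rw [integral_complex_ofReal] at h
  have h' : ∫ θ in Ioo (-Real.pi) Real.pi, pois s z θ = 1 := by exact_mod_cast h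
  rw [← ofReal_integral_eq_lintegral_ofReal, h', ENNReal.ofReal_one]
  · exact ((continuous_pois hz).integrableOn_Icc).mono_set Ioo_subset_Icc_self
  · filter_upwards with θ using pois_nonneg hz.le θ

/-- Integral means of `|g| ^ p` over the circle of radius `s`. -/
noncomputable def circMean (p : ℝ) (g : ℂ → ℂ) (s : ℝ) : ℝ≥0∞ :=
  ∫⁻ θ in Ioo (-Real.pi) Real.pi, ‖g (circleMap 0 s θ)‖ₑ ^ p

lemma continuous_comp_circleMap {g : ℂ → ℂ} (hg : ContinuousOn g UD) {s : ℝ} (h0 : 0 ≤ s)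
    (hs : s < 1) : Continuous fun θ => g (circleMap 0 s θ) :=
  hg.comp_continuous (continuous_circleMap 0 s) fun θ => by
    rw [mem_UD, norm_circleMap_zero' h0]; exact hs

lemma enorm_rpow_le_pois {p : ℝ} (hp : 1 < p) {g : ℂ → ℂ} (hg : DifferentiableOn ℂ g UD) {s : ℝ}
    {z : ℂ} (hz : ‖z‖ < s) (hs : s < 1) :
    ‖g z‖ₑ ^ p ≤ ∫⁻ θ in Ioo (-Real.pi) Real.pi,
      ENNReal.ofReal (pois s z θ) * ‖g (circleMap 0 s θ)‖ₑ ^ p := by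
  have hc := continuous_comp_circleMap hg.continuousOn ((norm_nonneg z).trans hz.le) hs
  have h := lintegral_mul_rpow_le (μ := volume.restrict (Ioo (-Real.pi) Real.pi)) hp
    (k := fun θ => ENNReal.ofReal (pois s z θ)) (φ := fun θ => ‖g (circleMap 0 s θ)‖ₑ)
    (by have := (continuous_pois hz).measurable; fun_prop)
    hc.measurable.enorm.aemeasurable
  rw [lintegral_pois hz hs, ENNReal.one_rpow, one_mul] at h
  refine le_trans ?_ h
  gcongr
  conv_lhs => rw [← integral_pois hg hz hs]
  refine (enorm_integral_le_lintegral_enorm _).trans (le_of_eq (lintegral_congr fun θ => ?_))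
  rw [enorm_mul]
  congr 1
  rw [← ofReal_norm, Complex.norm_real, Real.norm_of_nonneg (pois_nonneg hz.le θ)]

lemma enorm_rpow_le_circMean {p : ℝ} (hp : 1 < p) {g : ℂ → ℂ} (hg : DifferentiableOn ℂ g UD)
    {s : ℝ} {z : ℂ} (hz : ‖z‖ < s) (hs : s < 1) :
    ‖g z‖ₑ ^ p ≤ ENNReal.ofReal (1 / (s - ‖z‖)) * circMean p g s := by
  refine (enorm_rpow_le_pois hp hg hz hs).trans ?_
  rw [circMean, ← lintegral_const_mul' _ _ ENNReal.ofReal_ne_top]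
  gcongr with θ
  exact pois_le hz hs.le θ

lemma circMean_mono {p : ℝ} (hp : 1 < p) {g : ℂ → ℂ} (hg : DifferentiableOn ℂ g UD) {r s : ℝ}
    (hr : 0 ≤ r) (hrs : r ≤ s) (hs : s < 1) : circMean p g r ≤ circMean p g s := by
  rcases hrs.eq_or_lt with rfl | hrs
  · rfl
  have hz : ∀ θ, ‖circleMap 0 r θ‖ < s := fun θ => by rwa [norm_circleMap_zero' hr]
  have hc := (continuous_comp_circleMap hg.continuousOn (hr.trans hrs.le) hs).measurable
  have hm := measurable_pois s r
  calc circMean p g r ≤ ∫⁻ θ in Ioo (-Real.pi) Real.pi, ∫⁻ φ in Ioo (-Real.pi) Real.pi,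
        ENNReal.ofReal (pois s (circleMap 0 r θ) φ) * ‖g (circleMap 0 s φ)‖ₑ ^ p :=
        lintegral_mono fun θ => enorm_rpow_le_pois hp hg (hz θ) hs
    _ = ∫⁻ φ in Ioo (-Real.pi) Real.pi, ∫⁻ θ in Ioo (-Real.pi) Real.pi,
        ENNReal.ofReal (pois s (circleMap 0 r θ) φ) * ‖g (circleMap 0 s φ)‖ₑ ^ p := by
        refine lintegral_lintegral_swap (Measurable.aemeasurable ?_)
        exact hm.ennreal_ofReal.mul ((hc.comp measurable_snd).enorm.pow_const p)
    _ = circMean p g s := by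
        refine lintegral_congr fun φ => ?_
        have hm2 := (continuous_pois (hz φ)).measurable
        simp_rw [pois_comm hr _ φ]
        rw [lintegral_mul_const _ (by fun_prop), lintegral_pois (hz φ) hs, one_mul]

lemma measurable_circMean (p : ℝ) {g : ℂ → ℂ} (hg : Measurable g) : Measurable (circMean p g) := by
  unfold circMean
  exact Measurable.lintegral_prod_right' (f := fun x : ℝ × ℝ => ‖g (circleMap 0 x.1 x.2)‖ₑ ^ p)
    ((hg.comp measurable_circleMap_prod).enorm.pow_const p)

lemma lintegral_enorm_rpow {ω : ℂ → ℝ} (hω : RadialWeight ω) (hp : WhatPos ω) (p : ℝ) {g : ℂ → ℂ}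
    (hg : Measurable g) : ∫⁻ z, ‖g z‖ₑ ^ p ∂(diskMeasure ω) = (ENNReal.ofReal Real.pi)⁻¹ *
      ∫⁻ s, ENNReal.ofReal s * circMean p g s ∂(radialMeasure ω) := by
  rw [lintegral_diskMeasure hω hp (hg.enorm.pow_const p)]
  congr 1
  have hm := (hg.comp measurable_circleMap_prod).enorm.pow_const p
  rw [lintegral_lintegral_swap]
  · refine lintegral_congr fun s => ?_
    rw [lintegral_const_mul' _ _ ENNReal.ofReal_ne_top, circMean]
  · exact (measurable_snd.ennreal_ofReal.mul (hm.comp measurable_swap)).aemeasurable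

lemma lintegral_circMean_le {ω : ℂ → ℝ} (hω : RadialWeight ω) (hp : WhatPos ω) (p : ℝ) {g : ℂ → ℂ}
    (hg : Measurable g) : ∫⁻ s, ENNReal.ofReal s * circMean p g s ∂(radialMeasure ω) =
      ENNReal.ofReal Real.pi * ∫⁻ z, ‖g z‖ₑ ^ p ∂(diskMeasure ω) := by
  rw [lintegral_enorm_rpow hω hp p hg, ← mul_assoc, ENNReal.mul_inv_cancel, one_mul]
  · simp [Real.pi_pos]
  · simp

lemma circMean_mul_tl_le {ω : ℂ → ℝ} (hω : RadialWeight ω) (hp : WhatPos ω) {α B C : ℝ}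
    (hN : RegularTail (tl ω) α B C) {p : ℝ} (h1p : 1 < p) : ∃ K > 0, ∀ g : ℂ → ℂ, Measurable g →
    DifferentiableOn ℂ g UD → ∀ t, 0 < t → t < 1 → circMean p g t * ENNReal.ofReal (tl ω (1 - t)) ≤
      ENNReal.ofReal K * ∫⁻ z, ‖g z‖ₑ ^ p ∂(diskMeasure ω) := by
  have hC := hN.one_le
  have hpi := Real.pi_pos
  refine ⟨C * 2 ^ B * (2 * Real.pi), by positivity, fun g hgm hg t h0 h1 => ?_⟩
  set t' := max t (1 / 2) with ht'
  have ha : t ≤ t' := le_max_left _ _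
  have hb : 1 / 2 ≤ t' := le_max_right _ _
  have hc : t' < 1 := max_lt h1 (by norm_num)
  have hd : 1 - t ≤ 2 * (1 - t') := by
    rcases max_cases t (1 / 2) with h | h <;> rw [← ht'] at h <;> linarith [h.1]
  have hW : tl ω (1 - t) ≤ C * 2 ^ B * tl ω (1 - t') :=
    (tl_mono hp hd).trans (tl_two_mul_le hN (by linarith) (by linarith))
  have hM : circMean p g t' * ENNReal.ofReal (tl ω (1 - t')) ≤
      2 * ∫⁻ s, ENNReal.ofReal s * circMean p g s ∂(radialMeasure ω) := by
    rw [ofReal_tl hp, sub_sub_cancel, ← setLIntegral_const]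
    rw [← lintegral_const_mul' _ _ (by simp)]
    refine (setLIntegral_mono_ae' measurableSet_Ioi ?_).trans (setLIntegral_le_lintegral _ _)
    filter_upwards [ae_radialMeasure] with s hs hs'
    have hs' : t' < s := hs'
    rw [← mul_assoc]
    have : 1 ≤ 2 * ENNReal.ofReal s := by
      rw [show (2 : ℝ≥0∞) = ENNReal.ofReal 2 by simp, ← ENNReal.ofReal_mul zero_le_two]
      exact ENNReal.one_le_ofReal.2 (by linarith)
    calc circMean p g t' ≤ 1 * circMean p g s := by
          rw [one_mul]; exact circMean_mono h1p hg (by linarith) hs'.le hs.2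
      _ ≤ _ := by gcongr
  calc circMean p g t * ENNReal.ofReal (tl ω (1 - t))
      ≤ circMean p g t' * ENNReal.ofReal (C * 2 ^ B * tl ω (1 - t')) := by
        gcongr
        exact circMean_mono h1p hg h0.le ha hc
    _ = ENNReal.ofReal (C * 2 ^ B) * (circMean p g t' * ENNReal.ofReal (tl ω (1 - t'))) := by
        rw [ENNReal.ofReal_mul (by positivity)]; ring
    _ ≤ ENNReal.ofReal (C * 2 ^ B) *
        (2 * ∫⁻ s, ENNReal.ofReal s * circMean p g s ∂(radialMeasure ω)) := by gcongr
    _ = _ := by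
        rw [lintegral_circMean_le hω hp p hgm, ENNReal.ofReal_mul (p := C * 2 ^ B) (by positivity),
          ENNReal.ofReal_mul zero_le_two, ENNReal.ofReal_ofNat]
        ring

/-- Pointwise growth of functions in `A^p_ω`. -/
lemma enorm_rpow_mul_tl_le {ω : ℂ → ℝ} (hω : RadialWeight ω) (hp : WhatPos ω) {α B C : ℝ}
    (hN : RegularTail (tl ω) α B C) {p : ℝ} (h1p : 1 < p) : ∃ K > 0, ∀ g : ℂ → ℂ, Measurable g →
    DifferentiableOn ℂ g UD → ∀ z ∈ UD, ‖g z‖ₑ ^ p *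
      ENNReal.ofReal (tl ω (1 - ‖z‖) * (1 - ‖z‖)) ≤
      ENNReal.ofReal K * ∫⁻ z, ‖g z‖ₑ ^ p ∂(diskMeasure ω) := by
  obtain ⟨K, hK, h⟩ := circMean_mul_tl_le hω hp hN h1p
  have hC := hN.one_le
  refine ⟨2 * (C * 2 ^ B) * K, by positivity, fun g hgm hg z hz => ?_⟩
  have hz1 := mem_UD.1 hz
  have hz0 := norm_nonneg z
  set a := 1 - ‖z‖ with ha
  have ha0 : 0 < a := by linarith
  have e1 := enorm_rpow_le_circMean h1p hg (s := 1 - a / 2) (z := z) (by linarith) (by linarith)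
  have e2 := h g hgm hg (1 - a / 2) (by linarith) (by linarith)
  have e3 : tl ω a ≤ C * 2 ^ B * tl ω (a / 2) := by
    have := tl_two_mul_le hN (half_pos ha0) (by linarith)
    rwa [mul_div_cancel₀ _ two_ne_zero] at this
  rw [show 1 - a / 2 - ‖z‖ = a / 2 by rw [ha]; ring] at e1
  rw [sub_sub_cancel] at e2
  calc ‖g z‖ₑ ^ p * ENNReal.ofReal (tl ω a * a)
      ≤ ENNReal.ofReal (1 / (a / 2)) * circMean p g (1 - a / 2) *
        ENNReal.ofReal (C * 2 ^ B * tl ω (a / 2) * a) := by gcongr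
    _ = ENNReal.ofReal (2 * (C * 2 ^ B)) *
        (circMean p g (1 - a / 2) * ENNReal.ofReal (tl ω (a / 2))) := by
        rw [mul_right_comm, ← ENNReal.ofReal_mul (by positivity),
          show 1 / (a / 2) * (C * 2 ^ B * tl ω (a / 2) * a) = 2 * (C * 2 ^ B) * tl ω (a / 2) by
            field_simp, ENNReal.ofReal_mul (by positivity)]
        ring
    _ ≤ ENNReal.ofReal (2 * (C * 2 ^ B)) *
        (ENNReal.ofReal K * ∫⁻ z, ‖g z‖ₑ ^ p ∂(diskMeasure ω)) := by gcongr
    _ = _ := by rw [← mul_assoc, ← ENNReal.ofReal_mul (by positivity)]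

lemma exists_tl_div_le {ω : ℂ → ℝ} {α B C : ℝ} (hN : RegularTail (tl ω) α B C) :
    ∃ L, 1 ≤ L ∧ ∀ t, 0 < t → t ≤ 1 → tl ω (t / L) ≤ tl ω t / 2 := by
  have hC := hN.one_le
  have hα := hN.alpha_pos
  have hL : 1 ≤ (2 * C) ^ (1 / α) := Real.one_le_rpow (by linarith) (by positivity)
  refine ⟨(2 * C) ^ (1 / α), hL, fun t h0 h1 => ?_⟩
  have h := hN.lower (t / (2 * C) ^ (1 / α)) t (by positivity) (div_le_self h0.le hL) h1
  refine h.trans (le_of_eq ?_)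
  rw [div_div_cancel_left' h0.ne', Real.inv_rpow (by positivity), ← Real.rpow_mul (by positivity),
    one_div_mul_cancel hα.ne', Real.rpow_one]
  field_simp

/-- `A^p_ω` embeds in the weighted space with the regularized weight `ω̂(z) / (1 - |z|)`. -/
lemma lintegral_regularized_le {ω : ℂ → ℝ} (hω : RadialWeight ω) (hp : WhatPos ω) {α B C : ℝ}
    (hN : RegularTail (tl ω) α B C) {p : ℝ} (h1p : 1 < p) : ∃ K > 0, ∀ g : ℂ → ℂ, Measurable g →
    DifferentiableOn ℂ g UD →
      ∫⁻ z in UD, ‖g z‖ₑ ^ p * ENNReal.ofReal (tl ω (1 - ‖z‖) / (1 - ‖z‖)) ∂dA ≤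
      ENNReal.ofReal K * ∫⁻ z, ‖g z‖ₑ ^ p ∂(diskMeasure ω) := by
  obtain ⟨L, hL, hL2⟩ := exists_tl_div_le hN
  have hpi := Real.pi_pos
  have hfin := isFiniteMeasure_radialMeasure hp
  refine ⟨2 * L, by positivity, fun g hgm hg => ?_⟩
  have hmono := (tl_mono hp).measurable
  have hM := measurable_circMean p hgm
  set ψ : ℝ → ℝ≥0∞ := fun s => ENNReal.ofReal s * circMean p g s with hψ
  have hψm : Measurable ψ := by fun_prop
  set T : Set (ℝ × ℝ) := {x | x.1 < x.2 ∧ x.2 ≤ 1 - (1 - x.1) / L} with hT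
  have hTm : MeasurableSet T :=
    (measurableSet_lt measurable_fst measurable_snd).inter
      (measurableSet_le measurable_snd (by fun_prop))
  set k : ℝ × ℝ → ℝ≥0∞ := T.indicator fun x => ENNReal.ofReal (1 / (1 - x.1)) with hk
  have hkm : Measurable k := Measurable.indicator (by fun_prop) hTm
  have e1 : ∀ s ∈ Ioo (0:ℝ) 1, ψ s * ENNReal.ofReal (tl ω (1 - s) / (1 - s)) ≤
      2 * ∫⁻ s', k (s, s') * ψ s' ∂(radialMeasure ω) := by
    intro s hs
    have hs1 : 0 < 1 - s := by linarith [hs.2]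
    have hnn := tl_nonneg ω (1 - s)
    have hmass : ENNReal.ofReal (tl ω (1 - s)) ≤
        2 * radialMeasure ω (Ioc s (1 - (1 - s) / L)) := by
      have h1 : ENNReal.ofReal (tl ω (1 - s)) ≤ radialMeasure ω (Ioc s (1 - (1 - s) / L)) +
          ENNReal.ofReal (tl ω (1 - s) / 2) := by
        rw [ofReal_tl hp, sub_sub_cancel]
        calc radialMeasure ω (Ioi s) ≤ radialMeasure ω (Ioc s (1 - (1 - s) / L)) +
              radialMeasure ω (Ioi (1 - (1 - s) / L)) := by
              refine (measure_mono ?_).trans (measure_union_le _ _)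
              intro x hx
              rcases le_or_gt x (1 - (1 - s) / L) with h | h
              · exact Or.inl ⟨hx, h⟩
              · exact Or.inr h
          _ ≤ _ := by
              gcongr
              rw [← ofReal_tl hp]
              exact ENNReal.ofReal_le_ofReal (hL2 _ hs1 (by linarith [hs.1]))
      have h2 : ENNReal.ofReal (tl ω (1 - s) / 2) ≤
          radialMeasure ω (Ioc s (1 - (1 - s) / L)) := by
        rw [show tl ω (1 - s) = tl ω (1 - s) / 2 + tl ω (1 - s) / 2 by ring,
          ENNReal.ofReal_add (by positivity) (by positivity)] at h1
        rw [show tl ω (1 - s) / 2 + tl ω (1 - s) / 2 = tl ω (1 - s) by ring] at h1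
        exact (ENNReal.add_le_add_iff_right ENNReal.ofReal_ne_top).1 h1
      calc ENNReal.ofReal (tl ω (1 - s)) = 2 * ENNReal.ofReal (tl ω (1 - s) / 2) := by
            rw [← ENNReal.ofReal_ofNat 2, ← ENNReal.ofReal_mul (by norm_num)]; congr 1; ring
        _ ≤ _ := by gcongr
    rw [div_eq_mul_one_div, ENNReal.ofReal_mul hnn]
    calc ψ s * (ENNReal.ofReal (tl ω (1 - s)) * ENNReal.ofReal (1 / (1 - s)))
        ≤ ψ s * (2 * radialMeasure ω (Ioc s (1 - (1 - s) / L)) * ENNReal.ofReal (1 / (1 - s))) := by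
          gcongr
      _ = 2 * (ENNReal.ofReal (1 / (1 - s)) * ψ s * radialMeasure ω (Ioc s (1 - (1 - s) / L))) := by
          ring
      _ ≤ _ := by
          gcongr
          rw [← setLIntegral_const, ← lintegral_indicator measurableSet_Ioc]
          refine lintegral_mono_ae ?_
          filter_upwards [ae_radialMeasure] with s' hs'
          by_cases hmem : s' ∈ Ioc s (1 - (1 - s) / L)
          · have hmT : (s, s') ∈ T := ⟨hmem.1, hmem.2⟩
            rw [indicator_of_mem hmem, hk, indicator_of_mem hmT]
            gcongr
            exact mul_le_mul' (ENNReal.ofReal_le_ofReal hmem.1.le)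
              (circMean_mono h1p hg hs.1.le hmem.1.le hs'.2)
          · rw [indicator_of_notMem hmem]; exact zero_le
  have e2 : ∀ s' ∈ Ioo (0:ℝ) 1, ∫⁻ s in Ioo (0:ℝ) 1, k (s, s') ≤ ENNReal.ofReal L := by
    intro s' hs'
    have h1 : 0 < 1 - s' := by linarith [hs'.2]
    calc ∫⁻ s in Ioo (0:ℝ) 1, k (s, s') ≤ ∫⁻ s, k (s, s') := setLIntegral_le_lintegral _ _
      _ ≤ ∫⁻ s, (Icc (1 - L * (1 - s')) 1).indicator (fun _ => ENNReal.ofReal (1 / (1 - s'))) s := by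
          refine lintegral_mono fun s => ?_
          by_cases hm : (s, s') ∈ T
          · have h2 : s < s' := hm.1
            have h3 : s' ≤ 1 - (1 - s) / L := hm.2
            have h4 : (1 - s) / L ≤ 1 - s' := by linarith
            rw [div_le_iff₀ (by linarith)] at h4
            have h5 : s ∈ Icc (1 - L * (1 - s')) 1 := ⟨by linarith, by linarith⟩
            rw [hk]
            simp only [indicator_of_mem hm, indicator_of_mem h5]
            gcongr
          · simp only [hk, indicator_of_notMem hm]; exact zero_le
      _ = ENNReal.ofReal L := by
          rw [lintegral_indicator measurableSet_Icc, setLIntegral_const, Real.volume_Icc,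
            ← ENNReal.ofReal_mul (by positivity)]
          congr 1
          field_simp
          ring
  have hm := (hgm.comp measurable_circleMap_prod).enorm.pow_const p
  have hGm : Measurable fun z => ‖g z‖ₑ ^ p * ENNReal.ofReal (tl ω (1 - ‖z‖) / (1 - ‖z‖)) :=
    (hgm.enorm.pow_const p).mul (by fun_prop)
  rw [lintegral_disk hGm, lintegral_lintegral_swap]
  · calc (ENNReal.ofReal Real.pi)⁻¹ * ∫⁻ s in Ioo (0:ℝ) 1, ∫⁻ θ in Ioo (-Real.pi) Real.pi,
          ENNReal.ofReal s * (‖g (circleMap 0 s θ)‖ₑ ^ p *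
            ENNReal.ofReal (tl ω (1 - ‖circleMap 0 s θ‖) / (1 - ‖circleMap 0 s θ‖)))
        = (ENNReal.ofReal Real.pi)⁻¹ * ∫⁻ s in Ioo (0:ℝ) 1,
            ψ s * ENNReal.ofReal (tl ω (1 - s) / (1 - s)) := by
          congr 1
          refine setLIntegral_congr_fun measurableSet_Ioo fun s hs => ?_
          simp only [norm_circleMap_zero' hs.1.le, hψ, circMean]
          rw [lintegral_const_mul' _ _ ENNReal.ofReal_ne_top,
            lintegral_mul_const' _ _ ENNReal.ofReal_ne_top, mul_assoc]
      _ ≤ (ENNReal.ofReal Real.pi)⁻¹ * ∫⁻ s in Ioo (0:ℝ) 1,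
            2 * ∫⁻ s', k (s, s') * ψ s' ∂(radialMeasure ω) := by
          refine mul_le_mul_right ?_ _
          exact setLIntegral_mono' measurableSet_Ioo e1
      _ = (ENNReal.ofReal Real.pi)⁻¹ * (2 * ∫⁻ s', (∫⁻ s in Ioo (0:ℝ) 1, k (s, s')) * ψ s'
            ∂(radialMeasure ω)) := by
          rw [lintegral_const_mul' _ _ (by simp), lintegral_lintegral_swap
            (hkm.mul (hψm.comp measurable_snd)).aemeasurable]
          congr 2
          refine lintegral_congr fun s' => ?_
          rw [lintegral_mul_const]
          exact hkm.comp (by fun_prop)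
      _ ≤ (ENNReal.ofReal Real.pi)⁻¹ * (2 * ∫⁻ s', ENNReal.ofReal L * ψ s' ∂(radialMeasure ω)) := by
          refine mul_le_mul_right (mul_le_mul_right ?_ _) _
          refine lintegral_mono_ae ?_
          filter_upwards [ae_radialMeasure] with s' hs'
          gcongr
          exact e2 s' hs'
      _ = _ := by
          rw [lintegral_const_mul' _ _ ENNReal.ofReal_ne_top, lintegral_circMean_le hω hp p hgm,
            ENNReal.ofReal_mul zero_le_two, ENNReal.ofReal_ofNat]
          rw [show ∀ a b c d : ℝ≥0∞, a * (2 * (b * (c * d))) = (a * c) * (2 * b * d) by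
            intros; ring, ENNReal.inv_mul_cancel (by simp [hpi]) (by simp), one_mul]
  · have hcm := measurable_circleMap_prod.comp measurable_swap
    refine Measurable.aemeasurable ?_
    refine measurable_snd.ennreal_ofReal.mul ((hm.comp measurable_swap).mul ?_)
    have : Measurable fun z : ℂ => ENNReal.ofReal (tl ω (1 - ‖z‖) / (1 - ‖z‖)) := by fun_prop
    exact this.comp hcm

/-- The size of `A^p_ω` functions in the scale of `L^q` of the measure `dA / (1 - |z|)`. -/
noncomputable def growthFactor (ω : ℂ → ℝ) (p q t : ℝ) : ℝ :=
  tl ω t ^ (1 / p) * t ^ (1 / p - 1 / q)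

lemma growthFactor_nonneg (ω : ℂ → ℝ) (p q : ℝ) {t : ℝ} (ht : 0 ≤ t) : 0 ≤ growthFactor ω p q t :=
  mul_nonneg (Real.rpow_nonneg (tl_nonneg _ _) _) (Real.rpow_nonneg ht _)

lemma measurable_growthFactor {ω : ℂ → ℝ} (hp : WhatPos ω) (p q : ℝ) :
    Measurable (growthFactor ω p q) := by
  have := (tl_mono hp).measurable
  unfold growthFactor; fun_prop

lemma embedding {ω : ℂ → ℝ} (hω : RadialWeight ω) (hp : WhatPos ω) {α B C : ℝ}
    (hN : RegularTail (tl ω) α B C) {p q : ℝ} (h1p : 1 < p) (hpq : p ≤ q) : ∃ K > 0, ∀ g : ℂ → ℂ,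
    Measurable g → DifferentiableOn ℂ g UD →
      ∫⁻ z in UD, (‖g z‖ₑ * ENNReal.ofReal (growthFactor ω p q (1 - ‖z‖))) ^ q *
        ENNReal.ofReal ((1 - ‖z‖)⁻¹) ∂dA ≤
      ENNReal.ofReal K * (∫⁻ z, ‖g z‖ₑ ^ p ∂(diskMeasure ω)) ^ (q / p) := by
  obtain ⟨K₁, hK₁, h₁⟩ := lintegral_regularized_le hω hp hN h1p
  obtain ⟨K₂, hK₂, h₂⟩ := enorm_rpow_mul_tl_le hω hp hN h1p
  have hp0 : 0 < p := by linarith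
  have hq0 : 0 < q := by linarith
  have hqp : 0 ≤ q / p - 1 := by rw [sub_nonneg, one_le_div hp0]; exact hpq
  refine ⟨K₂ ^ (q / p - 1) * K₁, by positivity, fun g hgm hg => ?_⟩
  set X := ∫⁻ z, ‖g z‖ₑ ^ p ∂(diskMeasure ω) with hX
  have hmono := (tl_mono hp).measurable
  have key : ∀ z ∈ UD, (‖g z‖ₑ * ENNReal.ofReal (growthFactor ω p q (1 - ‖z‖))) ^ q *
      ENNReal.ofReal ((1 - ‖z‖)⁻¹) ≤ (ENNReal.ofReal K₂ * X) ^ (q / p - 1) *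
        (‖g z‖ₑ ^ p * ENNReal.ofReal (tl ω (1 - ‖z‖) / (1 - ‖z‖))) := by
    intro z hz
    have hz1 := mem_UD.1 hz
    have hz0 := norm_nonneg z
    have h := h₂ g hgm hg z hz
    set b := 1 - ‖z‖ with hb
    have hb0 : 0 < b := by linarith
    have hW := hN.pos b hb0 (by linarith)
    set W := tl ω b with hW'
    calc (‖g z‖ₑ * ENNReal.ofReal (growthFactor ω p q b)) ^ q * ENNReal.ofReal (b⁻¹)
        = (‖g z‖ₑ ^ p * ENNReal.ofReal (W * b)) ^ (q / p - 1) *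
          (‖g z‖ₑ ^ p * ENNReal.ofReal (W / b)) := by
          rw [ENNReal.mul_rpow_of_nonneg _ _ hq0.le, ENNReal.mul_rpow_of_nonneg _ _ hqp,
            mul_mul_mul_comm, ← ENNReal.rpow_mul,
            ← ENNReal.rpow_add_of_nonneg _ _ (by positivity) hp0.le,
            show p * (q / p - 1) + p = q by field_simp; ring, mul_assoc,
            ENNReal.ofReal_rpow_of_nonneg (growthFactor_nonneg _ _ _ hb0.le) hq0.le,
            ENNReal.ofReal_rpow_of_nonneg (by positivity) hqp, ← ENNReal.ofReal_mul
            (Real.rpow_nonneg (growthFactor_nonneg _ _ _ hb0.le) _), ← ENNReal.ofReal_mul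
            (by positivity)]
          congr 2
          rw [growthFactor, Real.mul_rpow (by positivity) (by positivity),
            ← Real.rpow_mul hW.le, ← Real.rpow_mul hb0.le, Real.mul_rpow hW.le hb0.le,
            show W ^ (q / p - 1) * b ^ (q / p - 1) * (W / b) =
              (W ^ (q / p - 1) * W) * (b ^ (q / p - 1) * b⁻¹) by ring, ← Real.rpow_add_one hW.ne',
            ← Real.rpow_neg_one b, ← Real.rpow_add hb0, mul_assoc, ← Real.rpow_add hb0]
          congr 2
          all_goals field_simp
          ring
      _ ≤ _ := by gcongr
  calc _ ≤ ∫⁻ z in UD, (ENNReal.ofReal K₂ * X) ^ (q / p - 1) *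
        (‖g z‖ₑ ^ p * ENNReal.ofReal (tl ω (1 - ‖z‖) / (1 - ‖z‖))) ∂dA :=
        setLIntegral_mono' measurableSet_UD key
    _ = (ENNReal.ofReal K₂ * X) ^ (q / p - 1) *
        ∫⁻ z in UD, ‖g z‖ₑ ^ p * ENNReal.ofReal (tl ω (1 - ‖z‖) / (1 - ‖z‖)) ∂dA :=
        lintegral_const_mul _ ((hgm.enorm.pow_const p).mul (by fun_prop))
    _ ≤ (ENNReal.ofReal K₂ * X) ^ (q / p - 1) * (ENNReal.ofReal K₁ * X) := by
        gcongr; exact h₁ g hgm hg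
    _ = _ := by
        rw [ENNReal.mul_rpow_of_nonneg _ _ hqp, mul_mul_mul_comm,
          ENNReal.ofReal_rpow_of_pos hK₂, ← ENNReal.ofReal_mul (by positivity)]
        congr 1
        conv_lhs => rw [← ENNReal.rpow_one X, ← ENNReal.rpow_mul, one_mul]
        rw [← ENNReal.rpow_add_of_nonneg _ _ hqp zero_le_one, sub_add_cancel]

lemma RegularTail.rpow {N : ℝ → ℝ} {α B C : ℝ} (h : RegularTail N α B C) {x : ℝ} (hx : 0 < x) :
    RegularTail (fun t => N t ^ x) (α * x) (B * x) (C ^ x) := by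
  have hC := h.one_le
  refine ⟨mul_pos h.alpha_pos hx, mul_pos h.beta_pos hx, Real.one_le_rpow hC hx.le,
    fun t h0 h1 => Real.rpow_pos_of_pos (h.pos t h0 h1) _, fun s t h0 hst h1 =>
    Real.rpow_le_rpow (h.pos s h0 (hst.trans h1)).le (h.mono s t h0 hst h1) hx.le,
    fun s t h0 hst h1 => ?_, fun s t h0 hst h1 => ?_⟩
  · have ht := h0.trans_le hst
    have hs := h.pos s h0 (hst.trans h1)
    have := Real.rpow_le_rpow (h.pos t ht h1).le (h.upper s t h0 hst h1) hx.le
    rwa [Real.mul_rpow (by positivity) hs.le, Real.mul_rpow (by positivity) (by positivity),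
      ← Real.rpow_mul (by positivity)] at this
  · have ht := h0.trans_le hst
    have hs := h.pos s h0 (hst.trans h1)
    have ht' := h.pos t ht h1
    have := Real.rpow_le_rpow hs.le (h.lower s t h0 hst h1) hx.le
    rwa [Real.mul_rpow (by positivity) ht'.le, Real.mul_rpow (by positivity) (by positivity),
      ← Real.rpow_mul (by positivity)] at this

lemma oscillation_factor_le {w n : ℝ → ℝ} {ε B C σ : ℝ} (hw : RegularTail w (2 * ε) B C)
    (hn : RegularTail n ε B C) (hσ : 0 ≤ σ) {a t H : ℝ} (ha : 0 < a) (hat : a ≤ t) (htH : t ≤ H)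
    (hH : H ≤ 1) :
    w t * t ^ σ / n t ≤ C ^ 2 * (w H * H ^ σ / n a * (a / H) ^ ε) * (t / H) ^ ε := by
  have ht := ha.trans_le hat
  have hH0 := ht.trans_le htH
  have h1 := hw.lower t H ht htH hH
  have h2 := hn.lower a t ha hat (htH.trans hH)
  have hna := hn.pos a ha (by linarith)
  have hnt := hn.pos t ht (by linarith)
  have hwH := hw.pos H hH0 hH
  have hC := hn.one_le
  have h3 : t ^ σ ≤ H ^ σ := Real.rpow_le_rpow ht.le htH hσ
  have h4 : (n t)⁻¹ ≤ C * (a / t) ^ ε * (n a)⁻¹ := by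
    rw [inv_le_iff_one_le_mul₀ hnt]
    have : 1 ≤ (n a)⁻¹ * (C * (a / t) ^ ε * n t) := by
      rw [← inv_mul_cancel₀ hna.ne']; gcongr
    linarith [this, show C * (a / t) ^ ε * (n a)⁻¹ * n t = (n a)⁻¹ * (C * (a / t) ^ ε * n t) by ring]
  rw [div_eq_mul_inv]
  calc w t * t ^ σ * (n t)⁻¹ ≤ (C * (t / H) ^ (2 * ε) * w H) * H ^ σ *
        (C * (a / t) ^ ε * (n a)⁻¹) := by gcongr
    _ = C ^ 2 * (w H * H ^ σ / n a * ((t / H) ^ (2 * ε) * (a / t) ^ ε)) := by ring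
    _ = _ := by
      have : (t / H) ^ (2 * ε) * (a / t) ^ ε = (a / H) ^ ε * (t / H) ^ ε := by
        rw [two_mul, Real.rpow_add (by positivity), mul_assoc,
          ← Real.mul_rpow (by positivity) (by positivity), div_mul_div_cancel₀' ht.ne', mul_comm]
      rw [this]; ring

/-- Control of the oscillation along a radius by a geometric chain of hyperbolic discs. -/
lemma radial_chain {f : ℂ → ℂ} {w n : ℝ → ℝ} {ε B C σ c M : ℝ} (hw : RegularTail w (2 * ε) B C)
    (hn : RegularTail n ε B C) (hσ : 0 ≤ σ) (hε : 0 < ε) (hc : 0 < c) (hM : 0 ≤ M)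
    (hloc : ∀ z ∈ UD, ∀ ζ ∈ UD, ‖z - ζ‖ ≤ c * (1 - ‖z‖) → ‖f z - f ζ‖ ≤
      M * (w (1 - ‖z‖) * (1 - ‖z‖) ^ σ / n (1 - ‖z‖))) {u : ℂ} (hu : ‖u‖ = 1) {a H : ℝ}
    (ha : 0 < a) (haH : a ≤ H) (hH : H ≤ 1) :
    ‖f ((1 - a : ℝ) * u) - f ((1 - H : ℝ) * u)‖ ≤ (1 + ((1 + c) ^ ε - 1)⁻¹) *
      (M * C ^ 2 * (w H * H ^ σ / n a * (a / H) ^ ε)) := by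
  have hna := hn.pos a ha (by linarith)
  have hH0 := ha.trans_le haH
  have hwH := hw.pos H hH0 hH
  have hC := hn.one_le
  set A := M * C ^ 2 * (w H * H ^ σ / n a * (a / H) ^ ε) with hA
  have hA0 : 0 ≤ A := by positivity
  have hx : 1 < (1 + c) ^ ε := Real.one_lt_rpow (by linarith) hε
  set x := (1 + c) ^ ε with hxdef
  set K := 1 + (x - 1)⁻¹ with hK
  have hx1 : 0 < x - 1 := by linarith
  have hKx : K + 1 ≤ K * x := by
    have : (x - 1)⁻¹ * (x - 1) = 1 := inv_mul_cancel₀ hx1.ne'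
    rw [hK]; nlinarith
  have hK1 : 1 ≤ K := by rw [hK]; linarith [inv_pos.2 hx1]
  have hstep : ∀ s t, a ≤ s → s ≤ t → t ≤ H → t ≤ (1 + c) * s →
      ‖f ((1 - s : ℝ) * u) - f ((1 - t : ℝ) * u)‖ ≤ A * (s / H) ^ ε := by
    intro s t has hst htH htc
    have hs0 := ha.trans_le has
    have hnorm : ∀ r : ℝ, r ≤ 1 → ‖((1 - r : ℝ) : ℂ) * u‖ = 1 - r := fun r hr => by
      rw [norm_mul, hu, mul_one, Complex.norm_real, Real.norm_of_nonneg (by linarith)]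
    have h := hloc ((1 - s : ℝ) * u) (mem_UD.2 (by rw [hnorm s (by linarith)]; linarith))
      ((1 - t : ℝ) * u) (mem_UD.2 (by rw [hnorm t (by linarith)]; linarith)) (by
        rw [hnorm s (by linarith), ← sub_mul, norm_mul, hu, mul_one, ← Complex.ofReal_sub,
          Complex.norm_real, Real.norm_of_nonneg (by linarith)]
        linarith)
    rw [hnorm s (by linarith), sub_sub_cancel] at h
    refine h.trans ?_
    have := mul_le_mul_of_nonneg_left
      (oscillation_factor_le hw hn hσ ha has (hst.trans htH) hH) hM
    refine this.trans (le_of_eq ?_)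
    rw [hA]; ring
  have hind : ∀ m : ℕ, ∀ t, a ≤ t → t ≤ H → t ≤ a * (1 + c) ^ m →
      ‖f ((1 - a : ℝ) * u) - f ((1 - t : ℝ) * u)‖ ≤ K * A * (t / H) ^ ε := by
    intro m
    induction m with
    | zero =>
      intro t h1 h2 h3
      rw [pow_zero, mul_one] at h3
      rw [le_antisymm h3 h1, sub_self, norm_zero]
      positivity
    | succ m ih =>
      intro t h1 h2 h3
      rcases le_total (t / (1 + c)) a with h4 | h4
      · rw [div_le_iff₀ (by linarith)] at h4
        refine (hstep a t le_rfl h1 h2 (by linarith)).trans ?_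
        have : (a / H) ^ ε ≤ (t / H) ^ ε := by gcongr
        have h5 : A ≤ K * A := le_mul_of_one_le_left hA0 hK1
        gcongr
      · have ht0 := ha.trans_le h1
        have h5 : t / (1 + c) ≤ t := div_le_self ht0.le (by linarith)
        have e1 := ih (t / (1 + c)) h4 (h5.trans h2) (by
          rw [div_le_iff₀ (by linarith), mul_assoc, ← pow_succ]; exact h3)
        have e2 := hstep (t / (1 + c)) t h4 h5 h2 (by field_simp; rfl)
        have e3 : (t / (1 + c) / H) ^ ε = (t / H) ^ ε / x := by
          rw [div_right_comm, Real.div_rpow (by positivity) (by positivity)]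
        rw [e3] at e1 e2
        calc _ ≤ _ := norm_sub_le_norm_sub_add_norm_sub _ (f ((1 - t / (1 + c) : ℝ) * u)) _
          _ ≤ K * A * ((t / H) ^ ε / x) + A * ((t / H) ^ ε / x) := add_le_add e1 e2
          _ = (K + 1) * (A * (t / H) ^ ε / x) := by ring
          _ ≤ (K * x) * (A * (t / H) ^ ε / x) := by gcongr
          _ = _ := by field_simp
  obtain ⟨m, hm⟩ := pow_unbounded_of_one_lt (H / a) (show 1 < 1 + c by linarith)
  have := hind m H haH le_rfl (by rw [div_lt_iff₀ ha] at hm; linarith)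
  rwa [div_self hH0.ne', Real.one_rpow, mul_one] at this

lemma norm_sub_le_hk {z ζ : ℂ} (hz : z ∈ UD) (hζ : ζ ∈ UD) : ‖z - ζ‖ ≤ hk z ζ := by
  have h1 := mem_UD.1 hz
  have h2 := mem_UD.1 hζ
  refine (sq_le_sq₀ (norm_nonneg _) (hk_nonneg z ζ)).1 ?_
  have key : hk z ζ ^ 2 = ‖z - ζ‖ ^ 2 + (1 - ‖z‖ ^ 2) * (1 - ‖ζ‖ ^ 2) := by
    simp only [hk, ← Complex.normSq_eq_norm_sq, Complex.normSq_apply, Complex.sub_re,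
      Complex.sub_im, Complex.mul_re, Complex.mul_im, Complex.conj_re, Complex.conj_im,
      Complex.one_re, Complex.one_im]
    ring
  have e1 : 0 ≤ 1 - ‖z‖ ^ 2 := by nlinarith [norm_nonneg z]
  have e2 : 0 ≤ 1 - ‖ζ‖ ^ 2 := by nlinarith [norm_nonneg ζ]
  rw [key]
  linarith [mul_nonneg e1 e2]

lemma exists_unit_mul (z : ℂ) : ∃ u : ℂ, ‖u‖ = 1 ∧ z = (‖z‖ : ℂ) * u :=
  ⟨Complex.exp (z.arg * Complex.I), Complex.norm_exp_ofReal_mul_I _, eq_norm_mul_exp z⟩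

lemma oscillation_assemble {w n : ℝ → ℝ} {ε B C σ a b H K₀ M d₁ d₂ d₃ F : ℝ}
    (hn : RegularTail n ε B C) (hw : RegularTail w (2 * ε) B C) (hK₀ : 0 ≤ K₀) (hM : 0 ≤ M)
    (ha0 : 0 < a) (haH : a ≤ H) (hb0 : 0 < b) (hbH : b ≤ H) (hH1 : H ≤ 1) (hε : 0 < ε)
    (e1 : d₁ ≤ K₀ * (w H * H ^ σ / n a * (a / H) ^ ε))
    (e2 : d₂ ≤ K₀ * (w H * H ^ σ / n b * (b / H) ^ ε))
    (e3 : d₃ ≤ M * (w H * H ^ σ / n a * (a / H) ^ ε)) (tri : F ≤ d₁ + d₃ + d₂) :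
    n a * F ≤ (K₀ + M + K₀ * C ^ 2) * C *
      (w b * b ^ σ * (a / H) ^ ε * (H / b) ^ (2 * B + σ)) := by
  have hC := hn.one_le
  have hB := hn.beta_pos
  have hH0 : 0 < H := by linarith
  have hna := hn.pos a ha0 (by linarith)
  have hnb := hn.pos b hb0 (by linarith)
  have hwH := hw.pos H hH0 hH1
  have hwb := hw.pos b hb0 (by linarith)
  have hbs : 0 < b ^ σ := by positivity
  obtain ⟨Y, hY⟩ : ∃ Y, Y = (H / b) ^ B := ⟨_, rfl⟩
  obtain ⟨X, hX⟩ : ∃ X, X = (a / H) ^ ε := ⟨_, rfl⟩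
  obtain ⟨Z, hZ⟩ : ∃ Z, Z = (b / H) ^ ε := ⟨_, rfl⟩
  obtain ⟨S, hS⟩ : ∃ S, S = (H / b) ^ σ := ⟨_, rfl⟩
  obtain ⟨P, hP⟩ : ∃ P, P = w H * H ^ σ := ⟨_, rfl⟩
  have hX0 : 0 < X := by rw [hX]; positivity
  have hY0 : 0 < Y := by rw [hY]; positivity
  have hS0 : 0 < S := by rw [hS]; positivity
  have hP0 : 0 < P := by rw [hP]; positivity
  have hHb : 1 ≤ Y := by rw [hY]; exact Real.one_le_rpow (by rwa [one_le_div hb0]) hB.le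
  have h1 := hn.lower a H ha0 haH hH1
  have h2 := hn.upper b H hb0 hbH hH1
  have h3 : Z ≤ 1 := hZ ▸ Real.rpow_le_one (by positivity) (by rwa [div_le_one hH0]) hε.le
  have h4 := hw.upper b H hb0 hbH hH1
  have h5 : H ^ σ = S * b ^ σ := by
    rw [hS, ← Real.mul_rpow (by positivity) hb0.le, div_mul_cancel₀ _ hb0.ne']
  have h6 : (H / b) ^ (2 * B + σ) = Y * Y * S := by
    rw [hY, hS, two_mul, Real.rpow_add (by positivity), Real.rpow_add (by positivity)]
  rw [h6, ← hX]
  rw [← hX] at h1 e1 e3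
  rw [← hY] at h2 h4
  rw [← hZ] at e2
  rw [← hP] at e1 e2 e3
  rw [h5] at hP
  generalize b ^ σ = T at *
  clear h5 h6 hX hY hZ hS
  have hab : n a / n b * Z ≤ C ^ 2 * (X * Y) := by
    have h7 : n a ≤ C * X * (C * Y * n b) := h1.trans (by gcongr)
    calc n a / n b * Z ≤ n a / n b * 1 := mul_le_mul_of_nonneg_left h3 (by positivity)
      _ ≤ (C * X * (C * Y * n b)) / n b * 1 := by gcongr
      _ = _ := by field_simp
  have hPle : P ≤ C * Y * w b * (S * T) := by rw [hP]; gcongr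
  calc n a * F ≤ n a * (K₀ * (P / n a * X) + M * (P / n a * X) + K₀ * (P / n b * Z)) := by
        gcongr; linarith
    _ = (K₀ + M) * (P * (X * 1)) + K₀ * (P * (n a / n b * Z)) := by
        field_simp
    _ ≤ (K₀ + M) * (P * (X * Y)) + K₀ * (P * (C ^ 2 * (X * Y))) := by gcongr
    _ = (K₀ + M + K₀ * C ^ 2) * P * (X * Y) := by ring
    _ ≤ (K₀ + M + K₀ * C ^ 2) * (C * Y * w b * (S * T)) * (X * Y) := by gcongr
    _ = _ := by ring

set_option maxHeartbeats 1000000 in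
/-- Local oscillation bounds propagate to a global growth estimate. -/
lemma global_oscillation {f : ℂ → ℂ} {w n : ℝ → ℝ} {ε B C σ c M : ℝ} (hw : RegularTail w (2 * ε) B C)
    (hn : RegularTail n ε B C) (hσ : 0 ≤ σ) (hε : 0 < ε) (hc : 0 < c) (hc1 : c ≤ 1) (hM : 0 ≤ M)
    (hloc : ∀ z ∈ UD, ∀ ζ ∈ UD, ‖z - ζ‖ ≤ c * (1 - ‖z‖) → ‖f z - f ζ‖ ≤
      M * (w (1 - ‖z‖) * (1 - ‖z‖) ^ σ / n (1 - ‖z‖))) : ∃ K > 0, ∀ z ∈ UD, ∀ ζ ∈ UD,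
    n (1 - ‖z‖) * ‖f z - f ζ‖ ≤ K * (w (1 - ‖ζ‖) * (1 - ‖ζ‖) ^ σ *
      ((1 - ‖z‖) / hk z ζ) ^ ε * (hk z ζ / (1 - ‖ζ‖)) ^ (2 * B + σ)) := by
  have hC := hn.one_le
  have hB := hn.beta_pos
  set K₀ := (1 + ((1 + c) ^ ε - 1)⁻¹) * (M * C ^ 2) with hK₀
  have hx : 1 < (1 + c) ^ ε := Real.one_lt_rpow (by linarith) hε
  have hK₀0 : 0 ≤ K₀ := by
    have := inv_pos.2 (sub_pos.2 hx)
    positivity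
  set L := 2 / c with hL
  have hL2 : 2 ≤ L := by rw [hL, le_div_iff₀ hc]; linarith
  set K₁ := K₀ + M * C ^ 2 + K₀ * C ^ 2 with hK₁
  have hK₁0 : 0 ≤ K₁ := by positivity
  refine ⟨K₁ * C * 2 ^ ε * L ^ (2 * B + σ) + 1, by positivity, fun z hz ζ hζ => ?_⟩
  have hz1 := mem_UD.1 hz
  have hζ1 := mem_UD.1 hζ
  have hz0 := norm_nonneg z
  have hζ0 := norm_nonneg ζ
  have ha1 := one_sub_norm_le_hk (z := z) hζ
  have hb1 := one_sub_norm_le_hk (z := ζ) hz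
  rw [hk_comm] at hb1
  have hd := norm_sub_le_hk hz hζ
  have hh2 : hk z ζ ≤ 2 := hk_le_two hz hζ
  obtain ⟨u, hu, hzu⟩ := exists_unit_mul z
  obtain ⟨v, hv, hζv⟩ := exists_unit_mul ζ
  set a := 1 - ‖z‖ with ha
  set b := 1 - ‖ζ‖ with hb
  set h := hk z ζ with hh
  have ha0 : 0 < a := by linarith
  have hb0 : 0 < b := by linarith
  have hh0 : 0 < h := by linarith
  set H := min 1 (L * h) with hH
  have hHle : H ≤ 1 := min_le_left _ _
  have hHL : H ≤ L * h := min_le_right _ _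
  have haH : a ≤ H := le_min (by linarith) (by nlinarith)
  have hbH : b ≤ H := le_min (by linarith) (by nlinarith)
  have hhH : h ≤ 2 * H := by
    rcases min_cases 1 (L * h) with h' | h' <;> rw [← hH] at h' <;> nlinarith [h'.1]
  have hH0 : 0 < H := by linarith
  have hna := hn.pos a ha0 (by linarith)
  have hnb := hn.pos b hb0 (by linarith)
  have hnH := hn.pos H hH0 hHle
  have hwH := hw.pos H hH0 hHle
  have hwb := hw.pos b hb0 (by linarith)
  rw [show (‖z‖ : ℂ) = ((1 - a : ℝ) : ℂ) by rw [ha, sub_sub_cancel]] at hzu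
  rw [show (‖ζ‖ : ℂ) = ((1 - b : ℝ) : ℂ) by rw [hb, sub_sub_cancel]] at hζv
  set P := w H * H ^ σ with hP
  have hP0 : 0 ≤ P := by positivity
  have e1 := radial_chain hw hn hσ hε hc hM hloc hu ha0 haH hHle
  have e2 := radial_chain hw hn hσ hε hc hM hloc hv hb0 hbH hHle
  rw [← hzu, ← mul_assoc, ← hK₀, ← hP] at e1
  rw [← hζv, ← mul_assoc, ← hK₀, ← hP] at e2
  have e3 : ‖f ((1 - H : ℝ) * u) - f ((1 - H : ℝ) * v)‖ ≤ M * C ^ 2 * (P / n a * (a / H) ^ ε) := by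
    rcases min_cases 1 (L * h) with h' | h'
    · rw [← hH] at h'
      rw [h'.1]
      simp only [sub_self, Complex.ofReal_zero, zero_mul, norm_zero]
      positivity
    · rw [← hH] at h'
      have hm0 : 0 ≤ 1 - H := by linarith
      have hnorm : ∀ x : ℂ, ‖x‖ = 1 → ‖((1 - H : ℝ) : ℂ) * x‖ = 1 - H := fun x hx => by
        rw [norm_mul, hx, mul_one, Complex.norm_real, Real.norm_of_nonneg hm0]
      have huv : (1 - a) * ‖u - v‖ ≤ 2 * ‖z - ζ‖ := by
        have h1 : ((1 - a : ℝ) : ℂ) * (u - v) = (z - ζ) + ((a - b : ℝ) : ℂ) * v := by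
          rw [hzu, hζv]; push_cast; ring
        have h2 : |a - b| ≤ ‖z - ζ‖ := by
          rw [ha, hb, show 1 - ‖z‖ - (1 - ‖ζ‖) = -(‖z‖ - ‖ζ‖) by ring, abs_neg]
          exact abs_norm_sub_norm_le z ζ
        have h3 := congrArg norm h1
        rw [norm_mul, Complex.norm_real, Real.norm_of_nonneg (by linarith)] at h3
        rw [h3]
        refine (norm_add_le _ _).trans ?_
        rw [norm_mul, hv, mul_one, Complex.norm_real, Real.norm_eq_abs]
        linarith
      have h4 := hloc ((1 - H : ℝ) * u) (mem_UD.2 (by rw [hnorm u hu]; linarith))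
        ((1 - H : ℝ) * v) (mem_UD.2 (by rw [hnorm v hv]; linarith)) (by
          rw [hnorm u hu, ← mul_sub, norm_mul, Complex.norm_real, Real.norm_of_nonneg hm0,
            sub_sub_cancel, h'.1, hL]
          have : (1 - H) * ‖u - v‖ ≤ (1 - a) * ‖u - v‖ := by gcongr
          rw [show c * (2 / c * h) = 2 * h by field_simp, ← hL, ← h'.1]
          linarith)
      rw [hnorm u hu, sub_sub_cancel] at h4
      have h5 := oscillation_factor_le hw hn hσ ha0 haH le_rfl hHle
      rw [div_self hH0.ne', Real.one_rpow, mul_one] at h5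
      refine h4.trans ((mul_le_mul_of_nonneg_left h5 hM).trans (le_of_eq ?_))
      rw [mul_assoc]
  have tri : ‖f z - f ζ‖ ≤ ‖f z - f ((1 - H : ℝ) * u)‖ +
      ‖f ((1 - H : ℝ) * u) - f ((1 - H : ℝ) * v)‖ + ‖f ζ - f ((1 - H : ℝ) * v)‖ := by
    rw [norm_sub_rev (f ζ)]
    have := norm_add₃_le (a := f z - f ((1 - H : ℝ) * u))
      (b := f ((1 - H : ℝ) * u) - f ((1 - H : ℝ) * v)) (c := f ((1 - H : ℝ) * v) - f ζ)
    simpa using this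
  have hmain := oscillation_assemble hn hw hK₀0 (by positivity) ha0 haH hb0 hbH hHle hε e1 e2 e3 tri
  clear hloc tri e1 e2 e3 hzu hζv
  clear_value K₀ K₁ L H a b h
  have hle : (H / b) ^ (2 * B + σ) ≤ L ^ (2 * B + σ) * (h / b) ^ (2 * B + σ) := by
    rw [← Real.mul_rpow (by positivity) (by positivity), ← mul_div_assoc]
    gcongr
  have hle2 : (a / H) ^ ε ≤ 2 ^ ε * (a / h) ^ ε := by
    rw [← Real.mul_rpow (by positivity) (by positivity)]
    gcongr
    rw [← mul_div_assoc, div_le_div_iff₀ hH0 hh0]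
    nlinarith
  have hbs : 0 < b ^ σ := by positivity
  have hq := mul_le_mul (mul_le_mul_of_nonneg_left hle2 (by positivity : 0 ≤ w b * b ^ σ)) hle
    (by positivity) (by positivity)
  refine hmain.trans ((mul_le_mul_of_nonneg_left hq (by positivity)).trans ?_)
  have hr : 0 ≤ w b * b ^ σ * (a / h) ^ ε * (h / b) ^ (2 * B + σ) := by positivity
  rw [← hK₁]
  calc _ = (K₁ * C * 2 ^ ε * L ^ (2 * B + σ)) * (w b * b ^ σ * (a / h) ^ ε *
        (h / b) ^ (2 * B + σ)) := by ring
    _ ≤ _ := mul_le_mul_of_nonneg_right (by linarith) hr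

lemma hyp_lt_of_norm_sub_le {z ζ : ℂ} {c r : ℝ} (hz : z ∈ UD) (hζ : ζ ∈ UD) (hc0 : 0 < c)
    (hc : c ≤ 1 / 2) (hcr : 2 * c < r) (h : ‖z - ζ‖ ≤ c * (1 - ‖z‖)) : hyp z ζ < r := by
  have hz1 := mem_UD.1 hz
  have hh := one_sub_norm_le_hk (z := z) hζ
  have hh0 := hk_pos hz hζ
  have hpd : pd z ζ ≤ c := by
    have : pd z ζ = ‖z - ζ‖ / hk z ζ := by simp [pd, hk]
    rw [this, div_le_iff₀ hh0]
    exact h.trans (by gcongr)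
  have hpd0 : 0 ≤ pd z ζ := by unfold pd; positivity
  have h1 : (1 + pd z ζ) / (1 - pd z ζ) ≤ 1 + 4 * c := by
    rw [div_le_iff₀ (by linarith)]
    nlinarith
  have h2 : 0 < (1 + pd z ζ) / (1 - pd z ζ) := div_pos (by linarith) (by linarith)
  have h3 := Real.log_le_sub_one_of_pos h2
  unfold hyp
  linarith

lemma exists_oscillation_bound {p q r : ℝ} {ν ω : ℂ → ℝ} {f : ℂ → ℂ} {α B C α' B' C' : ℝ}
    (hν : RadialWeight ν) (hνp : WhatPos ν) (hω : RadialWeight ω) (hωp : WhatPos ω)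
    (hN : RegularTail (tl ν) α B C) (hW : RegularTail (tl ω) α' B' C')
    (hp : 1 < p) (hpq : p ≤ q) (hr : 0 < r)
    (hBO : ∃ M, ∀ z ∈ UD, ∀ ζ ∈ UD, hyp z ζ < r → ‖f z - f ζ‖ * gam ω ν p q z ≤ M) :
    ∃ ε D K : ℝ, 0 < ε ∧ 0 < D ∧ 0 < K ∧ ∀ z ∈ UD, ∀ ζ ∈ UD,
      tl ν (1 - ‖z‖) ^ (1 / q) * ‖f z - f ζ‖ ≤ K * (growthFactor ω p q (1 - ‖ζ‖) *
        ((1 - ‖z‖) / hk z ζ) ^ ε * (hk z ζ / (1 - ‖ζ‖)) ^ D) := by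
  obtain ⟨M, hM⟩ := hBO
  have hp0 : 0 < p := by linarith
  have hq0 : 0 < q := by linarith
  have hn' := hN.rpow (x := 1 / q) (by positivity)
  have hw' := hW.rpow (x := 1 / p) (by positivity)
  set β := max (B * (1 / q)) (B' * (1 / p)) with hβ
  set Γ := max (C ^ (1 / q)) (C' ^ (1 / p)) with hΓ
  set ε := min (α * (1 / q)) (α' * (1 / p) / 2) with hε
  have hε0 : 0 < ε := lt_min hn'.alpha_pos (half_pos hw'.alpha_pos)
  have hn := hn'.weaken hε0 (min_le_left _ _) (le_max_left _ _ : _ ≤ β) (le_max_left _ _ : _ ≤ Γ)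
  have hw := hw'.weaken (α' := 2 * ε) (by positivity)
    (by have := min_le_right (α * (1 / q)) (α' * (1 / p) / 2); linarith)
    (le_max_right _ _ : _ ≤ β) (le_max_right _ _ : _ ≤ Γ)
  have hσ : 0 ≤ 1 / p - 1 / q := sub_nonneg.2 (one_div_le_one_div_of_le hp0 hpq)
  set c := min (1 / 2) (r / 4) with hc
  have hc0 : 0 < c := lt_min (by norm_num) (by positivity)
  have hc2 : c ≤ 1 / 2 := min_le_left _ _
  have hcr : c ≤ r / 4 := min_le_right _ _
  obtain ⟨K, hK, h⟩ := global_oscillation (f := f) (σ := 1 / p - 1 / q) (c := c) (M := max M 0)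
    hw hn hσ hε0 hc0 (by linarith) (le_max_right _ _) (fun z hz ζ hζ hd => by
      have h1 := (hM z hz ζ hζ (hyp_lt_of_norm_sub_le hz hζ hc0 hc2 (by linarith) hd)).trans
        (le_max_left M 0)
      have hz1 := mem_UD.1 hz
      have ha : 0 < 1 - ‖z‖ := by linarith
      have hz0 := norm_nonneg z
      have e1 : what ν ‖z‖ = tl ν (1 - ‖z‖) := by
        rw [tl_eq_tail hν hνp ha.le (by linarith), tail, sub_sub_cancel]
      have e2 : what ω ‖z‖ = tl ω (1 - ‖z‖) := by
        rw [tl_eq_tail hω hωp ha.le (by linarith), tail, sub_sub_cancel]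
      have p1 := tl_pos hν hνp ha (by linarith)
      have p2 := tl_pos hω hωp ha (by linarith)
      rw [gam, e1, e2] at h1
      rw [← mul_div_assoc, le_div_iff₀ (by positivity), Real.rpow_sub ha]
      rw [← mul_div_assoc, div_le_iff₀ (by positivity)] at h1
      have p3 : 0 < (1 - ‖z‖) ^ (1 / q) := by positivity
      rw [← mul_div_assoc, ← mul_div_assoc, le_div_iff₀ p3]
      linarith)
  exact ⟨ε, 2 * β + (1 / p - 1 / q), K, hε0, by have := hn.beta_pos; positivity, hK, h⟩

lemma lintegral_schur {X Y : Type*} [MeasurableSpace X] [MeasurableSpace Y] {μ : Measure X}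
    {η : Measure Y} [SFinite μ] [SFinite η] {q : ℝ} (hq : 1 < q) {k : X → Y → ℝ≥0∞}
    (hk : Measurable (Function.uncurry k)) {φ : Y → ℝ≥0∞} (hφ : Measurable φ) {A G : X → ℝ≥0∞}
    {D : Y → ℝ≥0∞} (hA : Measurable A) (hG : Measurable G)
    (h1 : ∀ᵐ x ∂μ, ∫⁻ y, k x y ∂η ≤ A x)
    (h2 : ∀ᵐ y ∂η, ∫⁻ x, k x y * (A x ^ (q - 1) * G x) ∂μ ≤ D y) :
    ∫⁻ x, (∫⁻ y, k x y * φ y ∂η) ^ q * G x ∂μ ≤ ∫⁻ y, φ y ^ q * D y ∂η := by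
  calc ∫⁻ x, (∫⁻ y, k x y * φ y ∂η) ^ q * G x ∂μ
      ≤ ∫⁻ x, (∫⁻ y, k x y * φ y ^ q * (A x ^ (q - 1) * G x) ∂η) ∂μ := by
        refine lintegral_mono_ae ?_
        filter_upwards [h1] with x hx
        rw [lintegral_mul_const _ (by fun_prop)]
        refine (mul_le_mul_left (lintegral_mul_rpow_le hq (by fun_prop) (by fun_prop)) _).trans ?_
        rw [mul_comm (_ ^ (q - 1)), mul_assoc]
        gcongr
    _ = ∫⁻ y, (∫⁻ x, k x y * φ y ^ q * (A x ^ (q - 1) * G x) ∂μ) ∂η := by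
        refine lintegral_lintegral_swap (Measurable.aemeasurable ?_)
        unfold Function.uncurry at hk ⊢
        fun_prop
    _ ≤ _ := by
        refine lintegral_mono_ae ?_
        filter_upwards [h2] with y hy
        refine le_trans (le_of_eq ?_) (mul_le_mul_right hy _)
        rw [← lintegral_const_mul _ (by fun_prop)]
        congr 1
        ext x
        ring

lemma norm_circleMap_sub {s s' θ : ℝ} : ‖circleMap 0 s' θ - circleMap 0 s θ‖ = |s' - s| := by
  have : circleMap 0 s' θ - circleMap 0 s θ = ((s' - s : ℝ) : ℂ) * Complex.exp (θ * Complex.I) := by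
    simp [circleMap]; ring
  rw [this, norm_mul, Complex.norm_exp_ofReal_mul_I, mul_one, Complex.norm_real, Real.norm_eq_abs]

lemma hk_circleMap_le {z : ℂ} (hz : z ∈ UD) {s s' θ : ℝ} (hs : 0 < s) (hss : s ≤ s')
    (hs' : s' < 1) : hk z (circleMap 0 s' θ) ≤ 2 * hk z (circleMap 0 s θ) := by
  have h1 := one_sub_norm_le_hk (z := circleMap 0 s θ) hz
  rw [norm_circleMap_zero' hs.le, hk_comm] at h1
  have h2 : hk z (circleMap 0 s' θ) ≤ hk z (circleMap 0 s θ) + (s' - s) := by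
    unfold hk
    have e : 1 - conj z * circleMap 0 s' θ = (1 - conj z * circleMap 0 s θ) -
      conj z * (circleMap 0 s' θ - circleMap 0 s θ) := by ring
    rw [e]
    refine (norm_sub_le _ _).trans ?_
    rw [norm_mul, RCLike.norm_conj, norm_circleMap_sub, abs_of_nonneg (by linarith)]
    have := mem_UD.1 hz
    gcongr
    nlinarith
  linarith

lemma hk_rpow_neg_le {z : ℂ} (hz : z ∈ UD) {s s' θ x : ℝ} (hx : 0 ≤ x) (hs : 0 < s)
    (hss : s ≤ s') (hs' : s' < 1) :
    hk z (circleMap 0 s θ) ^ (-x) ≤ 2 ^ x * hk z (circleMap 0 s' θ) ^ (-x) := by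
  have h0 : 0 < hk z (circleMap 0 s θ) := hk_pos hz (mem_UD.2 (by
    rw [norm_circleMap_zero' hs.le]; linarith))
  have h0' : 0 < hk z (circleMap 0 s' θ) := hk_pos hz (mem_UD.2 (by
    rw [norm_circleMap_zero' (by linarith)]; linarith))
  rw [Real.rpow_neg h0.le, Real.rpow_neg h0'.le, ← div_eq_mul_inv, le_div_iff₀ (by positivity),
    ← div_eq_inv_mul, div_le_iff₀ (by positivity), ← Real.mul_rpow (by norm_num) h0.le]
  gcongr
  exact hk_circleMap_le hz hs hss hs'

/-- The majorant of the Bergman kernel of `A²_ν`. -/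
noncomputable def bergMaj (ν : ℂ → ℝ) (α : ℝ) (z ζ : ℂ) : ℝ :=
  (1 - ‖z‖ * ‖ζ‖) ^ α / tl ν (1 - ‖z‖ * ‖ζ‖) * hk z ζ ^ (-(1 + α))

lemma bergMaj_comm (ν : ℂ → ℝ) (α : ℝ) (z ζ : ℂ) : bergMaj ν α z ζ = bergMaj ν α ζ z := by
  unfold bergMaj
  rw [hk_comm, mul_comm ‖z‖]

lemma measurable_bergMaj {ν : ℂ → ℝ} (hνp : WhatPos ν) (α : ℝ) :
    Measurable (Function.uncurry (bergMaj ν α)) := by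
  have := (tl_mono hνp).measurable
  unfold Function.uncurry bergMaj
  fun_prop

lemma lintegral_bergMaj_le {ν : ℂ → ℝ} {α B C t : ℝ} (hν : RadialWeight ν) (hνp : WhatPos ν)
    (hN : RegularTail (tl ν) α B C) (ht : 0 < t) (htα : t < α) : ∃ K > (0 : ℝ), ∀ z ∈ UD,
    ∫⁻ ζ, ENNReal.ofReal (bergMaj ν α z ζ * (1 - ‖ζ‖) ^ (-t)) ∂diskMeasure ν ≤
      ENNReal.ofReal (K * (1 - ‖z‖) ^ (-t)) := by
  obtain ⟨K, hK, h⟩ := forelliRudin (x := α - t) (y := α) (by linarith) (by linarith)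
  have hC := hN.one_le
  have hB := hN.beta_pos
  have hα := hN.alpha_pos
  have hmt := (tl_mono hνp).measurable
  refine ⟨2 * (C * 2 ^ B) * (2 ^ α * 2 ^ (1 + α)) * (C * K), by positivity, fun z hz => ?_⟩
  have hz1 := mem_UD.1 hz
  have hz0 := norm_nonneg z
  have hmeas : Measurable fun ζ => ENNReal.ofReal (bergMaj ν α z ζ * (1 - ‖ζ‖) ^ (-t)) := by
    have := (measurable_bergMaj hνp α).of_uncurry_left (x := z)
    fun_prop
  refine (lintegral_diskMeasure_le hν hνp hN hmeas
    (c := ENNReal.ofReal (2 ^ α * 2 ^ (1 + α))) ?_).trans ?_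
  · intro θ s s' hs hss hs' hd
    rw [← ENNReal.ofReal_mul (by positivity)]
    refine ENNReal.ofReal_le_ofReal ?_
    unfold bergMaj
    rw [norm_circleMap_zero' hs.le, norm_circleMap_zero' (by linarith)]
    have e1 : 1 - ‖z‖ * s' ≤ 1 - ‖z‖ * s := by nlinarith
    have e0 : 0 < 1 - ‖z‖ * s' := by nlinarith
    have e2 : 1 - ‖z‖ * s ≤ 2 * (1 - ‖z‖ * s') := by nlinarith
    have e3 : (1 - ‖z‖ * s) ^ α ≤ 2 ^ α * (1 - ‖z‖ * s') ^ α := by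
      have := e0.trans_le e1
      rw [← Real.mul_rpow (by norm_num) e0.le]; gcongr
    have e4 := tl_mono hνp e1
    have e5 := tl_pos hν hνp e0 (by nlinarith)
    have e6 := hk_rpow_neg_le (θ := θ) hz (by positivity : 0 ≤ 1 + α) hs hss hs'
    have e7 : (1 - s) ^ (-t) ≤ (1 - s') ^ (-t) :=
      Real.rpow_le_rpow_of_nonpos (by linarith) (by linarith) (by linarith)
    have h0 := hk_nonneg z (circleMap 0 s θ)
    have h0' := hk_nonneg z (circleMap 0 s' θ)
    have hs1 : 0 ≤ 1 - s := by linarith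
    have hs1' : 0 ≤ 1 - s' := by linarith
    calc _ ≤ (2 ^ α * (1 - ‖z‖ * s') ^ α) / tl ν (1 - ‖z‖ * s') *
          (2 ^ (1 + α) * hk z (circleMap 0 s' θ) ^ (-(1 + α))) * (1 - s') ^ (-t) := by gcongr
      _ = _ := by ring
  · rw [mul_assoc (2 * (C * 2 ^ B)), mul_assoc (2 * (C * 2 ^ B)),
      ENNReal.ofReal_mul (p := 2 * (C * 2 ^ B)) (by positivity),
      mul_assoc (ENNReal.ofReal (2 * (C * 2 ^ B)))]
    refine mul_le_mul_right (α := ℝ≥0∞) ?_ _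
    rw [mul_assoc (2 ^ α * 2 ^ (1 + α)),
      ENNReal.ofReal_mul (p := 2 ^ α * 2 ^ (1 + α)) (by positivity)]
    refine mul_le_mul_right (α := ℝ≥0∞) ?_ _
    rw [mul_assoc, ENNReal.ofReal_mul (by positivity)]
    have := mul_le_mul (le_refl (ENNReal.ofReal C)) (h z hz) zero_le zero_le
    rw [show α - t - α = -t by ring, ← lintegral_const_mul _ (by fun_prop)] at this
    refine le_trans (setLIntegral_mono' measurableSet_UD fun ζ hζ => ?_) this
    rw [← ENNReal.ofReal_mul' (by
      have := mem_UD.1 hζ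
      exact div_nonneg (tl_nonneg _ _) (by linarith)), ← ENNReal.ofReal_mul (by positivity)]
    refine ENNReal.ofReal_le_ofReal ?_
    have hζ1 := mem_UD.1 hζ
    have hζ0 := norm_nonneg ζ
    have hb : 0 < 1 - ‖ζ‖ := by linarith
    have hd : 1 - ‖ζ‖ ≤ 1 - ‖z‖ * ‖ζ‖ := by nlinarith
    have hd0 : 0 < 1 - ‖z‖ * ‖ζ‖ := by linarith
    have hd1 : 1 - ‖z‖ * ‖ζ‖ ≤ 1 := by nlinarith
    have e1 := hN.lower _ _ hb hd hd1
    have e2 := tl_pos hν hνp hd0 hd1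
    rw [Real.div_rpow hb.le hd0.le] at e1
    have e3 : (1 - ‖ζ‖) ^ (α - t - 1) = (1 - ‖ζ‖) ^ α * (1 - ‖ζ‖) ^ (-t) / (1 - ‖ζ‖) := by
      rw [Real.rpow_sub_one hb.ne', ← Real.rpow_add hb]; ring_nf
    rw [e3, bergMaj, show α + 1 = 1 + α by ring]
    have h0 : 0 ≤ hk z ζ ^ (-(1 + α)) := Real.rpow_nonneg (hk_nonneg z ζ) _
    have hbt : 0 < (1 - ‖ζ‖) ^ (-t) := by positivity
    have hda : 0 < (1 - ‖z‖ * ‖ζ‖) ^ α := by positivity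
    calc _ = ((1 - ‖z‖ * ‖ζ‖) ^ α / tl ν (1 - ‖z‖ * ‖ζ‖) * tl ν (1 - ‖ζ‖)) *
          (hk z ζ ^ (-(1 + α)) * (1 - ‖ζ‖) ^ (-t) / (1 - ‖ζ‖)) := by ring
      _ ≤ ((1 - ‖z‖ * ‖ζ‖) ^ α / tl ν (1 - ‖z‖ * ‖ζ‖) *
          (C * ((1 - ‖ζ‖) ^ α / (1 - ‖z‖ * ‖ζ‖) ^ α) * tl ν (1 - ‖z‖ * ‖ζ‖))) *
          (hk z ζ ^ (-(1 + α)) * (1 - ‖ζ‖) ^ (-t) / (1 - ‖ζ‖)) := by gcongr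
      _ = _ := by field_simp

/-- Schur's test for the majorant of the Bergman kernel. -/
lemma lintegral_bergMaj_rpow_le {ν : ℂ → ℝ} {α B C q : ℝ} (hν : RadialWeight ν) (hνp : WhatPos ν)
    (hN : RegularTail (tl ν) α B C) (hq : 1 < q) : ∃ K > (0 : ℝ), ∀ φ : ℂ → ℝ≥0∞, Measurable φ →
    ∫⁻ z, (∫⁻ ζ, ENNReal.ofReal (bergMaj ν α z ζ) * φ ζ ∂diskMeasure ν) ^ q ∂diskMeasure ν ≤
      ENNReal.ofReal K * ∫⁻ z, φ z ^ q ∂diskMeasure ν := by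
  have hα := hN.alpha_pos
  have hq0 : 0 < q := by linarith
  set t := α / (2 * q) with ht
  have ht0 : 0 < t := by positivity
  have htq : t * q = α / 2 := by rw [ht]; field_simp
  have htα : t < α := by nlinarith
  obtain ⟨K₁, hK₁, h1⟩ := lintegral_bergMaj_le hν hνp hN ht0 htα
  obtain ⟨K₂, hK₂, h2⟩ := lintegral_bergMaj_le (t := t * (q - 1)) hν hνp hN
    (mul_pos ht0 (by linarith)) (by nlinarith)
  have hmb := measurable_bergMaj hνp α
  refine ⟨K₁ ^ (q - 1) * K₂, by positivity, fun φ hφ => ?_⟩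
  have key := lintegral_schur (μ := diskMeasure ν) (η := diskMeasure ν) hq
    (k := fun z ζ => ENNReal.ofReal (bergMaj ν α z ζ * (1 - ‖ζ‖) ^ (-t)))
    (φ := fun ζ => φ ζ * ENNReal.ofReal ((1 - ‖ζ‖) ^ t))
    (A := fun z => ENNReal.ofReal (K₁ * (1 - ‖z‖) ^ (-t))) (G := fun _ => 1)
    (D := fun ζ => ENNReal.ofReal (K₁ ^ (q - 1) * K₂ * (1 - ‖ζ‖) ^ (-(t * q))))
    (by unfold Function.uncurry at hmb ⊢; fun_prop) (by fun_prop) (by fun_prop) (by fun_prop)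
    (by filter_upwards [ae_diskMeasure ν] with z hz using h1 z hz) (by
      filter_upwards [ae_diskMeasure ν] with ζ hζ
      have hζ1 := mem_UD.1 hζ
      have hb : 0 < 1 - ‖ζ‖ := by linarith
      have h3 := mul_le_mul_right (α := ℝ≥0∞) (h2 ζ hζ)
        (ENNReal.ofReal (K₁ ^ (q - 1) * (1 - ‖ζ‖) ^ (-t)))
      rw [← lintegral_const_mul _ (by
        have := hmb.of_uncurry_left (x := ζ); fun_prop)] at h3
      refine le_trans (lintegral_mono_ae ?_) (h3.trans (le_of_eq ?_))
      · filter_upwards [ae_diskMeasure ν] with z hz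
        have hz1 := mem_UD.1 hz
        have ha : 0 < 1 - ‖z‖ := by linarith
        rw [mul_one, ENNReal.ofReal_rpow_of_nonneg (by positivity) (by linarith),
          ← ENNReal.ofReal_mul' (by positivity), ← ENNReal.ofReal_mul (by positivity)]
        refine ENNReal.ofReal_le_ofReal (le_of_eq ?_)
        rw [Real.mul_rpow hK₁.le (by positivity), ← Real.rpow_mul ha.le, bergMaj_comm ν α z ζ,
          neg_mul]
        ring
      · rw [← ENNReal.ofReal_mul (by positivity)]
        congr 1
        rw [show -(t * q) = -t + -(t * (q - 1)) by ring, Real.rpow_add hb]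
        ring)
  refine le_trans (le_of_eq ?_) (key.trans (le_of_eq ?_))
  · refine lintegral_congr fun z => ?_
    rw [mul_one]
    congr 1
    refine lintegral_congr_ae ?_
    filter_upwards [ae_diskMeasure ν] with ζ hζ
    have hζ1 := mem_UD.1 hζ
    have hb : 0 < 1 - ‖ζ‖ := by linarith
    rw [mul_left_comm, mul_comm (ENNReal.ofReal _) (φ ζ), ← ENNReal.ofReal_mul' (by positivity),
      mul_assoc, ← Real.rpow_add hb, neg_add_cancel, Real.rpow_zero, mul_one]
  · rw [← lintegral_const_mul _ (by fun_prop)]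
    refine lintegral_congr_ae ?_
    filter_upwards [ae_diskMeasure ν] with ζ hζ
    have hζ1 := mem_UD.1 hζ
    have hb : 0 < 1 - ‖ζ‖ := by linarith
    rw [ENNReal.mul_rpow_of_nonneg _ _ hq0.le,
      ENNReal.ofReal_rpow_of_nonneg (by positivity) hq0.le, mul_assoc,
      ← ENNReal.ofReal_mul (by positivity), ← Real.rpow_mul hb.le, mul_left_comm,
      ← Real.rpow_add hb, add_neg_cancel, Real.rpow_zero, mul_one, mul_comm]

lemma lintegral_forelliRudin_weighted {ν : ℂ → ℝ} {α B C ε m : ℝ} (hν : RadialWeight ν)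
    (hνp : WhatPos ν) (hN : RegularTail (tl ν) α B C) (hε : 0 < ε) (hm : 0 ≤ m) :
    ∃ K > (0 : ℝ), ∀ ζ ∈ UD,
    ∫⁻ z, ENNReal.ofReal ((1 - ‖z‖) ^ ε / tl ν (1 - ‖z‖) * hk ζ z ^ (-(2 + m + ε)))
      ∂diskMeasure ν ≤ ENNReal.ofReal (K * (1 - ‖ζ‖) ^ (-(m + 1))) := by
  obtain ⟨K, hK, h⟩ := forelliRudin (x := ε) (y := 1 + m + ε) hε (by linarith)
  have hC := hN.one_le
  have hmt := (tl_mono hνp).measurable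
  refine ⟨2 * (C * 2 ^ B) * (2 ^ ε * 2 ^ (2 + m + ε)) * K, by positivity, fun ζ hζ => ?_⟩
  have hζ1 := mem_UD.1 hζ
  have hmeas : Measurable fun z =>
      ENNReal.ofReal ((1 - ‖z‖) ^ ε / tl ν (1 - ‖z‖) * hk ζ z ^ (-(2 + m + ε))) := by fun_prop
  refine (lintegral_diskMeasure_le hν hνp hN hmeas
    (c := ENNReal.ofReal (2 ^ ε * 2 ^ (2 + m + ε))) ?_).trans ?_
  · intro θ s s' hs hss hs' hd
    rw [← ENNReal.ofReal_mul (by positivity)]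
    refine ENNReal.ofReal_le_ofReal ?_
    rw [norm_circleMap_zero' hs.le, norm_circleMap_zero' (by linarith)]
    have e0 : 0 < 1 - s' := by linarith
    have e1 : 0 < 1 - s := by linarith
    have e3 : (1 - s) ^ ε ≤ 2 ^ ε * (1 - s') ^ ε := by
      rw [← Real.mul_rpow (by norm_num) e0.le]; gcongr
    have e4 := tl_mono hνp (by linarith : 1 - s' ≤ 1 - s)
    have e5 := tl_pos hν hνp e0 (by linarith)
    have e6 := hk_rpow_neg_le (θ := θ) hζ (by positivity : 0 ≤ 2 + m + ε) hs hss hs'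
    have h0 := hk_nonneg ζ (circleMap 0 s θ)
    calc _ ≤ (2 ^ ε * (1 - s') ^ ε) / tl ν (1 - s') *
          (2 ^ (2 + m + ε) * hk ζ (circleMap 0 s' θ) ^ (-(2 + m + ε))) := by gcongr
      _ = _ := by ring
  · rw [mul_assoc (2 * (C * 2 ^ B)), mul_assoc (2 * (C * 2 ^ B)),
      ENNReal.ofReal_mul (p := 2 * (C * 2 ^ B)) (by positivity),
      mul_assoc (ENNReal.ofReal (2 * (C * 2 ^ B)))]
    refine mul_le_mul_right ?_ _
    rw [mul_assoc (2 ^ ε * 2 ^ (2 + m + ε)),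
      ENNReal.ofReal_mul (p := 2 ^ ε * 2 ^ (2 + m + ε)) (by positivity)]
    refine mul_le_mul_right (α := ℝ≥0∞) ?_ _
    have := h ζ hζ
    rw [show ε - (1 + m + ε) = -(m + 1) by ring] at this
    refine le_trans (setLIntegral_mono' measurableSet_UD fun z hz => ?_) this
    have hz1 := mem_UD.1 hz
    have hz0 := norm_nonneg z
    have ha : 0 < 1 - ‖z‖ := by linarith
    have hp := tl_pos hν hνp ha (by linarith)
    rw [← ENNReal.ofReal_mul' (by positivity)]
    refine ENNReal.ofReal_le_ofReal (le_of_eq ?_)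
    rw [Real.rpow_sub_one ha.ne', show 1 + m + ε + 1 = 2 + m + ε by ring]
    field_simp

lemma lintegral_weighted_schur {ν : ℂ → ℝ} {α B C ε m q : ℝ} (hν : RadialWeight ν)
    (hνp : WhatPos ν) (hN : RegularTail (tl ν) α B C) (hε : 0 < ε) (hm : 0 ≤ m) (hq : 1 < q) :
    ∃ K > (0 : ℝ), ∀ Φ : ℂ → ℝ≥0∞, Measurable Φ →
    ∫⁻ z, (∫⁻ ζ in UD, ENNReal.ofReal ((1 - ‖ζ‖) ^ m * hk z ζ ^ (-(2 + m + ε))) * Φ ζ ∂dA) ^ q *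
      ENNReal.ofReal ((1 - ‖z‖) ^ (ε * q) / tl ν (1 - ‖z‖)) ∂diskMeasure ν ≤
    ENNReal.ofReal K * ∫⁻ ζ in UD, Φ ζ ^ q * ENNReal.ofReal ((1 - ‖ζ‖)⁻¹) ∂dA := by
  obtain ⟨K₁, hK₁, h1⟩ := forelliRudin (x := m + 1) (y := 1 + m + ε) (by linarith) (by linarith)
  obtain ⟨K₂, hK₂, h2⟩ := lintegral_forelliRudin_weighted hν hνp hN hε hm
  have hmt := (tl_mono hνp).measurable
  refine ⟨K₁ ^ (q - 1) * K₂, by positivity, fun Φ hΦ => ?_⟩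
  have key := lintegral_schur (μ := diskMeasure ν) (η := dA.restrict UD) hq
    (k := fun z ζ => ENNReal.ofReal ((1 - ‖ζ‖) ^ m * hk z ζ ^ (-(2 + m + ε))))
    (φ := Φ) (A := fun z => ENNReal.ofReal (K₁ * (1 - ‖z‖) ^ (-ε)))
    (G := fun z => ENNReal.ofReal ((1 - ‖z‖) ^ (ε * q) / tl ν (1 - ‖z‖)))
    (D := fun ζ => ENNReal.ofReal (K₁ ^ (q - 1) * K₂ * (1 - ‖ζ‖)⁻¹))
    (by unfold Function.uncurry; fun_prop) hΦ (by fun_prop) (by fun_prop)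
    (by
      filter_upwards [ae_diskMeasure ν] with z hz
      have := h1 z hz
      rwa [show m + 1 - (1 + m + ε) = -ε by ring, add_sub_cancel_right,
        show 1 + m + ε + 1 = 2 + m + ε by ring] at this) (by
      filter_upwards [ae_restrict_mem measurableSet_UD] with ζ hζ
      have hζ1 := mem_UD.1 hζ
      have hb : 0 < 1 - ‖ζ‖ := by linarith
      have h3 := mul_le_mul_right (α := ℝ≥0∞) (h2 ζ hζ)
        (ENNReal.ofReal (K₁ ^ (q - 1) * (1 - ‖ζ‖) ^ m))
      rw [← lintegral_const_mul _ (by fun_prop)] at h3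
      refine le_trans (lintegral_mono_ae ?_) (h3.trans (le_of_eq ?_))
      · filter_upwards [ae_diskMeasure ν] with z hz
        have hz1 := mem_UD.1 hz
        have ha : 0 < 1 - ‖z‖ := by linarith
        rw [ENNReal.ofReal_rpow_of_nonneg (by positivity) (by linarith),
          ← ENNReal.ofReal_mul (by positivity), ← ENNReal.ofReal_mul'
            (mul_nonneg (by positivity) (div_nonneg (by positivity) (tl_nonneg _ _))),
          ← ENNReal.ofReal_mul (by positivity)]
        refine ENNReal.ofReal_le_ofReal (le_of_eq ?_)
        rw [Real.mul_rpow hK₁.le (by positivity), ← Real.rpow_mul ha.le, hk_comm z ζ,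
          show (1 - ‖z‖) ^ ε = (1 - ‖z‖) ^ (-ε * (q - 1)) * (1 - ‖z‖) ^ (ε * q) by
            rw [← Real.rpow_add ha]; ring_nf]
        ring
      · rw [← ENNReal.ofReal_mul (by positivity)]
        congr 1
        have : (1 - ‖ζ‖)⁻¹ = (1 - ‖ζ‖) ^ m * (1 - ‖ζ‖) ^ (-(m + 1)) := by
          rw [← Real.rpow_add hb, show m + -(m + 1) = -1 by ring, Real.rpow_neg_one]
        rw [this]
        ring)
  refine key.trans (le_of_eq ?_)
  rw [← lintegral_const_mul _ (by fun_prop)]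
  refine lintegral_congr fun ζ => ?_
  rw [ENNReal.ofReal_mul (by positivity), mul_left_comm]

lemma commutator_kernel_le {f : ℂ → ℂ} {ν : ℂ → ℝ} {φ : ℝ → ℝ} {q ε D K : ℝ} {n : ℕ}
    (hν : RadialWeight ν) (hνp : WhatPos ν) (hφ : ∀ t, 0 < t → 0 ≤ φ t)
    {z ζ : ℂ} (hz : z ∈ UD) (hζ : ζ ∈ UD)
    (hf : tl ν (1 - ‖z‖) ^ (1 / q) * ‖f z - f ζ‖ ≤ K * (φ (1 - ‖ζ‖) *
        ((1 - ‖z‖) / hk z ζ) ^ ε * (hk z ζ / (1 - ‖ζ‖)) ^ D)) :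
    stdWeight n ζ * (‖f z - f ζ‖ * ‖Bker (stdWeight n) z ζ‖) ≤
      (K * (2 * n + 1) * 2 ^ (2 * n) * ((1 - ‖z‖) ^ ε / tl ν (1 - ‖z‖) ^ (1 / q))) *
      ((1 - ‖ζ‖) ^ (2 * n - D) * hk z ζ ^ (-(2 + (2 * n - D) + ε)) * φ (1 - ‖ζ‖)) := by
  have hz1 := mem_UD.1 hz
  have hz0 := norm_nonneg z
  have hζ1 := mem_UD.1 hζ
  have hζ0 := norm_nonneg ζ
  have ha : 0 < 1 - ‖z‖ := by linarith
  have hb : 0 < 1 - ‖ζ‖ := by linarith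
  have hh := hk_pos hz hζ
  have hNq : 0 < tl ν (1 - ‖z‖) ^ (1 / q) := by
    have := tl_pos hν hνp ha (by linarith); positivity
  have hφ0 := hφ _ hb
  have h1 : stdWeight n ζ ≤ 2 ^ (2 * n) * (1 - ‖ζ‖) ^ (2 * n) := by
    rw [← mul_pow, stdWeight]
    have : 0 ≤ 1 - ‖ζ‖ ^ 2 := by nlinarith
    gcongr
    nlinarith
  rw [mul_comm, ← le_div_iff₀ hNq] at hf
  rw [norm_Bker_stdWeight n hz hζ]
  calc _ ≤ (2 ^ (2 * n) * (1 - ‖ζ‖) ^ (2 * n)) * ((K * (φ (1 - ‖ζ‖) *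
        ((1 - ‖z‖) / hk z ζ) ^ ε * (hk z ζ / (1 - ‖ζ‖)) ^ D) / tl ν (1 - ‖z‖) ^ (1 / q)) *
        ((2 * n + 1) / hk z ζ ^ (2 * n + 2))) := by
        gcongr
    _ = _ := by
        have e1 : hk z ζ ^ (-(2 + (2 * n - D) + ε)) =
            hk z ζ ^ D / hk z ζ ^ ε / hk z ζ ^ (2 * n + 2) := by
          rw [← Real.rpow_natCast, ← Real.rpow_sub hh, ← Real.rpow_sub hh]
          congr 1; push_cast; ring
        have e2 : (1 - ‖ζ‖) ^ (2 * n - D : ℝ) = (1 - ‖ζ‖) ^ (2 * n) / (1 - ‖ζ‖) ^ D := by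
          rw [← Real.rpow_natCast, ← Real.rpow_sub hb]
          congr 1; push_cast; ring
        rw [e1, e2, Real.div_rpow ha.le hh.le, Real.div_rpow hh.le hb.le]
        ring

lemma lintegral_commutator_le {p q : ℝ} {ν ω : ℂ → ℝ} {f : ℂ → ℂ}
    {α B C α' B' C' ε D K : ℝ} {n : ℕ}
    (hν : RadialWeight ν) (hνp : WhatPos ν) (hω : RadialWeight ω) (hωp : WhatPos ω)
    (hN : RegularTail (tl ν) α B C) (hW : RegularTail (tl ω) α' B' C')
    (hp : 1 < p) (hpq : p ≤ q) (hε : 0 < ε) (hK : 0 < K) (hn : D ≤ 2 * n)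
    (hf : ∀ z ∈ UD, ∀ ζ ∈ UD,
      tl ν (1 - ‖z‖) ^ (1 / q) * ‖f z - f ζ‖ ≤ K * (growthFactor ω p q (1 - ‖ζ‖) *
        ((1 - ‖z‖) / hk z ζ) ^ ε * (hk z ζ / (1 - ‖ζ‖)) ^ D)) :
    ∃ K' > (0 : ℝ), ∀ g : ℂ → ℂ, Measurable g → DifferentiableOn ℂ g UD →
      ∫⁻ z, (∫⁻ ζ, ‖f z - f ζ‖ₑ * ‖g ζ‖ₑ * ‖Bker (stdWeight n) z ζ‖ₑ
        ∂diskMeasure (stdWeight n)) ^ q ∂diskMeasure ν ≤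
      ENNReal.ofReal K' * (∫⁻ z, ‖g z‖ₑ ^ p ∂diskMeasure ω) ^ (q / p) := by
  have hq : 1 < q := by linarith
  have hq0 : 0 < q := by linarith
  obtain ⟨K₁, hK₁, h1⟩ := embedding hω hωp hW hp hpq
  obtain ⟨K₂, hK₂, h2⟩ := lintegral_weighted_schur (m := 2 * n - D) hν hνp hN hε
    (by linarith) hq
  set K₀ := K * (2 * n + 1) * 2 ^ (2 * n) with hK₀
  have hK₀0 : 0 < K₀ := by positivity
  refine ⟨K₀ ^ q * (K₂ * K₁), by positivity, fun g hg hgd => ?_⟩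
  have hgm := measurable_growthFactor hωp p q
  have h3 := h2 (fun ζ => ‖g ζ‖ₑ * ENNReal.ofReal (growthFactor ω p q (1 - ‖ζ‖)))
    (by fun_prop)
  have hmt := (tl_mono hνp).measurable
  rw [ENNReal.ofReal_mul (by positivity), ENNReal.ofReal_mul hK₂.le, mul_assoc, mul_assoc]
  refine le_trans ?_ (mul_le_mul_right (h3.trans (mul_le_mul_right (h1 g hg hgd) _)) _)
  rw [← lintegral_const_mul' _ _ ENNReal.ofReal_ne_top]
  refine lintegral_mono_ae ?_
  filter_upwards [ae_diskMeasure ν] with z hz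
  have hz1 := mem_UD.1 hz
  have hz0 := norm_nonneg z
  have ha : 0 < 1 - ‖z‖ := by linarith
  have hNp := tl_pos hν hνp ha (by linarith)
  set c := K₀ * ((1 - ‖z‖) ^ ε / tl ν (1 - ‖z‖) ^ (1 / q)) with hc
  have hc0 : 0 ≤ c := by positivity
  have hcq : ENNReal.ofReal c ^ q = ENNReal.ofReal (K₀ ^ q) *
      ENNReal.ofReal ((1 - ‖z‖) ^ (ε * q) / tl ν (1 - ‖z‖)) := by
    rw [ENNReal.ofReal_rpow_of_nonneg hc0 hq0.le, ← ENNReal.ofReal_mul (by positivity), hc,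
      Real.mul_rpow hK₀0.le (by positivity), Real.div_rpow (by positivity) (by positivity),
      ← Real.rpow_mul ha.le, ← Real.rpow_mul hNp.le, one_div_mul_cancel hq0.ne', Real.rpow_one]
  rw [mul_left_comm, ← hcq, ← ENNReal.mul_rpow_of_nonneg _ _ hq0.le]
  refine ENNReal.rpow_le_rpow ?_ hq0.le
  rw [mul_comm, ← lintegral_const_mul _ (by fun_prop)]
  have hsm : Measurable fun ζ => ENNReal.ofReal (stdWeight n ζ) :=
    (continuous_stdWeight n).measurable.ennreal_ofReal
  refine (lintegral_withDensity_le_lintegral_mul _ hsm _).trans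
    (setLIntegral_mono' measurableSet_UD fun ζ hζ => ?_)
  have hζ1 := mem_UD.1 hζ
  have hb : 0 < 1 - ‖ζ‖ := by linarith
  have hh := hk_pos hz hζ
  have key := ENNReal.ofReal_le_ofReal (commutator_kernel_le (n := n) hν hνp
    (fun t ht => growthFactor_nonneg ω p q ht.le) hz hζ (hf z hz ζ hζ))
  have h5 := growthFactor_nonneg ω p q hb.le
  rw [ENNReal.ofReal_mul (stdWeight_nonneg n ζ), ENNReal.ofReal_mul (norm_nonneg _),
    ofReal_norm, ofReal_norm, ← hK₀, ← hc, ENNReal.ofReal_mul (p := c) hc0,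
    ENNReal.ofReal_mul (p := _ ^ _ * _ ^ _) (by positivity)] at key
  simp only [Pi.mul_apply]
  calc _ = ENNReal.ofReal (stdWeight n ζ) * (‖f z - f ζ‖ₑ * ‖Bker (stdWeight n) z ζ‖ₑ) *
        ‖g ζ‖ₑ := by ring
    _ ≤ _ := mul_le_mul_left key _
    _ = _ := by ring

lemma measurable_indicator_of_continuousOn {h : ℂ → ℂ} (hh : ContinuousOn h UD) :
    Measurable (UD.indicator h) := by
  classical
  rw [← Set.piecewise_eq_indicator]
  exact hh.measurable_piecewise continuousOn_const measurableSet_UD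

lemma integrable_of_lintegral_rpow_lt_top {X : Type*} [MeasurableSpace X] {μ : Measure X}
    [IsFiniteMeasure μ] {q : ℝ} (hq : 1 ≤ q) {h : X → ℂ} (hm : AEStronglyMeasurable h μ)
    (hi : ∫⁻ x, ‖h x‖ₑ ^ q ∂μ < ∞) : Integrable h μ := by
  refine ⟨hm, ?_⟩
  have : ∫⁻ x, ‖h x‖ₑ ∂μ ≤ ∫⁻ x, (1 + ‖h x‖ₑ ^ q) ∂μ := by
    refine lintegral_mono fun x => ?_
    rcases le_total ‖h x‖ₑ 1 with h1 | h1
    · exact h1.trans le_self_add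
    · refine le_trans ?_ le_add_self
      simpa using ENNReal.rpow_le_rpow_of_exponent_le h1 hq
  refine this.trans_lt ?_
  rw [lintegral_add_left measurable_const]
  simp only [lintegral_const, one_mul]
  exact ENNReal.add_lt_top.2 ⟨measure_lt_top _ _, hi⟩

lemma Pw_sub {ν : ℂ → ℝ} (hν : RadialWeight ν) (hp : WhatPos ν) {h₁ h₂ : ℂ → ℂ}
    (hh₁ : Integrable h₁ (diskMeasure ν)) (hh₂ : Integrable h₂ (diskMeasure ν)) {z : ℂ}
    (hz : z ∈ UD) : Pw ν (fun ζ => h₁ ζ - h₂ ζ) z = Pw ν h₁ z - Pw ν h₂ z := by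
  refine (hasSum_Pw hν hp (hh₁.sub hh₂) hz).unique
    (((hasSum_Pw hν hp hh₁ hz).sub (hasSum_Pw hν hp hh₂ hz)).congr_fun fun n => ?_)
  have hb : ∀ h : ℂ → ℂ, Integrable h (diskMeasure ν) →
      Integrable (fun ζ => h ζ * conj ζ ^ n) (diskMeasure ν) := fun h hh => by
    refine hh.mul_bdd (c := 1) (Complex.continuous_conj.pow n).aestronglyMeasurable ?_
    filter_upwards [ae_diskMeasure ν] with ζ hζ
    rw [norm_pow, RCLike.norm_conj]
    exact pow_le_one₀ (norm_nonneg _) (mem_UD.1 hζ).le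
  simp only [Pi.sub_apply, sub_mul]
  rw [integral_sub (hb _ hh₁) (hb _ hh₂)]
  ring

lemma Pw_const_mul {ν : ℂ → ℝ} (hν : RadialWeight ν) (c : ℂ) (h : ℂ → ℂ) (z : ℂ) :
    Pw ν (fun ζ => c * h ζ) z = c * Pw ν h z := by
  rw [Pw_eq hν, Pw_eq hν, ← integral_const_mul]
  simp only [mul_assoc]

lemma enorm_Pw_le {ν : ℂ → ℝ} (hν : RadialWeight ν) (h : ℂ → ℂ) (z : ℂ) :
    ‖Pw ν h z‖ₑ ≤ ∫⁻ ζ, ‖h ζ‖ₑ * ‖Bker ν z ζ‖ₑ ∂diskMeasure ν := by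
  rw [Pw_eq hν]
  refine (enorm_integral_le_lintegral_enorm _).trans (le_of_eq ?_)
  simp only [enorm_mul, RCLike.enorm_conj]

lemma norm_Bker_le {ν : ℂ → ℝ} (hν : RadialWeight ν) (hνp : WhatPos ν) {α B C : ℝ}
    (hN : RegularTail (tl ν) α B C) (hα : α < 1) (hαB : α < B) : ∃ K > (0 : ℝ),
    ∀ z ∈ UD, ∀ ζ ∈ UD, ‖Bker ν z ζ‖ ≤ K * bergMaj ν α z ζ := by
  obtain ⟨K, hK, h⟩ := exists_norm_tsum_mom_le hν hνp hN hα hαB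
  refine ⟨K, hK, fun z hz ζ hζ => ?_⟩
  have hz1 := mem_UD.1 hz
  have hζ1 := mem_UD.1 hζ
  have e : ‖ζ * conj z‖ = ‖z‖ * ‖ζ‖ := by rw [norm_mul, RCLike.norm_conj, mul_comm]
  have := h (ζ * conj z) (by rw [e]; nlinarith [norm_nonneg z, norm_nonneg ζ])
  rw [e, mul_comm ζ] at this
  rw [Bker, mul_comm ζ, bergMaj, ← mul_assoc]
  exact this

/-- The Bergman projection of a radial weight with regular tail is bounded on `L^q_ν`. -/
lemma lintegral_Pw_rpow_le {ν : ℂ → ℝ} (hν : RadialWeight ν) (hνp : WhatPos ν) {α B C q : ℝ}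
    (hN : RegularTail (tl ν) α B C) (hα : α < 1) (hαB : α < B) (hq : 1 < q) :
    ∃ K > (0 : ℝ), ∀ u : ℂ → ℂ, ContinuousOn u UD →
    ∫⁻ z, ‖Pw ν u z‖ₑ ^ q ∂diskMeasure ν ≤ ENNReal.ofReal K * ∫⁻ z, ‖u z‖ₑ ^ q ∂diskMeasure ν := by
  obtain ⟨K₁, hK₁, h1⟩ := norm_Bker_le hν hνp hN hα hαB
  obtain ⟨K₂, hK₂, h2⟩ := lintegral_bergMaj_rpow_le hν hνp hN hq
  have hq0 : 0 < q := by linarith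
  refine ⟨K₁ ^ q * K₂, by positivity, fun u hu => ?_⟩
  have h3 := h2 (fun z => ‖UD.indicator u z‖ₑ) (measurable_indicator_of_continuousOn hu).enorm
  have e : ∫⁻ z, ‖UD.indicator u z‖ₑ ^ q ∂diskMeasure ν = ∫⁻ z, ‖u z‖ₑ ^ q ∂diskMeasure ν := by
    refine lintegral_congr_ae ?_
    filter_upwards [ae_diskMeasure ν] with z hz
    rw [indicator_of_mem hz]
  rw [e] at h3
  rw [ENNReal.ofReal_mul (by positivity), mul_assoc]
  refine le_trans ?_ (mul_le_mul_right h3 _)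
  rw [← lintegral_const_mul' _ _ ENNReal.ofReal_ne_top]
  refine lintegral_mono_ae ?_
  filter_upwards [ae_diskMeasure ν] with z hz
  rw [← ENNReal.ofReal_rpow_of_nonneg hK₁.le hq0.le, ← ENNReal.mul_rpow_of_nonneg _ _ hq0.le]
  refine ENNReal.rpow_le_rpow ((enorm_Pw_le hν u z).trans ?_) hq0.le
  rw [← lintegral_const_mul' _ _ ENNReal.ofReal_ne_top]
  refine lintegral_mono_ae ?_
  filter_upwards [ae_diskMeasure ν] with ζ hζ
  rw [indicator_of_mem hζ, ← mul_assoc, mul_comm, ← ENNReal.ofReal_mul hK₁.le, ← ofReal_norm]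
  gcongr
  exact h1 z hz ζ hζ

/-- A symbol of controlled growth is integrable against `ν`. -/
lemma integrable_of_growth {ν : ℂ → ℝ} (hν : RadialWeight ν) (hνp : WhatPos ν) {α B C q ε K : ℝ}
    (hN : RegularTail (tl ν) α B C) (hq : 1 < q) (hε : 0 < ε) {f : ℂ → ℂ}
    (hfc : ContinuousOn f UD)
    (hf : ∀ z ∈ UD, tl ν (1 - ‖z‖) ^ (1 / q) * ‖f z - f 0‖ ≤ K * (1 - ‖z‖) ^ ε) :
    Integrable f (diskMeasure ν) := by
  have hq0 : 0 < q := by linarith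
  have := diskMeasure_finite hν
  obtain ⟨L, hL, h⟩ := lintegral_forelliRudin_weighted (ε := ε * q) (m := 0) hν hνp hN
    (by positivity) le_rfl
  have h0 := h 0 (mem_UD.2 (by simp))
  have hi : Integrable (fun z => f z - f 0) (diskMeasure ν) := by
    refine integrable_of_lintegral_rpow_lt_top hq.le
      (aestronglyMeasurable_of_continuousOn ν (hfc.sub continuousOn_const)) ?_
    have hb := ENNReal.mul_lt_top (ENNReal.ofReal_lt_top (r := |K| ^ q))
      (h0.trans_lt ENNReal.ofReal_lt_top)
    refine lt_of_le_of_lt ?_ hb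
    rw [← lintegral_const_mul' _ _ ENNReal.ofReal_ne_top]
    refine lintegral_mono_ae ?_
    filter_upwards [ae_diskMeasure ν] with z hz
    have hz1 := mem_UD.1 hz
    have hz0 := norm_nonneg z
    have ha : 0 < 1 - ‖z‖ := by linarith
    have hNp := tl_pos hν hνp ha (by linarith)
    have hNq : 0 < tl ν (1 - ‖z‖) ^ (1 / q) := by positivity
    have e1 : hk 0 z = 1 := by simp [hk]
    rw [e1, Real.one_rpow, mul_one, ← ENNReal.ofReal_mul (by positivity), ← ofReal_norm,
      ENNReal.ofReal_rpow_of_nonneg (norm_nonneg _) hq0.le]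
    refine ENNReal.ofReal_le_ofReal ?_
    have h2 := hf z hz
    rw [mul_comm, ← le_div_iff₀ hNq] at h2
    have h3 : ‖f z - f 0‖ ≤ |K| * ((1 - ‖z‖) ^ ε / tl ν (1 - ‖z‖) ^ (1 / q)) := by
      refine h2.trans ?_
      rw [mul_div_assoc]
      gcongr
      exact le_abs_self K
    refine (Real.rpow_le_rpow (norm_nonneg _) h3 hq0.le).trans (le_of_eq ?_)
    rw [Real.mul_rpow (abs_nonneg K) (by positivity), Real.div_rpow (by positivity) (by positivity),
      ← Real.rpow_mul ha.le, ← Real.rpow_mul hNp.le, one_div_mul_cancel hq0.ne', Real.rpow_one]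
  exact (hi.add (integrable_const (f 0))).congr (Filter.Eventually.of_forall fun z => by simp)

/-- A symbol of controlled growth is integrable against high standard weights. -/
lemma integrable_stdWeight_of_growth {ν : ℂ → ℝ} (hν : RadialWeight ν) (hνp : WhatPos ν)
    {α B C q ε K : ℝ} {n : ℕ} (hN : RegularTail (tl ν) α B C) (hq : 1 < q) (hε : 0 < ε)
    (hn : B ≤ 2 * n) {f : ℂ → ℂ} (hfc : ContinuousOn f UD)
    (hf : ∀ z ∈ UD, tl ν (1 - ‖z‖) ^ (1 / q) * ‖f z - f 0‖ ≤ K * (1 - ‖z‖) ^ ε) :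
    Integrable f (diskMeasure (stdWeight n)) := by
  have hq0 : 0 < q := by linarith
  have := diskMeasure_finite (radialWeight_stdWeight n)
  have := isFiniteMeasure_dA
  have hC := hN.one_le
  have hB := hN.beta_pos
  have hN1 := tl_pos hν hνp one_pos le_rfl
  set L := 2 ^ (2 * n) * (|K| * (C / tl ν 1) ^ (1 / q)) with hL
  have hi : Integrable (fun z => f z - f 0) (diskMeasure (stdWeight n)) := by
    refine ⟨aestronglyMeasurable_of_continuousOn _ (hfc.sub continuousOn_const), ?_⟩
    have hsm : Measurable fun ζ => ENNReal.ofReal (stdWeight n ζ) :=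
      (continuous_stdWeight n).measurable.ennreal_ofReal
    have hb : ∫⁻ _ in UD, ENNReal.ofReal L ∂dA < ∞ := by
      rw [lintegral_const]
      exact ENNReal.mul_lt_top ENNReal.ofReal_lt_top (measure_lt_top _ _)
    refine lt_of_le_of_lt ((lintegral_withDensity_le_lintegral_mul _ hsm _).trans
      (setLIntegral_mono' measurableSet_UD fun z hz => ?_)) hb
    have hz1 := mem_UD.1 hz
    have hz0 := norm_nonneg z
    have ha : 0 < 1 - ‖z‖ := by linarith
    have ha1 : 1 - ‖z‖ ≤ 1 := by linarith
    have hNp := tl_pos hν hνp ha (by linarith)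
    have hNq : 0 < tl ν (1 - ‖z‖) ^ (1 / q) := by positivity
    simp only [Pi.mul_apply]
    rw [← ofReal_norm, ← ENNReal.ofReal_mul (stdWeight_nonneg n z)]
    refine ENNReal.ofReal_le_ofReal ?_
    have h1 : stdWeight n z ≤ 2 ^ (2 * n) * (1 - ‖z‖) ^ (2 * n) := by
      rw [← mul_pow, stdWeight]
      have : 0 ≤ 1 - ‖z‖ ^ 2 := by nlinarith
      gcongr
      nlinarith
    have h2 := hf z hz
    rw [mul_comm, ← le_div_iff₀ hNq] at h2
    have h3 : (1 - ‖z‖) ^ ε ≤ 1 := Real.rpow_le_one ha.le ha1 hε.le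
    have h4 : (tl ν (1 - ‖z‖) ^ (1 / q))⁻¹ ≤ (C / tl ν 1) ^ (1 / q) * (1 - ‖z‖) ^ (-B) := by
      have h5 := hN.upper _ _ ha ha1 le_rfl
      have h6 : (tl ν (1 - ‖z‖))⁻¹ ≤ C / tl ν 1 * (1 - ‖z‖) ^ (-B) := by
        rw [one_div, Real.inv_rpow ha.le, ← Real.rpow_neg ha.le] at h5
        rw [inv_le_iff_one_le_mul₀ hNp, div_mul_eq_mul_div, div_mul_eq_mul_div, le_div_iff₀ hN1]
        linarith
      rw [← Real.inv_rpow hNp.le]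
      refine (Real.rpow_le_rpow (by positivity) h6 (by positivity)).trans ?_
      rw [Real.mul_rpow (by positivity) (by positivity), ← Real.rpow_mul ha.le]
      have h7 : (1 - ‖z‖) ^ (-B * (1 / q)) ≤ (1 - ‖z‖) ^ (-B) := by
        refine Real.rpow_le_rpow_of_exponent_ge ha ha1 ?_
        have : 1 / q ≤ 1 := by rw [div_le_one hq0]; exact hq.le
        nlinarith
      gcongr
    have h8 : (1 - ‖z‖) ^ (2 * n) * (1 - ‖z‖) ^ (-B) ≤ 1 := by
      rw [← Real.rpow_natCast, ← Real.rpow_add ha]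
      exact Real.rpow_le_one ha.le ha1 (by push_cast; linarith)
    calc stdWeight n z * ‖f z - f 0‖ ≤ (2 ^ (2 * n) * (1 - ‖z‖) ^ (2 * n)) *
          (|K| * 1 * ((C / tl ν 1) ^ (1 / q) * (1 - ‖z‖) ^ (-B))) := by
          refine mul_le_mul h1 (h2.trans ?_) (norm_nonneg _) (by positivity)
          rw [div_eq_mul_inv]
          refine mul_le_mul ?_ h4 (by positivity) (by positivity)
          gcongr
          exact le_abs_self K
      _ = L * ((1 - ‖z‖) ^ (2 * n) * (1 - ‖z‖) ^ (-B)) := by rw [hL]; ring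
      _ ≤ L * 1 := by gcongr
      _ = L := mul_one L
  exact (hi.add (integrable_const (f 0))).congr (Filter.Eventually.of_forall fun z => by simp)

lemma wnorm_eq_lintegral {ω : ℂ → ℝ} (hω : RadialWeight ω) {p : ℝ} (hp : 0 < p) {F : ℂ → ℂ}
    (hF : ContinuousOn F UD) :
    wnorm p ω F = (∫⁻ z, ‖F z‖ₑ ^ p ∂diskMeasure ω).toReal ^ (1 / p) := by
  have hm := measurable_indicator_of_continuousOn hF
  have h := setIntegral_mul_weight hω (h := fun z => ‖UD.indicator F z‖ ^ p)
    (fun z => by positivity) (by fun_prop)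
  have e1 : ∫ z in UD, ‖UD.indicator F z‖ ^ p * ω z ∂dA = ∫ z in UD, ‖F z‖ ^ p * ω z ∂dA :=
    setIntegral_congr_fun measurableSet_UD fun z hz => by simp only [indicator_of_mem hz]
  have e2 : ∫⁻ z, ENNReal.ofReal (‖UD.indicator F z‖ ^ p) ∂diskMeasure ω =
      ∫⁻ z, ‖F z‖ₑ ^ p ∂diskMeasure ω := by
    refine lintegral_congr_ae ?_
    filter_upwards [ae_diskMeasure ω] with z hz
    rw [indicator_of_mem hz, ← ofReal_norm, ENNReal.ofReal_rpow_of_nonneg (norm_nonneg _) hp.le]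
  rw [e1, e2] at h
  rw [wnorm, h]

lemma lintegral_enorm_rpow_lt_top {ω : ℂ → ℝ} (hω : RadialWeight ω) {p : ℝ} (hp : 0 < p)
    {g : ℂ → ℂ} (hg : Hinfty g) : ∫⁻ z, ‖g z‖ₑ ^ p ∂diskMeasure ω < ∞ := by
  obtain ⟨-, M, hM⟩ := hg
  have := diskMeasure_finite hω
  have hb : ∫⁻ _, ENNReal.ofReal M ^ p ∂diskMeasure ω < ∞ := by
    rw [lintegral_const]
    exact ENNReal.mul_lt_top (ENNReal.rpow_lt_top_of_nonneg hp.le ENNReal.ofReal_ne_top)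
      (measure_lt_top _ _)
  refine lt_of_le_of_lt (lintegral_mono_ae ?_) hb
  filter_upwards [ae_diskMeasure ω] with z hz
  rw [← ofReal_norm]
  gcongr
  exact hM z hz

lemma Hinfty.integrable_mul {ν : ℂ → ℝ} {f g : ℂ → ℂ} (hg : Hinfty g)
    (hf : Integrable f (diskMeasure ν)) : Integrable (fun z => f z * g z) (diskMeasure ν) := by
  obtain ⟨hgd, M, hM⟩ := hg
  refine hf.mul_bdd (c := M) (aestronglyMeasurable_of_continuousOn ν hgd.continuousOn) ?_
  filter_upwards [ae_diskMeasure ν] with z hz using hM z hz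

lemma Hinfty.integrable {ν : ℂ → ℝ} {g : ℂ → ℂ} (hν : RadialWeight ν) (hg : Hinfty g) :
    Integrable g (diskMeasure ν) := by
  have := diskMeasure_finite hν
  simpa using hg.integrable_mul (integrable_const (μ := diskMeasure ν) (1 : ℂ))

lemma lintegral_Hankel_le {p q : ℝ} {ν ω κ : ℂ → ℝ} {f : ℂ → ℂ} {K₁ K₂ : ℝ} (hq : 1 < q)
    (hp : 0 < p) (hν : RadialWeight ν) (hνp : WhatPos ν) (hκ : RadialWeight κ) (hκp : WhatPos κ)
    (hω : RadialWeight ω) (hf : ContinuousOn f UD)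
    (hfν : Integrable f (diskMeasure ν)) (hfκ : Integrable f (diskMeasure κ))
    (hK₂ : 0 < K₂)
    (h1 : ∀ g : ℂ → ℂ, Measurable g → DifferentiableOn ℂ g UD →
      ∫⁻ z, (∫⁻ ζ, ‖f z - f ζ‖ₑ * ‖g ζ‖ₑ * ‖Bker κ z ζ‖ₑ ∂diskMeasure κ) ^ q ∂diskMeasure ν ≤
      ENNReal.ofReal K₁ * (∫⁻ z, ‖g z‖ₑ ^ p ∂diskMeasure ω) ^ (q / p))
    (h2 : ∀ u : ℂ → ℂ, ContinuousOn u UD → ∫⁻ z, ‖Pw ν u z‖ₑ ^ q ∂diskMeasure ν ≤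
      ENNReal.ofReal K₂ * ∫⁻ z, ‖u z‖ₑ ^ q ∂diskMeasure ν) {g : ℂ → ℂ} (hg : Hinfty g) :
    ∫⁻ z, ‖Hankel ν f g z‖ₑ ^ q ∂diskMeasure ν ≤
      ENNReal.ofReal (2 ^ (q - 1) * ((1 + K₂) * K₁)) *
        (∫⁻ z, ‖g z‖ₑ ^ p ∂diskMeasure ω) ^ (q / p) := by
  have hq0 : 0 < q := by linarith
  have hgc := hg.1.continuousOn
  have := diskMeasure_finite hν
  set v := Pw κ (fun ζ => f ζ * g ζ) with hv
  set u := fun z => f z * g z - v z with hu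
  have hvd : DifferentiableOn ℂ v UD := differentiableOn_Pw hκ hκp (hg.integrable_mul hfκ)
  have huc : ContinuousOn u UD := (hf.mul hgc).sub hvd.continuousOn
  have hcomm : ∀ z ∈ UD, ‖u z‖ₑ ≤
      ∫⁻ ζ, ‖f z - f ζ‖ₑ * ‖UD.indicator g ζ‖ₑ * ‖Bker κ z ζ‖ₑ ∂diskMeasure κ := by
    intro z hz
    have e : u z = Pw κ (fun ζ => f z * g ζ - f ζ * g ζ) z := by
      rw [Pw_sub hκ hκp ((hg.integrable hκ).const_mul _) (hg.integrable_mul hfκ) hz,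
        Pw_const_mul hκ, Pw_eq_self hκ hκp hg.1 (hg.integrable hκ) hz]
    rw [e]
    refine (enorm_Pw_le hκ _ z).trans (le_of_eq (lintegral_congr_ae ?_))
    filter_upwards [ae_diskMeasure κ] with ζ hζ
    rw [indicator_of_mem hζ, ← sub_mul, enorm_mul]
  have hu1 : ∫⁻ z, ‖u z‖ₑ ^ q ∂diskMeasure ν ≤
      ENNReal.ofReal K₁ * (∫⁻ z, ‖g z‖ₑ ^ p ∂diskMeasure ω) ^ (q / p) := by
    have h3 := h1 (UD.indicator g) (measurable_indicator_of_continuousOn hgc)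
      (hg.1.congr fun z hz => indicator_of_mem hz g)
    have e : ∫⁻ z, ‖UD.indicator g z‖ₑ ^ p ∂diskMeasure ω = ∫⁻ z, ‖g z‖ₑ ^ p ∂diskMeasure ω := by
      refine lintegral_congr_ae ?_
      filter_upwards [ae_diskMeasure ω] with z hz
      rw [indicator_of_mem hz]
    rw [e] at h3
    refine le_trans (lintegral_mono_ae ?_) h3
    filter_upwards [ae_diskMeasure ν] with z hz
    exact ENNReal.rpow_le_rpow (hcomm z hz) hq0.le
  have hG := lintegral_enorm_rpow_lt_top hω hp hg
  have hui : Integrable u (diskMeasure ν) :=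
    integrable_of_lintegral_rpow_lt_top hq.le (aestronglyMeasurable_of_continuousOn ν huc)
      (hu1.trans_lt (ENNReal.mul_lt_top ENNReal.ofReal_lt_top
        (ENNReal.rpow_lt_top_of_nonneg (by positivity) hG.ne)))
  have hvi : Integrable v (diskMeasure ν) :=
    ((hg.integrable_mul hfν).sub hui).congr (Filter.Eventually.of_forall fun z => by
      simp only [hu, Pi.sub_apply, sub_sub_cancel])
  have hHankel : ∀ z ∈ UD, Hankel ν f g z = u z - Pw ν u z := by
    intro z hz
    rw [Hankel, hu, Pw_sub hν hνp (hg.integrable_mul hfν) hvi hz, Pw_eq_self hν hνp hvd hvi hz]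
    ring
  calc ∫⁻ z, ‖Hankel ν f g z‖ₑ ^ q ∂diskMeasure ν
      ≤ ∫⁻ z, 2 ^ (q - 1) * (‖u z‖ₑ ^ q + ‖Pw ν u z‖ₑ ^ q) ∂diskMeasure ν := by
        refine lintegral_mono_ae ?_
        filter_upwards [ae_diskMeasure ν] with z hz
        rw [hHankel z hz]
        exact (ENNReal.rpow_le_rpow enorm_sub_le hq0.le).trans
          (ENNReal.rpow_add_le_mul_rpow_add_rpow _ _ hq.le)
    _ = 2 ^ (q - 1) * (∫⁻ z, ‖u z‖ₑ ^ q ∂diskMeasure ν +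
          ∫⁻ z, ‖Pw ν u z‖ₑ ^ q ∂diskMeasure ν) := by
        rw [lintegral_const_mul' _ _ (ENNReal.rpow_ne_top_of_nonneg (by linarith) (by simp)),
          lintegral_add_left' ((aestronglyMeasurable_of_continuousOn ν huc).enorm.pow_const q)]
    _ ≤ 2 ^ (q - 1) * ((1 + ENNReal.ofReal K₂) * ∫⁻ z, ‖u z‖ₑ ^ q ∂diskMeasure ν) := by
        rw [add_mul, one_mul]
        gcongr
        exact h2 u huc
    _ ≤ 2 ^ (q - 1) * ((1 + ENNReal.ofReal K₂) * (ENNReal.ofReal K₁ *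
          (∫⁻ z, ‖g z‖ₑ ^ p ∂diskMeasure ω) ^ (q / p))) := by gcongr
    _ = _ := by
        rw [ENNReal.ofReal_mul (by positivity), ENNReal.ofReal_mul (by positivity),
          ENNReal.ofReal_add zero_le_one hK₂.le, ENNReal.ofReal_one,
          ← ENNReal.ofReal_rpow_of_pos two_pos, ENNReal.ofReal_ofNat]
        ring

lemma wnorm_le_of_lintegral_le {p q K : ℝ} {ν ω : ℂ → ℝ} (hν : RadialWeight ν)
    (hω : RadialWeight ω) (hp : 0 < p) (hq : 0 < q) (hK : 0 ≤ K) {F g : ℂ → ℂ}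
    (hF : ContinuousOn F UD) (hg : Hinfty g)
    (h : ∫⁻ z, ‖F z‖ₑ ^ q ∂diskMeasure ν ≤
      ENNReal.ofReal K * (∫⁻ z, ‖g z‖ₑ ^ p ∂diskMeasure ω) ^ (q / p)) :
    wnorm q ν F ≤ K ^ (1 / q) * wnorm p ω g := by
  rw [wnorm_eq_lintegral hν hq hF, wnorm_eq_lintegral hω hp hg.1.continuousOn]
  have hG := lintegral_enorm_rpow_lt_top hω hp hg
  have h1 := ENNReal.toReal_mono (ENNReal.mul_ne_top ENNReal.ofReal_ne_top
    (ENNReal.rpow_ne_top_of_nonneg (by positivity) hG.ne)) h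
  rw [ENNReal.toReal_mul, ENNReal.toReal_ofReal hK, ← ENNReal.toReal_rpow] at h1
  refine (Real.rpow_le_rpow ENNReal.toReal_nonneg h1 (by positivity)).trans (le_of_eq ?_)
  rw [Real.mul_rpow hK (by positivity), ← Real.rpow_mul ENNReal.toReal_nonneg]
  congr 2
  field_simp

/-- Proposition 5.2: if `ν ∈ B_q` is radial, `ω ∈ D` and the symbol `f`
belongs to `BO(Δ)`, then `H^ν_f : A^p_ω → L^q_ν` is bounded. -/
theorem BO_implies_hankel_bounded (p q : ℝ) (hp : 1 < p) (hpq : p ≤ q)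
    (ν ω : ℂ → ℝ) (hν : RadialWeight ν) (hνp : WhatPos ν) (hνq : Bq q ν)
    (hω : RadialWeight ω) (hωp : WhatPos ω) (hωD : Dclass ω)
    (f : ℂ → ℂ) (hf : ContinuousOn f UD)
    (r : ℝ) (hr : 0 < r)
    (hBO : ∃ M : ℝ, ∀ z ∈ UD, ∀ ζ ∈ UD, hyp z ζ < r →
      ‖f z - f ζ‖ * gam ω ν p q z ≤ M) :
    ∃ C > (0 : ℝ), ∀ g : ℂ → ℂ, Hinfty g →
      wnorm q ν (Hankel ν f g) ≤ C * wnorm p ω g := by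
  have hp0 : 0 < p := by linarith
  have hq : 1 < q := by linarith
  obtain ⟨α₀, B₀, C₀, hN₀⟩ := exists_regularTail hν hνp (Dclass_of_Bq hq hν hνp hνq)
  obtain ⟨α', B', C', hW₀⟩ := exists_regularTail hω hωp hωD
  have hW := regularTail_tl hω hωp hW₀
  have hN := (regularTail_tl hν hνp hN₀).weaken (α' := min α₀ (1 / 2)) (B' := max B₀ 1)
    (lt_min hN₀.alpha_pos (by norm_num)) (min_le_left _ _) (le_max_left _ _) le_rfl
  set α := min α₀ (1 / 2)
  set B := max B₀ 1
  have hα : α ≤ 1 / 2 := min_le_right _ _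
  have hB : 1 ≤ B := le_max_right _ _
  obtain ⟨ε, D, K, hε, hD, hK, hosc⟩ :=
    exists_oscillation_bound hν hνp hω hωp hN hW hp hpq hr hBO
  obtain ⟨n, hn⟩ := exists_nat_ge (max B D)
  have hnB : B ≤ 2 * n := by have := le_max_left B D; linarith
  have hnD : D ≤ 2 * n := by have := le_max_right B D; linarith
  have hgrowth : ∀ z ∈ UD, tl ν (1 - ‖z‖) ^ (1 / q) * ‖f z - f 0‖ ≤
      K * growthFactor ω p q 1 * (1 - ‖z‖) ^ ε := fun z hz => by
    have := hosc z hz 0 (mem_UD.2 (by simp))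
    simpa [hk, mul_assoc] using this
  obtain ⟨K₁, hK₁, h1⟩ := lintegral_commutator_le hν hνp hω hωp hN hW hp hpq hε hK hnD hosc
  obtain ⟨K₂, hK₂, h2⟩ := lintegral_Pw_rpow_le hν hνp hN (by linarith) (by linarith) hq
  have hfν := integrable_of_growth hν hνp hN hq hε hf hgrowth
  have hfκ := integrable_stdWeight_of_growth hν hνp hN hq hε hnB hf hgrowth
  refine ⟨(2 ^ (q - 1) * ((1 + K₂) * K₁)) ^ (1 / q), by positivity, fun g hg => ?_⟩
  refine wnorm_le_of_lintegral_le hν hω hp0 (by linarith) (by positivity) ?_ hg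
    (lintegral_Hankel_le hq hp0 hν hνp (radialWeight_stdWeight n) (whatPos_stdWeight n) hω hf hfν
      hfκ hK₂ h1 h2 hg)
  exact (hf.mul hg.1.continuousOn).sub
    (differentiableOn_Pw hν hνp (hg.integrable_mul hfν)).continuousOn
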